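/- arXiv:2501.19379 — 3 statements merged into one kernel-verified Lean document; each statement's English description precedes it below -/
import Mathlib

section
/- Assume R is a ℚ-algebra. Let P be a prime perfect D-ideal of R{x̄}_{D*} with characteristic set 𝒞, let H = ∏_{c∈𝒞} I_c s_c and B = P ∩ R. Then H ∉ P and P = ⟨𝒞 ∪ B⟩_D : H^∞, where ⟨·⟩_D denotes the reflexive D-ideal generated and J : H^∞ = {f : H^n f ∈ J for some n}. -/
open MvPolynomial
open scoped BigOperators

/-- The variables `dᶿxⱼ` of the `D*`-polynomial ring in `n` indeterminates with `M`
operators: a pair (index of `x`, multi-exponent `θ ∈ ℕ^M`). -/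
abbrev DVar (n M : ℕ) : Type := Fin n × (Fin M → ℕ)

/-- Applying the composite operator with multi-exponent `φ` to a variable. -/
def shiftVar {n M : ℕ} (u : DVar n M) (φ : Fin M → ℕ) : DVar n M :=
  (u.1, fun l => u.2 l + φ l)

/-- `φ` encodes a composition of the associated endomorphisms only (a `σ`-transform). -/
def IsSigmaExp {M : ℕ} (σset : Finset (Fin M)) (φ : Fin M → ℕ) : Prop :=
  ∀ k, φ k ≠ 0 → k ∈ σset

/-- `φ` encodes a composition of operators involving at least one derivation-type
operator (a `δ`-transform). -/
def IsDeltaExp {M : ℕ} (σset : Finset (Fin M)) (φ : Fin M → ℕ) : Prop :=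
  ∃ k, k ∉ σset ∧ φ k ≠ 0

/-- `u` is the leader of `f`: the highest-ranked variable occurring in `f`. -/
def IsLeader {R : Type} [CommRing R] {n M : ℕ} (lt : DVar n M → DVar n M → Prop)
    (f : MvPolynomial (DVar n M) R) (u : DVar n M) : Prop :=
  u ∈ f.vars ∧ ∀ v ∈ f.vars, v ≠ u → lt v u

/-- `f` lies in (the image of) `R`, i.e. is a constant polynomial. -/
def IsConst {R : Type} [CommRing R] {n M : ℕ} (f : MvPolynomial (DVar n M) R) : Prop :=
  ∃ r : R, f = C r

/-- `g` is reduced with respect to `f`: `g` contains no `δ`-transform of the leader of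
`f`, and every `σ`-transform of the leader of `f` occurs in `g` with degree `< deg f`. -/
def ReducedWrt {R : Type} [CommRing R] {n M : ℕ} (lt : DVar n M → DVar n M → Prop)
    (σset : Finset (Fin M)) (g f : MvPolynomial (DVar n M) R) : Prop :=
  ∀ u : DVar n M, IsLeader lt f u →
    (∀ φ : Fin M → ℕ, IsDeltaExp σset φ → shiftVar u φ ∉ g.vars) ∧
    (∀ φ : Fin M → ℕ, IsSigmaExp σset φ →
      degreeOf (shiftVar u φ) g < degreeOf u f)

/-- `g` is reduced with respect to every element of `A`. -/
def ReducedWrtSet {R : Type} [CommRing R] {n M : ℕ} (lt : DVar n M → DVar n M → Prop)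
    (σset : Finset (Fin M)) (g : MvPolynomial (DVar n M) R)
    (A : Set (MvPolynomial (DVar n M) R)) : Prop :=
  ∀ f ∈ A, ReducedWrt lt σset g f

/-- `A` is autoreduced: no element is constant and any two distinct elements are reduced
with respect to each other. -/
def Autoreduced {R : Type} [CommRing R] {n M : ℕ} (lt : DVar n M → DVar n M → Prop)
    (σset : Finset (Fin M)) (A : Set (MvPolynomial (DVar n M) R)) : Prop :=
  (∀ f ∈ A, ¬ IsConst f) ∧
  ∀ f ∈ A, ∀ g ∈ A, f ≠ g → ReducedWrt lt σset g f

/-- `rk f < rk g`: the leader of `f` is below that of `g`, or they coincide and the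
leading degree of `f` is smaller. -/
def RkLt {R : Type} [CommRing R] {n M : ℕ} (lt : DVar n M → DVar n M → Prop)
    (f g : MvPolynomial (DVar n M) R) : Prop :=
  ∃ uf ug, IsLeader lt f uf ∧ IsLeader lt g ug ∧
    (lt uf ug ∨ (uf = ug ∧ degreeOf uf f < degreeOf ug g))

/-- `rk f = rk g`: same leader and same leading degree. -/
def RkEq {R : Type} [CommRing R] {n M : ℕ} (lt : DVar n M → DVar n M → Prop)
    (f g : MvPolynomial (DVar n M) R) : Prop :=
  ∃ uf ug, IsLeader lt f uf ∧ IsLeader lt g ug ∧ uf = ug ∧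
    degreeOf uf f = degreeOf ug g

/-- `rk f ≤ rk g` (with constants of lowest rank). -/
def RkLe {R : Type} [CommRing R] {n M : ℕ} (lt : DVar n M → DVar n M → Prop)
    (f g : MvPolynomial (DVar n M) R) : Prop :=
  IsConst f ∨ RkLt lt f g ∨ RkEq lt f g

/-- `lt` is a ranking of the variables, with `σ`-operators `σset` and operator ranks `ν`. -/
structure IsRanking {n M : ℕ} (lt : DVar n M → DVar n M → Prop)
    (σset : Finset (Fin M)) (ν : Fin M → ℕ) : Prop where
  trichot : ∀ u v, lt u v ∨ u = v ∨ lt v u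
  irrefl : ∀ u, ¬ lt u u
  trans : ∀ u v w, lt u v → lt v w → lt u w
  wf : WellFounded lt
  lt_op : ∀ (u : DVar n M) (k : Fin M), lt u (shiftVar u (Pi.single k 1))
  mono : ∀ (u v : DVar n M) (k : Fin M), lt u v →
    lt (shiftVar u (Pi.single k 1)) (shiftVar v (Pi.single k 1))
  op_ord : ∀ (u : DVar n M) (k k' : Fin M), ν k < ν k' →
    lt (shiftVar u (Pi.single k 1)) (shiftVar u (Pi.single k' 1))
  nu_sigma : ∀ k ∈ σset, ν k = 0

/-- Lexicographic comparison of two rank-sorted lists of `D*`-polynomials. -/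
def PrecList {R : Type} [CommRing R] {n M : ℕ} (lt : DVar n M → DVar n M → Prop)
    (la lb : List (MvPolynomial (DVar n M) R)) : Prop :=
  (∃ i : ℕ, i < la.length ∧ i < lb.length ∧
      RkLt lt (la.getD i 0) (lb.getD i 0) ∧
      ∀ j < i, RkEq lt (la.getD j 0) (lb.getD j 0)) ∨
  (lb.length < la.length ∧ ∀ i < lb.length, RkEq lt (la.getD i 0) (lb.getD i 0))

/-- The pre-order `A ≺ B` on autoreduced (finite) sets of `D*`-polynomials. -/
def Prec {R : Type} [CommRing R] {n M : ℕ} (lt : DVar n M → DVar n M → Prop)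
    (A B : Finset (MvPolynomial (DVar n M) R)) : Prop :=
  ∃ la lb : List (MvPolynomial (DVar n M) R),
    la.Nodup ∧ lb.Nodup ∧ (∀ f, f ∈ la ↔ f ∈ A) ∧ (∀ f, f ∈ lb ↔ f ∈ B) ∧
    la.Pairwise (RkLt lt) ∧ lb.Pairwise (RkLt lt) ∧ PrecList lt la lb

/-- The initial of `f` with respect to the variable `u`: the leading coefficient of `f`
viewed as a univariate polynomial in `u`. -/
noncomputable def initialOf {R : Type} [CommRing R] {n M : ℕ} (u : DVar n M)
    (f : MvPolynomial (DVar n M) R) : MvPolynomial (DVar n M) R :=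
  ∑ d ∈ f.support.filter (fun d => d u = degreeOf u f),
    monomial (d.erase u) (coeff d f)

/-- `𝒞` is a characteristic set of the ideal `I`: a minimal element (for `≺`) of the
collection of autoreduced subsets `A ⊆ I` with `s_f ∉ I` for all `f ∈ A`. -/
def IsCharSet {R : Type} [CommRing R] {n M : ℕ} (lt : DVar n M → DVar n M → Prop)
    (σset : Finset (Fin M)) (I : Ideal (MvPolynomial (DVar n M) R))
    (𝒞 : Finset (MvPolynomial (DVar n M) R)) : Prop :=
  (Autoreduced lt σset (𝒞 : Set (MvPolynomial (DVar n M) R)) ∧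
    (𝒞 : Set (MvPolynomial (DVar n M) R)) ⊆ (I : Set (MvPolynomial (DVar n M) R)) ∧
    ∀ f ∈ 𝒞, ∀ u : DVar n M, IsLeader lt f u → pderiv u f ∉ I) ∧
  ∀ B : Finset (MvPolynomial (DVar n M) R),
    Autoreduced lt σset (B : Set (MvPolynomial (DVar n M) R)) →
    (B : Set (MvPolynomial (DVar n M) R)) ⊆ (I : Set (MvPolynomial (DVar n M) R)) →
    (∀ f ∈ B, ∀ u : DVar n M, IsLeader lt f u → pderiv u f ∉ I) →
    ¬ Prec lt B 𝒞

/-- The coordinate operators of a `D*`-ring structure (with respect to a ranked basis of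
`D`) on a commutative `K`-algebra `A`: operators `δ k`, the subset `σset` of associated
endomorphisms, the map `fac` sending each operator to the associated endomorphism of its
local factor, operator ranks `ν`, and structure constants `α`, subject to additivity,
`K`-linearity, pairwise commutativity, multiplicativity and injectivity of the associated
endomorphisms, and the twisted Leibniz rule of the ranked basis. -/
structure DStarOps (K : Type) [Field K] (A : Type) [CommRing A] [Algebra K A]
    (M : ℕ) where
  δ : Fin M → A → A
  σset : Finset (Fin M)
  fac : Fin M → Fin M
  ν : Fin M → ℕ
  α : Fin M → Fin M → Fin M → K
  map_add : ∀ (k : Fin M) (a b : A), δ k (a + b) = δ k a + δ k b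
  map_smul : ∀ (k : Fin M) (c : K) (a : A), δ k (c • a) = c • δ k a
  comm : ∀ (k l : Fin M) (a : A), δ k (δ l a) = δ l (δ k a)
  fac_mem : ∀ k, fac k ∈ σset
  fac_sigma : ∀ k ∈ σset, fac k = k
  sigma_one : ∀ k ∈ σset, δ k 1 = 1
  sigma_mul : ∀ k ∈ σset, ∀ a b : A, δ k (a * b) = δ k a * δ k b
  sigma_inj : ∀ k ∈ σset, Function.Injective (δ k)
  nu_sigma : ∀ k ∈ σset, ν k = 0
  nu_delta : ∀ k ∉ σset, 1 ≤ ν k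
  prod_rule : ∀ k ∉ σset, ∀ a b : A,
    δ k (a * b) = δ k a * δ (fac k) b + δ (fac k) a * δ k b +
      ∑ pq ∈ Finset.univ.filter
          (fun pq : Fin M × Fin M =>
            pq.1 ∉ σset ∧ pq.2 ∉ σset ∧ fac pq.1 = fac k ∧ fac pq.2 = fac k ∧
              ν pq.1 + ν pq.2 ≤ ν k),
        α k pq.1 pq.2 • (δ pq.1 a * δ pq.2 b)

variable {K : Type} [Field K] {A : Type} [CommRing A] [Algebra K A] {M : ℕ}

/-- Applying a composite of the operators along a list of indices. -/
def applyWord (op : DStarOps K A M) (w : List (Fin M)) (a : A) : A :=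
  w.foldr (fun k x => op.δ k x) a

/-- `b` is a `σ`-transform of `a`: the image of `a` under a composition of the
associated endomorphisms. -/
def IsSigmaTransform (op : DStarOps K A M) (a b : A) : Prop :=
  ∃ w : List (Fin M), (∀ k ∈ w, k ∈ op.σset) ∧ b = applyWord op w a

/-- An ideal closed under all the operators (a `D`-ideal). -/
def IsDIdeal (op : DStarOps K A M) (I : Ideal A) : Prop :=
  ∀ k : Fin M, ∀ a ∈ I, op.δ k a ∈ I

/-- A reflexive ideal: `a·σᵢ(a) ∈ I` implies `a ∈ I`. -/
def IsReflexive (op : DStarOps K A M) (I : Ideal A) : Prop :=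
  ∀ k ∈ op.σset, ∀ a : A, a * op.δ k a ∈ I → a ∈ I

/-- A perfect `D`-ideal: a radical, reflexive `D`-ideal. -/
def IsPerfectDIdeal (op : DStarOps K A M) (I : Ideal A) : Prop :=
  IsDIdeal op I ∧ IsReflexive op I ∧ I.IsRadical

/-- Membership in the `D`-ideal `[S]_D` generated by `S`. -/
def InDIdealGen (op : DStarOps K A M) (S : Set A) (a : A) : Prop :=
  ∀ I : Ideal A, S ⊆ I → IsDIdeal op I → a ∈ I

/-- Membership in the reflexive `D`-ideal `⟨S⟩_D` generated by `S`. -/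
def InReflexiveDIdealGen (op : DStarOps K A M) (S : Set A) (a : A) : Prop :=
  ∀ I : Ideal A, S ⊆ I → IsDIdeal op I → IsReflexive op I → a ∈ I

namespace DStarAux

/-- The coefficient of `u ^ i` in `f`. -/
noncomputable def coefU {τ R : Type} [CommRing R] (u : τ) (i : ℕ)
    (f : MvPolynomial τ R) : MvPolynomial τ R :=
  ∑ d ∈ f.support.filter (fun d => d u = i), monomial (d.erase u) (coeff d f)

theorem mem_vars_iff {τ R : Type} [CommRing R] (u : τ) (f : MvPolynomial τ R) :
    u ∈ f.vars ↔ degreeOf u f ≠ 0 := by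
  classical
  rw [vars_def, degreeOf_def, Multiset.mem_toFinset, Multiset.count_ne_zero]

theorem degreeOf_zero_of {τ R : Type} [CommRing R] {u : τ} {f : MvPolynomial τ R}
    (h : u ∉ f.vars) : degreeOf u f = 0 := by
  rw [mem_vars_iff] at h; simpa using h

theorem degreeOf_sum_le' {τ R ι : Type} [CommRing R] (u : τ) (s : Finset ι)
    (F : ι → MvPolynomial τ R) (k : ℕ) (h : ∀ i ∈ s, degreeOf u (F i) ≤ k) :
    degreeOf u (∑ i ∈ s, F i) ≤ k :=
  (degreeOf_sum_le u s F).trans (Finset.sup_le h)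

theorem degreeOf_monomial_le {τ R : Type} [CommRing R] (u : τ) (d : τ →₀ ℕ) (a : R) :
    degreeOf u (monomial d a) ≤ d u := by
  by_cases ha : a = 0
  · simp [ha]
  · rw [degreeOf_monomial_eq d u ha]

theorem coefU_degreeOf_le {τ R : Type} [CommRing R] (u v : τ) (i : ℕ)
    (f : MvPolynomial τ R) : degreeOf v (coefU u i f) ≤ degreeOf v f := by
  classical
  refine degreeOf_sum_le' _ _ _ _ fun d hd => (degreeOf_monomial_le _ _ _).trans ?_
  refine le_trans ?_ (monomial_le_degreeOf v (Finset.mem_filter.1 hd).1)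
  by_cases h : v = u
  · subst h; simp
  · rw [Finsupp.erase_ne h]

theorem coefU_degreeOf_self {τ R : Type} [CommRing R] (u : τ) (i : ℕ)
    (f : MvPolynomial τ R) : degreeOf u (coefU u i f) = 0 := by
  classical
  refine Nat.le_zero.1 (degreeOf_sum_le' _ _ _ _ fun d hd => (degreeOf_monomial_le _ _ _).trans ?_)
  simp

theorem coefU_expand {τ R : Type} [CommRing R] (u : τ) (f : MvPolynomial τ R) :
    f = ∑ i ∈ Finset.range (degreeOf u f + 1), coefU u i f * X u ^ i := by
  classical
  have h1 : ∀ i ∈ Finset.range (degreeOf u f + 1), coefU u i f * X u ^ i =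
      ∑ d ∈ f.support with d u = i, monomial d (coeff d f) := by
    intro i _
    rw [coefU, Finset.sum_mul]
    refine Finset.sum_congr rfl fun d hd => ?_
    rw [← (Finset.mem_filter.1 hd).2, X_pow_eq_monomial, monomial_mul, mul_one,
      Finsupp.erase_add_single]
  rw [Finset.sum_congr rfl h1, Finset.sum_fiberwise_of_maps_to]
  · exact f.support_sum_monomial_coeff.symm
  · intro d hd
    exact Finset.mem_range.2 (Nat.lt_succ_of_le (monomial_le_degreeOf u hd))

/-- the non-leading part -/
noncomputable def restU {τ R : Type} [CommRing R] (u : τ)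
    (f : MvPolynomial τ R) : MvPolynomial τ R :=
  ∑ i ∈ Finset.range (degreeOf u f), coefU u i f * X u ^ i

theorem expand_rest {τ R : Type} [CommRing R] (u : τ) (f : MvPolynomial τ R) :
    f = coefU u (degreeOf u f) f * X u ^ (degreeOf u f) + restU u f := by
  conv_lhs => rw [coefU_expand u f]
  rw [Finset.sum_range_succ, add_comm, restU]

theorem degreeOf_X_pow_le {τ R : Type} [CommRing R] (u : τ) (i : ℕ) :
    degreeOf u ((X u : MvPolynomial τ R) ^ i) ≤ i := by
  rw [X_pow_eq_monomial]
  exact (degreeOf_monomial_le _ _ _).trans (by simp)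

theorem restU_degreeOf_le {τ R : Type} [CommRing R] (u v : τ)
    (f : MvPolynomial τ R) : degreeOf v (restU u f) ≤ degreeOf v f := by
  refine degreeOf_sum_le' _ _ _ _ fun i hi => (degreeOf_mul_le _ _ _).trans ?_
  by_cases h : v = u
  · subst h
    rw [coefU_degreeOf_self, zero_add]
    exact (degreeOf_X_pow_le _ _).trans (Finset.mem_range.1 hi).le
  · rw [degreeOf_X_pow_of_ne _ h, add_zero]
    exact coefU_degreeOf_le _ _ _ _

theorem restU_degreeOf_lt {τ R : Type} [CommRing R] (u : τ)
    (f : MvPolynomial τ R) (h : 0 < degreeOf u f) : degreeOf u (restU u f) < degreeOf u f := by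
  suffices degreeOf u (restU u f) ≤ degreeOf u f - 1 by omega
  refine degreeOf_sum_le' _ _ _ _ fun i hi => (degreeOf_mul_le _ _ _).trans ?_
  rw [coefU_degreeOf_self, zero_add]
  have := Finset.mem_range.1 hi
  exact (degreeOf_X_pow_le _ _).trans (by omega)

theorem pderiv_zero_of {τ R : Type} [CommRing R] {u : τ} {f : MvPolynomial τ R}
    (h : degreeOf u f = 0) : pderiv u f = 0 :=
  pderiv_eq_zero_of_notMem_vars (by rw [mem_vars_iff]; simpa using h)

theorem pderiv_degreeOf_le {τ R : Type} [CommRing R] (u v : τ) (f : MvPolynomial τ R) :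
    degreeOf v (pderiv u f) ≤ degreeOf v f := by
  classical
  rw [degreeOf_le_iff]
  intro m hm
  rw [mem_support_iff, coeff_pderiv] at hm
  have : m + Finsupp.single u 1 ∈ f.support := by
    rw [mem_support_iff]; intro h; rw [h] at hm; simp at hm
  have := monomial_le_degreeOf v this
  simp only [Finsupp.add_apply] at this
  omega

theorem pderiv_degreeOf_lt {τ R : Type} [CommRing R] (u : τ) (f : MvPolynomial τ R)
    (h0 : 0 < degreeOf u f) : degreeOf u (pderiv u f) < degreeOf u f := by
  classical
  rw [degreeOf_lt_iff h0]
  intro m hm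
  rw [mem_support_iff, coeff_pderiv] at hm
  have : m + Finsupp.single u 1 ∈ f.support := by
    rw [mem_support_iff]; intro h; rw [h] at hm; simp at hm
  have := monomial_le_degreeOf u this
  simp only [Finsupp.add_apply, Finsupp.single_eq_same] at this
  omega

theorem coeff_coefU_zero {τ R : Type} [CommRing R] (u : τ) (f : MvPolynomial τ R)
    (d : τ →₀ ℕ) (hd : d u = 0) : coeff d (coefU u 0 f) = coeff d f := by
  classical
  have : coefU u 0 f = ∑ d ∈ f.support with d u = 0, monomial d (coeff d f) := by
    refine Finset.sum_congr rfl fun d hd => ?_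
    rw [Finsupp.erase_of_notMem_support]
    simpa using (Finset.mem_filter.1 hd).2
  rw [this, coeff_sum]
  simp only [coeff_monomial, Finset.sum_ite_eq']
  simp only [Finset.mem_filter, mem_support_iff, hd, and_true]
  split_ifs with h
  · rfl
  · simpa using (not_not.1 h).symm

theorem coeff_coefU_zero' {τ R : Type} [CommRing R] (u : τ) (f : MvPolynomial τ R)
    (d : τ →₀ ℕ) (hd : d u ≠ 0) : coeff d (coefU u 0 f) = 0 := by
  by_contra h
  have := monomial_le_degreeOf u (mem_support_iff.2 h)
  rw [coefU_degreeOf_self] at this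
  omega

theorem exists_max {τ : Type} {lt : τ → τ → Prop} (tri : ∀ u v, lt u v ∨ u = v ∨ lt v u)
    (tr : ∀ u v w, lt u v → lt v w → lt u w) (S : Finset τ) (hS : S.Nonempty) :
    ∃ u ∈ S, ∀ v ∈ S, v ≠ u → lt v u := by
  classical
  induction hS using Finset.Nonempty.cons_induction with
  | singleton a => exact ⟨a, by simp, by simp⟩
  | cons a s ha hs ih =>
    obtain ⟨u, hu, hm⟩ := ih
    rcases tri a u with h | h | h
    · refine ⟨u, by simp [hu], fun v hv hne => ?_⟩
      rcases Finset.mem_cons.1 hv with rfl | hv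
      · exact h
      · exact hm v hv hne
    · exact absurd (h ▸ hu) ha
    · refine ⟨a, by simp, fun v hv hne => ?_⟩
      rcases Finset.mem_cons.1 hv with rfl | hv
      · exact absurd rfl hne
      · by_cases hvu : v = u
        · rw [hvu]; exact h
        · exact tr _ _ _ (hm v hv hvu) h

/-- comparison of degree vectors -/
def Smaller {τ R : Type} [CommRing R] (lt : τ → τ → Prop) (g' g : MvPolynomial τ R) : Prop :=
  ∃ w, degreeOf w g' < degreeOf w g ∧ ∀ v, lt w v → degreeOf v g' ≤ degreeOf v g

theorem smaller_wf {τ R : Type} [CommRing R] {lt : τ → τ → Prop}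
    (tri : ∀ u v, lt u v ∨ u = v ∨ lt v u)
    (irr : ∀ u, ¬ lt u u)
    (tr : ∀ u v w, lt u v → lt v w → lt u w) (wf : WellFounded lt) :
    WellFounded (Smaller (R := R) lt) := by
  classical
  have : Std.Trichotomous (Function.swap lt) := ⟨fun a b h1 h2 => by
    rcases tri a b with h | h | h
    · exact absurd h h2
    · exact h
    · exact absurd h h1⟩
  have W : WellFounded (Finsupp.Lex (Function.swap lt) ((· < ·) : ℕ → ℕ → Prop)) :=
    Finsupp.Lex.wellFounded' (fun n => Nat.not_lt_zero n) Nat.lt_wfRel.wf wf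
  refine Subrelation.wf ?_ (InvImage.wf
    (fun g : MvPolynomial τ R => Multiset.toFinsupp g.degrees) W)
  rintro g' g ⟨w, hw, hv⟩
  have key : ∀ (g : MvPolynomial τ R) v, Multiset.toFinsupp g.degrees v = degreeOf v g := by
    intro g v; rw [Multiset.toFinsupp_apply, degreeOf_def]
  rw [InvImage, Finsupp.lex_def]
  simp only [key]
  obtain ⟨j, hj, hm⟩ := exists_max tri tr
    ((g'.vars ∪ g.vars).filter (fun v => degreeOf v g' ≠ degreeOf v g)) ⟨w, by
      simp only [Finset.mem_filter, Finset.mem_union, mem_vars_iff]; omega⟩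
  have hj' := (Finset.mem_filter.1 hj).2
  refine ⟨j, fun d hd => ?_, ?_⟩
  · by_contra hne
    have hmem : d ∈ (g'.vars ∪ g.vars).filter (fun v => degreeOf v g' ≠ degreeOf v g) := by
      simp only [Finset.mem_filter, Finset.mem_union, mem_vars_iff]; omega
    have hd' : lt j d := hd
    have hdj : d ≠ j := fun h => irr j (h ▸ hd')
    exact irr _ (tr _ _ _ hd' (hm d hmem hdj))
  · by_cases hjw : w = j
    · exact hjw ▸ hw
    · have hwmem : w ∈ (g'.vars ∪ g.vars).filter (fun v => degreeOf v g' ≠ degreeOf v g) := by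
        simp only [Finset.mem_filter, Finset.mem_union, mem_vars_iff]; omega
      have := hv j (hm w hwmem hjw)
      omega

theorem shift_add {n M : ℕ} (u : DVar n M) (φ ψ : Fin M → ℕ) :
    shiftVar (shiftVar u φ) ψ = shiftVar u (φ + ψ) := by
  ext <;> simp [shiftVar, add_assoc]

theorem shift_zero {n M : ℕ} (u : DVar n M) : shiftVar u 0 = u := by
  ext <;> simp [shiftVar]

theorem exp_split {M : ℕ} (φ : Fin M → ℕ) (k : Fin M) (hk : φ k ≠ 0) :
    φ = Pi.single k 1 + (φ - Pi.single k 1) := by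
  funext l
  by_cases h : l = k
  · subst h; simp; omega
  · simp [h]

theorem shift_induct {n M : ℕ} (Q : DVar n M → Prop) (s : Fin M → Prop)
    (hstep : ∀ w k, s k → Q w → Q (shiftVar w (Pi.single k 1))) :
    ∀ (N : ℕ) (φ : Fin M → ℕ) (w : DVar n M), ∑ l, φ l = N → (∀ k, φ k ≠ 0 → s k) → Q w →
      Q (shiftVar w φ) := by
  intro N
  induction N with
  | zero =>
    intro φ w hs _ hw
    have : φ = 0 := by
      funext l
      have := (Finset.sum_eq_zero_iff.1 hs) l (Finset.mem_univ l)
      simpa using this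
    rw [this, shift_zero]; exact hw
  | succ N ih =>
    intro φ w hs hφ hw
    obtain ⟨k, hk⟩ : ∃ k, φ k ≠ 0 := by
      by_contra h
      push Not at h
      simp [h] at hs
    have hsp := exp_split φ k hk
    rw [hsp, ← shift_add]
    refine ih _ _ ?_ (fun l hl => hφ l ?_) (hstep w k (hφ k hk) hw)
    · have h2 : ∑ l, φ l = ∑ l, (Pi.single k 1 : Fin M → ℕ) l + ∑ l, (φ - Pi.single k 1 : Fin M → ℕ) l := by
        rw [← Finset.sum_add_distrib]
        exact Finset.sum_congr rfl fun l _ => congrFun hsp l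
      rw [Finset.sum_pi_single'] at h2
      simp only [Finset.mem_univ, if_true] at h2
      omega
    · intro h0; apply hl; simp [h0]

theorem delta_zero {K A : Type} [Field K] [CommRing A] [Algebra K A] {M : ℕ}
    (op : DStarOps K A M) (k : Fin M) : op.δ k 0 = 0 := by
  have := op.map_smul k 0 0
  simpa using this

theorem delta_sum {K A : Type} [Field K] [CommRing A] [Algebra K A] {M : ℕ}
    (op : DStarOps K A M) (k : Fin M) (s : Finset ℕ) (F : ℕ → A) :
    op.δ k (∑ i ∈ s, F i) = ∑ i ∈ s, op.δ k (F i) := by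
  classical
  induction s using Finset.induction_on with
  | empty => simp [delta_zero]
  | insert a s ha ih => rw [Finset.sum_insert ha, Finset.sum_insert ha, op.map_add, ih]

theorem sigma_pow {K A : Type} [Field K] [CommRing A] [Algebra K A] {M : ℕ}
    (op : DStarOps K A M) (k : Fin M) (hk : k ∈ op.σset) (a : A) (i : ℕ) :
    op.δ k (a ^ i) = op.δ k a ^ i := by
  induction i with
  | zero => simp [op.sigma_one k hk]
  | succ i ih => rw [pow_succ, pow_succ, op.sigma_mul k hk, ih]

theorem smul_mem_supp {K R τ : Type} [Field K] [CommRing R] [Algebra K R] (s : Set τ)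
    (c : K) (x : MvPolynomial τ R) (hx : x ∈ supported R s) : c • x ∈ supported R s := by
  rw [← algebraMap_smul R c x]
  exact Subalgebra.smul_mem _ hx _

theorem X_mem_supp {R τ : Type} [CommRing R] {s : Set τ} {v : τ} (hv : v ∈ s) :
    (X v : MvPolynomial τ R) ∈ supported R s :=
  Algebra.subset_adjoin ⟨v, hv, rfl⟩

theorem nu_lt_of_mem {K A : Type} [Field K] [CommRing A] [Algebra K A] {M : ℕ}
    (op : DStarOps K A M) (k : Fin M) {pq : Fin M × Fin M}
    (h : pq.1 ∉ op.σset ∧ pq.2 ∉ op.σset ∧ op.fac pq.1 = op.fac k ∧ op.fac pq.2 = op.fac k ∧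
              op.ν pq.1 + op.ν pq.2 ≤ op.ν k) : op.ν pq.1 < op.ν k ∧ op.ν pq.2 < op.ν k := by
  have h1 := op.nu_delta _ h.1
  have h2 := op.nu_delta _ h.2.1
  omega

theorem nu_fac_lt {K A : Type} [Field K] [CommRing A] [Algebra K A] {M : ℕ}
    (op : DStarOps K A M) (k : Fin M) (hk : k ∉ op.σset) : op.ν (op.fac k) < op.ν k := by
  rw [op.nu_sigma _ (op.fac_mem k)]
  have := op.nu_delta k hk
  omega

theorem delta_supp {K R : Type} [Field K] [CommRing R] [Algebra K R]
    {n M : ℕ} (op : DStarOps K (MvPolynomial (DVar n M) R) M)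
    (hvar : ∀ (k : Fin M) (u : DVar n M),
      op.δ k (X u) = X (shiftVar u (Pi.single k 1)))
    (hconst : ∀ (k : Fin M) (r : R), ∃ r' : R, op.δ k (C r) = C r')
    (s : Set (DVar n M)) (t : Fin M → Set (DVar n M))
    (hst : ∀ v ∈ s, ∀ k, shiftVar v (Pi.single k 1) ∈ t k)
    (ht : ∀ p k, op.ν p < op.ν k → t p ⊆ t k)
    (f : MvPolynomial (DVar n M) R) (hf : f ∈ supported R s) :
    ∀ k, op.δ k f ∈ supported R (t k) := by
  rw [supported_eq_adjoin_X] at hf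
  induction hf using Algebra.adjoin_induction with
  | mem x hx =>
    obtain ⟨v, hv, rfl⟩ := hx
    intro k
    rw [hvar]
    exact X_mem_supp (hst v hv k)
  | algebraMap r =>
    intro k
    obtain ⟨r', hr'⟩ := hconst k r
    rw [algebraMap_eq, hr']
    exact Subalgebra.algebraMap_mem _ r'
  | add x y _ _ hx hy =>
    intro k
    rw [op.map_add]
    exact add_mem (hx k) (hy k)
  | mul x y _ _ hx hy =>
    intro k
    by_cases hk : k ∈ op.σset
    · rw [op.sigma_mul k hk]
      exact mul_mem (hx k) (hy k)
    · rw [op.prod_rule k hk]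
      have hf := supported_mono (R := R) (ht _ _ (nu_fac_lt op k hk))
      refine add_mem (add_mem (mul_mem (hx k) (hf (hy _))) (mul_mem (hf (hx _)) (hy k))) ?_
      refine sum_mem fun pq hpq => smul_mem_supp _ _ _ ?_
      have h := nu_lt_of_mem op k (Finset.mem_filter.1 hpq).2
      exact mul_mem (supported_mono (R := R) (ht _ _ h.1) (hx _))
        (supported_mono (R := R) (ht _ _ h.2) (hy _))

/-- variables at most `u` -/
def LeS {n M : ℕ} (lt : DVar n M → DVar n M → Prop) (u : DVar n M) : Set (DVar n M) :=
  {v | v = u ∨ lt v u}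

/-- variables below `u` -/
def LtS {n M : ℕ} (lt : DVar n M → DVar n M → Prop) (u : DVar n M) : Set (DVar n M) :=
  {v | lt v u}

theorem LtS_sub_LeS {n M : ℕ} (lt : DVar n M → DVar n M → Prop) (u : DVar n M) :
    LtS lt u ⊆ LeS lt u := fun _ h => Or.inr h

theorem LeS_sub_LtS {n M : ℕ} {lt : DVar n M → DVar n M → Prop} {σset : Finset (Fin M)}
    {ν : Fin M → ℕ} (hr : IsRanking lt σset ν) {u v : DVar n M} (h : lt u v) :
    LeS lt u ⊆ LtS lt v := by
  rintro w (rfl | hw)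
  · exact h
  · exact hr.trans _ _ _ hw h

theorem delta_LeS {K R : Type} [Field K] [CommRing R] [Algebra K R]
    {n M : ℕ} (op : DStarOps K (MvPolynomial (DVar n M) R) M)
    (hvar : ∀ (k : Fin M) (u : DVar n M),
      op.δ k (X u) = X (shiftVar u (Pi.single k 1)))
    (hconst : ∀ (k : Fin M) (r : R), ∃ r' : R, op.δ k (C r) = C r')
    (lt : DVar n M → DVar n M → Prop)
    (hrank : IsRanking lt op.σset op.ν) (u : DVar n M)
    (f : MvPolynomial (DVar n M) R) (hf : f ∈ supported R (LeS lt u)) (k : Fin M) :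
    op.δ k f ∈ supported R (LeS lt (shiftVar u (Pi.single k 1))) := by
  refine delta_supp op hvar hconst (LeS lt u) (fun k => LeS lt (shiftVar u (Pi.single k 1)))
    ?_ ?_ f hf k
  · rintro v (rfl | hv) k
    · exact Or.inl rfl
    · exact Or.inr (hrank.mono _ _ _ hv)
  · intro p k hpk
    exact (LeS_sub_LtS hrank (hrank.op_ord u p k hpk)).trans (LtS_sub_LeS _ _)

theorem delta_LtS {K R : Type} [Field K] [CommRing R] [Algebra K R]
    {n M : ℕ} (op : DStarOps K (MvPolynomial (DVar n M) R) M)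
    (hvar : ∀ (k : Fin M) (u : DVar n M),
      op.δ k (X u) = X (shiftVar u (Pi.single k 1)))
    (hconst : ∀ (k : Fin M) (r : R), ∃ r' : R, op.δ k (C r) = C r')
    (lt : DVar n M → DVar n M → Prop)
    (hrank : IsRanking lt op.σset op.ν) (u : DVar n M)
    (f : MvPolynomial (DVar n M) R) (hf : f ∈ supported R (LtS lt u)) (k : Fin M) :
    op.δ k f ∈ supported R (LtS lt (shiftVar u (Pi.single k 1))) := by
  refine delta_supp op hvar hconst (LtS lt u) (fun k => LtS lt (shiftVar u (Pi.single k 1)))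
    ?_ ?_ f hf k
  · intro v hv k
    exact hrank.mono _ _ _ hv
  · intro p k hpk
    exact (LtS_sub_LeS _ _).trans (LeS_sub_LtS hrank (hrank.op_ord u p k hpk))

theorem delta_strong {K R : Type} [Field K] [CommRing R] [Algebra K R]
    {n M : ℕ} (op : DStarOps K (MvPolynomial (DVar n M) R) M)
    (hvar : ∀ (k : Fin M) (u : DVar n M),
      op.δ k (X u) = X (shiftVar u (Pi.single k 1)))
    (hconst : ∀ (k : Fin M) (r : R), ∃ r' : R, op.δ k (C r) = C r')
    (lt : DVar n M → DVar n M → Prop)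
    (hrank : IsRanking lt op.σset op.ν) (u : DVar n M) (k : Fin M) (hk : k ∉ op.σset)
    (f : MvPolynomial (DVar n M) R) (hf : f ∈ supported R (LeS lt u)) :
    ∃ L ∈ supported R (LtS lt (shiftVar u (Pi.single k 1))),
      op.δ k f = op.δ (op.fac k) (pderiv u f) * X (shiftVar u (Pi.single k 1)) + L := by
  have hfm := op.fac_mem k
  have low : ∀ p, op.ν p < op.ν k → ∀ g ∈ supported R (LeS lt u),
      op.δ p g ∈ supported R (LtS lt (shiftVar u (Pi.single k 1))) := fun p hp g hg =>
    supported_mono (R := R) (LeS_sub_LtS hrank (hrank.op_ord u p k hp))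
      (delta_LeS op hvar hconst lt hrank u g hg p)
  have hf' := hf
  rw [supported_eq_adjoin_X] at hf
  induction hf using Algebra.adjoin_induction with
  | mem x hx =>
    obtain ⟨v, hv, rfl⟩ := hx
    rcases hv with rfl | hv
    · refine ⟨0, zero_mem _, ?_⟩
      rw [pderiv_X_self, op.sigma_one _ hfm, hvar]; ring
    · refine ⟨X (shiftVar v (Pi.single k 1)), X_mem_supp (hrank.mono _ _ _ hv), ?_⟩
      have hne : v ≠ u := fun h => hrank.irrefl u (h ▸ hv)
      rw [pderiv_X_of_ne hne, delta_zero, hvar]; ring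
  | algebraMap r =>
    obtain ⟨r', hr'⟩ := hconst k r
    refine ⟨C r', Subalgebra.algebraMap_mem _ r', ?_⟩
    rw [algebraMap_eq, pderiv_C, delta_zero, hr']; ring
  | add x y hx hy ihx ihy =>
    obtain ⟨L1, hL1, h1⟩ := ihx hx
    obtain ⟨L2, hL2, h2⟩ := ihy hy
    refine ⟨L1 + L2, add_mem hL1 hL2, ?_⟩
    rw [op.map_add, h1, h2, map_add, op.map_add]; ring
  | mul x y hx hy ihx ihy =>
    obtain ⟨L1, hL1, h1⟩ := ihx hx
    obtain ⟨L2, hL2, h2⟩ := ihy hy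
    have hν := nu_fac_lt op k hk
    obtain ⟨S, hS, hSe⟩ : ∃ S ∈ supported R (LtS lt (shiftVar u (Pi.single k 1))),
        op.δ k (x * y) = op.δ k x * op.δ (op.fac k) y + op.δ (op.fac k) x * op.δ k y + S := by
      refine ⟨_, ?_, op.prod_rule k hk x y⟩
      refine sum_mem fun pq hpq => smul_mem_supp _ _ _ ?_
      have h := nu_lt_of_mem op k (Finset.mem_filter.1 hpq).2
      exact mul_mem (low _ h.1 _ hx) (low _ h.2 _ hy)
    refine ⟨L1 * op.δ (op.fac k) y + op.δ (op.fac k) x * L2 + S, add_mem (add_mem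
      (mul_mem hL1 (low _ hν y hy)) (mul_mem (low _ hν x hx) hL2)) hS, ?_⟩
    rw [hSe, h1, h2, pderiv_mul, op.map_add, op.sigma_mul _ hfm, op.sigma_mul _ hfm]
    ring

theorem leader_unique {R : Type} [CommRing R] {n M : ℕ} {lt : DVar n M → DVar n M → Prop}
    {σset : Finset (Fin M)} {ν : Fin M → ℕ} (hr : IsRanking lt σset ν)
    {f : MvPolynomial (DVar n M) R} {u v : DVar n M} (hu : IsLeader lt f u)
    (hv : IsLeader lt f v) : u = v := by
  by_contra h
  exact hr.irrefl _ (hr.trans _ _ _ (hu.2 v hv.1 (Ne.symm h)) (hv.2 u hu.1 h))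

theorem lt_or_eq_shift {n M : ℕ} {lt : DVar n M → DVar n M → Prop}
    {σset : Finset (Fin M)} {ν : Fin M → ℕ} (hr : IsRanking lt σset ν)
    (u v : DVar n M) (φ : Fin M → ℕ) (h : lt v u) : lt v (shiftVar u φ) := by
  refine shift_induct (fun w => lt v w) (fun _ => True) ?_ _ φ u rfl (fun _ _ => trivial) h
  intro w k _ hw
  exact hr.trans _ _ _ hw (hr.lt_op w k)

theorem not_mem_shift {R : Type} [CommRing R] {n M : ℕ} {lt : DVar n M → DVar n M → Prop}
    {σset : Finset (Fin M)} {ν : Fin M → ℕ} (hr : IsRanking lt σset ν)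
    {c : MvPolynomial (DVar n M) R} {u w : DVar n M} (hc : IsLeader lt c u) (h : lt u w)
    (φ : Fin M → ℕ) : shiftVar w φ ∉ c.vars := by
  intro hm
  have h1 := lt_or_eq_shift hr w u φ h
  by_cases he : shiftVar w φ = u
  · rw [he] at h1; exact hr.irrefl _ h1
  · exact hr.irrefl _ (hr.trans _ _ _ h1 (hc.2 _ hm he))

theorem not_const_of_leader {R : Type} [CommRing R] {n M : ℕ}
    {lt : DVar n M → DVar n M → Prop}
    {c : MvPolynomial (DVar n M) R} {u : DVar n M} (hc : IsLeader lt c u) : ¬ IsConst c := by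
  rintro ⟨r, rfl⟩
  have := hc.1
  simp at this

theorem reduced_of_le {R : Type} [CommRing R] {n M : ℕ} {lt : DVar n M → DVar n M → Prop}
    {σset : Finset (Fin M)} {f g c : MvPolynomial (DVar n M) R}
    (h : ∀ v, degreeOf v f ≤ degreeOf v g) (hg : ReducedWrt lt σset g c) :
    ReducedWrt lt σset f c := by
  intro u hu
  refine ⟨fun φ hφ hm => (hg u hu).1 φ hφ ?_, fun φ hφ => (h _).trans_lt ((hg u hu).2 φ hφ)⟩
  rw [mem_vars_iff] at hm ⊢
  have := h (shiftVar u φ)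
  omega

theorem exists_sorted {R : Type} [CommRing R] {n M : ℕ} {lt : DVar n M → DVar n M → Prop}
    {σset : Finset (Fin M)} {ν : Fin M → ℕ} (hr : IsRanking lt σset ν)
    (S : Finset (MvPolynomial (DVar n M) R)) (uc : MvPolynomial (DVar n M) R → DVar n M)
    (hinj : ∀ a ∈ S, ∀ b ∈ S, a ≠ b → uc a ≠ uc b) :
    ∃ l : List (MvPolynomial (DVar n M) R), l.Nodup ∧ (∀ f, f ∈ l ↔ f ∈ S) ∧
      l.Pairwise (fun a b => lt (uc a) (uc b)) := by
  classical
  let r : MvPolynomial (DVar n M) R → MvPolynomial (DVar n M) R → Prop :=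
    fun a b => ¬ lt (uc b) (uc a)
  have : Std.Total r := ⟨fun a b => by
    by_contra h
    simp only [r, not_or, not_not] at h
    exact hr.irrefl _ (hr.trans _ _ _ h.1 h.2)⟩
  have : IsTrans _ r := ⟨fun a b c hab hbc hca => by
    rcases hr.trichot (uc a) (uc b) with h | h | h
    · exact hbc (hr.trans _ _ _ hca h)
    · exact hbc (h ▸ hca)
    · exact hab h⟩
  have hnd : (S.toList.insertionSort r).Nodup :=
    (List.perm_insertionSort r S.toList).nodup_iff.2 S.nodup_toList
  have hmem : ∀ f, f ∈ S.toList.insertionSort r ↔ f ∈ S := by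
    intro f; rw [List.mem_insertionSort, Finset.mem_toList]
  refine ⟨S.toList.insertionSort r, hnd, hmem, ?_⟩
  have hp := (List.pairwise_insertionSort r S.toList).and hnd
  refine hp.imp_of_mem ?_
  intro a b ha hb hab
  rcases hr.trichot (uc a) (uc b) with h | h | h
  · exact h
  · exact absurd h (hinj a ((hmem a).1 ha) b ((hmem b).1 hb) hab.2)
  · exact absurd h hab.1

theorem autored_inj {R : Type} [CommRing R] {n M : ℕ} {lt : DVar n M → DVar n M → Prop}
    {σset : Finset (Fin M)} {S : Set (MvPolynomial (DVar n M) R)}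
    (hS : Autoreduced lt σset S) {a b : MvPolynomial (DVar n M) R} (ha : a ∈ S) (hb : b ∈ S)
    (hne : a ≠ b) {u v : DVar n M} (hu : IsLeader lt a u) (hv : IsLeader lt b v) : u ≠ v := by
  rintro rfl
  have h0 : IsSigmaExp σset (0 : Fin M → ℕ) := fun k hk => absurd rfl hk
  have h1 := (hS.2 a ha b hb hne u hu).2 0 h0
  have h2 := (hS.2 b hb a ha hne.symm u hv).2 0 h0
  rw [shift_zero] at h1 h2
  omega

theorem charset_min {R : Type} [CommRing R] {n M : ℕ} {lt : DVar n M → DVar n M → Prop}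
    {σset : Finset (Fin M)} {ν : Fin M → ℕ} (hr : IsRanking lt σset ν)
    {P : Ideal (MvPolynomial (DVar n M) R)}
    {𝒞 : Finset (MvPolynomial (DVar n M) R)}
    (h𝒞 : IsCharSet lt σset P 𝒞)
    (uc : MvPolynomial (DVar n M) R → DVar n M)
    (huc : ∀ c ∈ 𝒞, IsLeader lt c (uc c))
    (f : MvPolynomial (DVar n M) R) (hf : f ∈ P) (u : DVar n M) (hu : IsLeader lt f u)
    (hs : pderiv u f ∉ P)
    (hlow : ∀ c ∈ 𝒞, lt (uc c) u → ReducedWrt lt σset f c)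
    (heq : ∀ c ∈ 𝒞, uc c = u → degreeOf u f < degreeOf u c) : False := by
  classical
  obtain ⟨⟨haut, hsub, hsep⟩, hmin⟩ := h𝒞
  have hinj : ∀ a ∈ 𝒞, ∀ b ∈ 𝒞, a ≠ b → uc a ≠ uc b := fun a ha b hb hne =>
    autored_inj haut ha hb hne (huc a ha) (huc b hb)
  set Lo := 𝒞.filter (fun c => lt (uc c) u) with hLo
  set Hi := 𝒞.filter (fun c => ¬ lt (uc c) u) with hHi
  have mLo : ∀ c, c ∈ Lo ↔ c ∈ 𝒞 ∧ lt (uc c) u := fun c => Finset.mem_filter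
  have mHi : ∀ c, c ∈ Hi ↔ c ∈ 𝒞 ∧ ¬ lt (uc c) u := fun c => Finset.mem_filter
  obtain ⟨l1, nd1, m1, p1⟩ := exists_sorted hr Lo uc
    (fun a ha b hb => hinj a ((mLo a).1 ha).1 b ((mLo b).1 hb).1)
  obtain ⟨l2, nd2, m2, p2⟩ := exists_sorted hr Hi uc
    (fun a ha b hb => hinj a ((mHi a).1 ha).1 b ((mHi b).1 hb).1)
  have hfLo : f ∉ Lo := by
    intro h
    have h' := (mLo f).1 h
    have := leader_unique hr (huc f h'.1) hu
    rw [this] at h'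
    exact hr.irrefl _ h'.2
  have hdeg : degreeOf u f ≠ 0 := (mem_vars_iff u f).1 hu.1
  refine hmin (insert f Lo) ⟨?_, ?_⟩ ?_ ?_ ?_
  · intro g hg
    rw [Finset.mem_coe, Finset.mem_insert] at hg
    rcases hg with rfl | hg
    · exact not_const_of_leader hu
    · exact not_const_of_leader (huc g ((mLo g).1 hg).1)
  · intro a ha b hb hne
    rw [Finset.mem_coe, Finset.mem_insert] at ha hb
    rcases ha with rfl | ha
    · rcases hb with rfl | hb
      · exact absurd rfl hne
      · intro v hv
        have hvu := leader_unique hr hv hu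
        subst hvu
        have hb' := (mLo b).1 hb
        have hnm := not_mem_shift hr (huc b hb'.1) hb'.2
        refine ⟨fun φ _ => hnm φ, fun φ _ => ?_⟩
        rw [degreeOf_zero_of (hnm φ)]
        omega
    · rcases hb with rfl | hb
      · exact hlow a ((mLo a).1 ha).1 ((mLo a).1 ha).2
      · exact haut.2 a ((mLo a).1 ha).1 b ((mLo b).1 hb).1 hne
  · intro g hg
    rw [Finset.mem_coe, Finset.mem_insert] at hg
    rcases hg with rfl | hg
    · exact hf
    · exact hsub ((mLo g).1 hg).1
  · intro g hg v hv
    rw [Finset.mem_insert] at hg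
    rcases hg with rfl | hg
    · rw [leader_unique hr hv hu]; exact hs
    · exact hsep g ((mLo g).1 hg).1 v hv
  · have q1 : l1.Pairwise (RkLt lt) := p1.imp_of_mem fun {a b} ha hb hab =>
      ⟨uc a, uc b, huc a ((mLo a).1 ((m1 a).1 ha)).1, huc b ((mLo b).1 ((m1 b).1 hb)).1,
        Or.inl hab⟩
    have q2 : l2.Pairwise (RkLt lt) := p2.imp_of_mem fun {a b} ha hb hab =>
      ⟨uc a, uc b, huc a ((mHi a).1 ((m2 a).1 ha)).1, huc b ((mHi b).1 ((m2 b).1 hb)).1,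
        Or.inl hab⟩
    have hRkEq : ∀ (la lb : List (MvPolynomial (DVar n M) R)), ∀ i < l1.length,
        RkEq lt ((l1 ++ la).getD i 0) ((l1 ++ lb).getD i 0) := by
      intro la lb i hi
      rw [List.getD_append _ _ _ _ hi, List.getD_append _ _ _ _ hi,
        List.getD_eq_getElem _ _ hi]
      have h1 : l1[i] ∈ 𝒞 := ((mLo _).1 ((m1 _).1 (List.getElem_mem hi))).1
      exact ⟨_, _, huc _ h1, huc _ h1, rfl, rfl⟩
    refine ⟨l1 ++ [f], l1 ++ l2, ?_, ?_, ?_, ?_, ?_, ?_, ?_⟩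
    · rw [List.nodup_append]
      refine ⟨nd1, by simp, ?_⟩
      intro a ha b hb hab
      rw [List.mem_singleton] at hb
      exact hfLo ((m1 f).1 (hb ▸ hab ▸ ha))
    · rw [List.nodup_append]
      refine ⟨nd1, nd2, ?_⟩
      intro a ha b hb hab
      subst hab
      exact ((mHi a).1 ((m2 a).1 hb)).2 ((mLo a).1 ((m1 a).1 ha)).2
    · intro g
      rw [List.mem_append, m1, List.mem_singleton, Finset.mem_insert, or_comm]
    · intro g
      rw [List.mem_append, m1, m2, mLo, mHi]
      tauto
    · rw [List.pairwise_append]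
      refine ⟨q1, by simp, ?_⟩
      intro a ha b hb
      rw [List.mem_singleton] at hb
      subst hb
      have ha' := (mLo a).1 ((m1 a).1 ha)
      exact ⟨uc a, u, huc a ha'.1, hu, Or.inl ha'.2⟩
    · rw [List.pairwise_append]
      refine ⟨q1, q2, ?_⟩
      intro a ha b hb
      have ha' := (mLo a).1 ((m1 a).1 ha)
      have hb' := (mHi b).1 ((m2 b).1 hb)
      refine ⟨uc a, uc b, huc a ha'.1, huc b hb'.1, Or.inl ?_⟩
      rcases hr.trichot (uc b) u with h | h | h
      · exact absurd h hb'.2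
      · rw [h]; exact ha'.2
      · exact hr.trans _ _ _ ha'.2 h
    · cases l2 with
      | nil =>
        right
        refine ⟨by simp, fun i hi => ?_⟩
        rw [List.append_nil] at hi
        exact hRkEq _ _ i hi
      | cons g t =>
        left
        refine ⟨l1.length, by simp, by simp, ?_, fun j hj => hRkEq _ _ j hj⟩
        rw [List.getD_append_right _ _ _ _ le_rfl, List.getD_append_right _ _ _ _ le_rfl]
        simp only [Nat.sub_self, List.getD_cons_zero]
        have hg := (mHi g).1 ((m2 g).1 (by simp))
        refine ⟨u, uc g, hu, huc g hg.1, ?_⟩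
        rcases hr.trichot (uc g) u with h | h | h
        · exact absurd h hg.2
        · right
          refine ⟨h.symm, ?_⟩
          rw [h]
          exact heq g hg.1 h
        · exact Or.inl h

theorem initial_not_mem {R : Type} [CommRing R] {n M : ℕ} {lt : DVar n M → DVar n M → Prop}
    {σset : Finset (Fin M)} {ν : Fin M → ℕ} (hr : IsRanking lt σset ν)
    {P : Ideal (MvPolynomial (DVar n M) R)}
    {𝒞 : Finset (MvPolynomial (DVar n M) R)}
    (h𝒞 : IsCharSet lt σset P 𝒞)
    (uc : MvPolynomial (DVar n M) R → DVar n M)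
    (huc : ∀ c ∈ 𝒞, IsLeader lt c (uc c))
    (c : MvPolynomial (DVar n M) R) (hc : c ∈ 𝒞) : initialOf (uc c) c ∉ P := by
  intro hI
  have hI' : coefU (uc c) (degreeOf (uc c) c) c ∈ P := hI
  have hu := huc c hc
  set u := uc c with hudef
  have hexp := expand_rest u c
  have hcP : c ∈ P := h𝒞.1.2.1 hc
  have hrest : restU u c = c - coefU u (degreeOf u c) c * X u ^ (degreeOf u c) := by
    rw [eq_sub_iff_add_eq, add_comm]; exact hexp.symm
  have hrP : restU u c ∈ P := by
    rw [hrest]; exact P.sub_mem hcP (P.mul_mem_right _ hI')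
  have hsP : pderiv u (restU u c) ∉ P := by
    intro h
    apply h𝒞.1.2.2 c hc u hu
    rw [hexp, map_add, pderiv_mul, pderiv_zero_of (coefU_degreeOf_self u _ c)]
    exact P.add_mem (P.add_mem (by simp) (P.mul_mem_right _ hI')) h
  have hpos : 0 < degreeOf u c := Nat.pos_of_ne_zero ((mem_vars_iff u c).1 hu.1)
  have hle := fun v => restU_degreeOf_le u v c
  refine charset_min hr h𝒞 uc huc (restU u c) hrP u ⟨?_, ?_⟩ hsP ?_ ?_
  · by_contra h
    exact hsP (by rw [pderiv_eq_zero_of_notMem_vars h]; exact P.zero_mem)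
  · intro v hv hne
    refine hu.2 v ?_ hne
    rw [mem_vars_iff] at hv ⊢
    have := hle v
    omega
  · intro c1 hc1 hlt
    refine reduced_of_le hle (h𝒞.1.1.2 c1 hc1 c hc ?_)
    rintro rfl
    exact hr.irrefl _ hlt
  · intro c1 hc1 he
    have : c1 = c := by
      by_contra hne
      exact autored_inj h𝒞.1.1 hc1 hc hne (huc c1 hc1) hu he
    subst this
    exact restU_degreeOf_lt _ _ hpos

theorem reduced_coeffs {R : Type} [CommRing R] [Algebra ℚ R] {n M : ℕ}
    {lt : DVar n M → DVar n M → Prop}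
    {σset : Finset (Fin M)} {ν : Fin M → ℕ} (hr : IsRanking lt σset ν)
    {P : Ideal (MvPolynomial (DVar n M) R)}
    {𝒞 : Finset (MvPolynomial (DVar n M) R)}
    (h𝒞 : IsCharSet lt σset P 𝒞)
    (uc : MvPolynomial (DVar n M) R → DVar n M)
    (huc : ∀ c ∈ 𝒞, IsLeader lt c (uc c))
    (g : MvPolynomial (DVar n M) R) : g ∈ P → (∀ c ∈ 𝒞, ReducedWrt lt σset g c) →
      ∀ d, C (coeff d g) ∈ P := by
  induction g using (smaller_wf (R := R) hr.trichot hr.irrefl hr.trans hr.wf).induction with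
  | _ g ih =>
  intro hg hred
  have h0 : IsSigmaExp σset (0 : Fin M → ℕ) := fun k hk => absurd rfl hk
  by_cases hv : g.vars.Nonempty
  · obtain ⟨u, hu, hm⟩ := exists_max hr.trichot hr.trans g.vars hv
    have hpos : 0 < degreeOf u g := Nat.pos_of_ne_zero ((mem_vars_iff u g).1 hu)
    have hsP : pderiv u g ∈ P := by
      by_contra hs
      refine charset_min hr h𝒞 uc huc g hg u ⟨hu, hm⟩ hs (fun c hc _ => hred c hc) ?_
      intro c hc he
      have := (hred c hc (uc c) (huc c hc)).2 0 h0
      rwa [shift_zero, he] at this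
    have h1 := ih (pderiv u g) ⟨u, pderiv_degreeOf_lt u g hpos,
      fun v _ => pderiv_degreeOf_le u v g⟩ hsP
      (fun c hc => reduced_of_le (fun v => pderiv_degreeOf_le u v g) (hred c hc))
    have h2 : ∀ d : DVar n M →₀ ℕ, d u ≠ 0 → C (coeff d g) ∈ P := by
      intro d hd
      have hd' : d - Finsupp.single u 1 + Finsupp.single u 1 = d := by
        apply tsub_add_cancel_of_le
        rw [Finsupp.single_le_iff]; omega
      have := h1 (d - Finsupp.single u 1)
      rw [coeff_pderiv, hd'] at this
      have hmul := P.mul_mem_left (C (algebraMap ℚ R (((d u : ℕ) : ℚ)⁻¹))) this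
      rw [← C_mul] at hmul
      convert hmul using 2
      have hne : ((d u : ℕ) : ℚ) ≠ 0 := by exact_mod_cast hd
      have hcast : (((d - Finsupp.single u 1 : DVar n M →₀ ℕ) u : ℕ) : R) + 1 = algebraMap ℚ R ((d u : ℕ) : ℚ) := by
        rw [map_natCast, Finsupp.tsub_apply, Finsupp.single_eq_same]
        have : d u = (d u - 1) + 1 := by omega
        conv_rhs => rw [this]
        push_cast
        rfl
      rw [hcast, mul_left_comm, ← map_mul, inv_mul_cancel₀ hne, map_one, mul_one]
    have h3 : coefU u 0 g ∈ P := by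
      have : g - coefU u 0 g ∈ Ideal.map (C : R →+* _) (Ideal.comap C P) := by
        rw [mem_map_C_iff]
        intro d
        rw [Ideal.mem_comap, coeff_sub]
        by_cases hd : d u = 0
        · rw [coeff_coefU_zero u g d hd, sub_self]; simp
        · rw [coeff_coefU_zero' u g d hd, sub_zero]; exact h2 d hd
      have := Ideal.map_comap_le this
      have := P.sub_mem hg this
      rwa [sub_sub_cancel] at this
    have h4 := ih (coefU u 0 g) ⟨u, by rw [coefU_degreeOf_self]; exact hpos,
      fun v _ => coefU_degreeOf_le u v 0 g⟩ h3
      (fun c hc => reduced_of_le (fun v => coefU_degreeOf_le u v 0 g) (hred c hc))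
    intro d
    by_cases hd : d u = 0
    · rw [← coeff_coefU_zero u g d hd]; exact h4 d
    · exact h2 d hd
  · rw [Finset.not_nonempty_iff_eq_empty, vars_eq_empty_iff_eq_C] at hv
    intro d
    classical
    rw [hv, coeff_C]
    split_ifs
    · rw [← hv]; exact hg
    · simp

/-- the reflexive D-ideal generated by a set -/
noncomputable def genJ {K A : Type} [Field K] [CommRing A] [Algebra K A] {M : ℕ}
    (op : DStarOps K A M) (S : Set A) : Ideal A :=
  sInf {I : Ideal A | S ⊆ I ∧ IsDIdeal op I ∧ IsReflexive op I}

theorem mem_genJ {K A : Type} [Field K] [CommRing A] [Algebra K A] {M : ℕ}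
    (op : DStarOps K A M) (S : Set A) (a : A) :
    a ∈ genJ op S ↔ InReflexiveDIdealGen op S a := by
  rw [genJ, Submodule.mem_sInf]
  exact ⟨fun h I h1 h2 h3 => h I ⟨h1, h2, h3⟩, fun h I hI => h I hI.1 hI.2.1 hI.2.2⟩

theorem genJ_D {K A : Type} [Field K] [CommRing A] [Algebra K A] {M : ℕ}
    (op : DStarOps K A M) (S : Set A) : IsDIdeal op (genJ op S) := by
  intro k a ha
  rw [mem_genJ] at ha ⊢
  exact fun I h1 h2 h3 => h2 k a (ha I h1 h2 h3)

theorem genJ_R {K A : Type} [Field K] [CommRing A] [Algebra K A] {M : ℕ}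
    (op : DStarOps K A M) (S : Set A) : IsReflexive op (genJ op S) := by
  intro k hk a ha
  rw [mem_genJ] at ha ⊢
  exact fun I h1 h2 h3 => h3 k hk a (ha I h1 h2 h3)

/-- saturation membership -/
def InSat {A : Type} [CommRing A] (J : Ideal A) (H f : A) : Prop := ∃ m : ℕ, H ^ m * f ∈ J

theorem InSat.add {A : Type} [CommRing A] {J : Ideal A} {H f g : A} (hf : InSat J H f)
    (hg : InSat J H g) : InSat J H (f + g) := by
  obtain ⟨m, hm⟩ := hf
  obtain ⟨k, hk⟩ := hg
  refine ⟨m + k, ?_⟩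
  have : H ^ (m + k) * (f + g) = H ^ k * (H ^ m * f) + H ^ m * (H ^ k * g) := by ring
  rw [this]
  exact J.add_mem (J.mul_mem_left _ hm) (J.mul_mem_left _ hk)

theorem InSat.of_mem {A : Type} [CommRing A] {J : Ideal A} {H f : A} (hf : f ∈ J) :
    InSat J H f := ⟨0, by simpa using hf⟩

/-- elements that may be cancelled modulo the saturation -/
def Good {A : Type} [CommRing A] (J : Ideal A) (H a : A) : Prop :=
  ∀ g, InSat J H (a * g) → InSat J H g

theorem good_of_dvd {A : Type} [CommRing A] {J : Ideal A} {H a : A} (h : a ∣ H) :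
    Good J H a := by
  obtain ⟨b, rfl⟩ := h
  rintro g ⟨m, hm⟩
  refine ⟨m + 1, ?_⟩
  have : (a * b) ^ (m + 1) * g = b * ((a * b) ^ m * (a * g)) := by ring
  rw [this]
  exact J.mul_mem_left _ hm

theorem good_sigma {K A : Type} [Field K] [CommRing A] [Algebra K A] {M : ℕ}
    (op : DStarOps K A M) {J : Ideal A} (hJ : IsReflexive op J) {H a : A} (ha : Good J H a)
    (k : Fin M) (hk : k ∈ op.σset) : Good J H (op.δ k a) := by
  rintro g ⟨m, hm⟩
  have h1 : a * (H ^ m * g) ∈ J := by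
    refine hJ k hk _ ?_
    rw [op.sigma_mul k hk]
    have : a * (H ^ m * g) * (op.δ k a * op.δ k (H ^ m * g)) =
      (a * op.δ k (H ^ m * g)) * (H ^ m * (op.δ k a * g)) := by ring
    rw [this]
    exact J.mul_mem_left _ hm
  obtain ⟨j, hj⟩ := ha _ (InSat.of_mem h1)
  exact ⟨j + m, by rwa [pow_add, mul_assoc]⟩

/-- a reducing polynomial with leader `w` and degree `e` is available in `J` -/
def Tred {R : Type} [CommRing R] {n M : ℕ} (lt : DVar n M → DVar n M → Prop)
    (J : Ideal (MvPolynomial (DVar n M) R)) (H : MvPolynomial (DVar n M) R)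
    (e : ℕ) (w : DVar n M) : Prop :=
  ∃ (a : MvPolynomial (DVar n M) R) (b : ℕ → MvPolynomial (DVar n M) R),
    a ∈ supported R (LtS lt w) ∧ (∀ i, b i ∈ supported R (LtS lt w)) ∧ Good J H a ∧
    a * X w ^ e + ∑ i ∈ Finset.range e, b i * X w ^ i ∈ J

theorem supp_degreeOf {R : Type} [CommRing R] {n M : ℕ} {lt : DVar n M → DVar n M → Prop}
    {σset : Finset (Fin M)} {ν : Fin M → ℕ} (hr : IsRanking lt σset ν)
    {a : MvPolynomial (DVar n M) R} {w : DVar n M} (ha : a ∈ supported R (LtS lt w))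
    (v : DVar n M) (hv : v = w ∨ lt w v) : degreeOf v a = 0 := by
  apply degreeOf_zero_of
  intro hm
  have h1 : lt v w := (mem_supported.1 ha) hm
  rcases hv with rfl | hv
  · exact hr.irrefl _ h1
  · exact hr.irrefl _ (hr.trans _ _ _ h1 hv)

theorem Tred_sigma {K R : Type} [Field K] [CommRing R] [Algebra K R]
    {n M : ℕ} (op : DStarOps K (MvPolynomial (DVar n M) R) M)
    (hvar : ∀ (k : Fin M) (u : DVar n M),
      op.δ k (X u) = X (shiftVar u (Pi.single k 1)))
    (hconst : ∀ (k : Fin M) (r : R), ∃ r' : R, op.δ k (C r) = C r')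
    (lt : DVar n M → DVar n M → Prop)
    (hrank : IsRanking lt op.σset op.ν)
    {J : Ideal (MvPolynomial (DVar n M) R)} (hD : IsDIdeal op J) (hR : IsReflexive op J)
    (H : MvPolynomial (DVar n M) R) (e : ℕ) (w : DVar n M) (k : Fin M) (hk : k ∈ op.σset)
    (h : Tred lt J H e w) : Tred lt J H e (shiftVar w (Pi.single k 1)) := by
  obtain ⟨a, b, ha, hb, hg, hJ⟩ := h
  refine ⟨op.δ k a, fun i => op.δ k (b i), delta_LtS op hvar hconst lt hrank w a ha k,
    fun i => delta_LtS op hvar hconst lt hrank w _ (hb i) k, good_sigma op hR hg k hk, ?_⟩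
  have := hD k _ hJ
  rw [op.map_add, delta_sum] at this
  simpa only [op.sigma_mul k hk, sigma_pow op k hk, hvar] using this

theorem Tred_delta_aux {K R : Type} [Field K] [CommRing R] [Algebra K R]
    {n M : ℕ} (op : DStarOps K (MvPolynomial (DVar n M) R) M)
    (hvar : ∀ (k : Fin M) (u : DVar n M),
      op.δ k (X u) = X (shiftVar u (Pi.single k 1)))
    (hconst : ∀ (k : Fin M) (r : R), ∃ r' : R, op.δ k (C r) = C r')
    (lt : DVar n M → DVar n M → Prop)
    (hrank : IsRanking lt op.σset op.ν)
    {J : Ideal (MvPolynomial (DVar n M) R)} (hD : IsDIdeal op J) (hR : IsReflexive op J)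
    (H : MvPolynomial (DVar n M) R) (w : DVar n M) (k : Fin M) (hk : k ∉ op.σset)
    (f : MvPolynomial (DVar n M) R) (hfs : f ∈ supported R (LeS lt w)) (hfJ : f ∈ J)
    (hg : Good J H (pderiv w f)) : Tred lt J H 1 (shiftVar w (Pi.single k 1)) := by
  obtain ⟨L, hL, he⟩ := delta_strong op hvar hconst lt hrank w k hk f hfs
  have hps : pderiv w f ∈ supported R (LeS lt w) := by
    rw [mem_supported] at hfs ⊢
    intro v hv
    apply hfs
    rw [Finset.mem_coe, mem_vars_iff] at hv ⊢
    have := pderiv_degreeOf_le w v f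
    omega
  refine ⟨op.δ (op.fac k) (pderiv w f), fun _ => L, ?_, fun _ => hL,
    good_sigma op hR hg _ (op.fac_mem k), ?_⟩
  · exact supported_mono (R := R)
      (LeS_sub_LtS hrank (hrank.op_ord w _ k (nu_fac_lt op k hk)))
      (delta_LeS op hvar hconst lt hrank w _ hps _)
  · have := hD k f hfJ
    rw [he] at this
    simpa using this

theorem Tred_one {K R : Type} [Field K] [CommRing R] [Algebra K R]
    {n M : ℕ} (op : DStarOps K (MvPolynomial (DVar n M) R) M)
    (hvar : ∀ (k : Fin M) (u : DVar n M),
      op.δ k (X u) = X (shiftVar u (Pi.single k 1)))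
    (hconst : ∀ (k : Fin M) (r : R), ∃ r' : R, op.δ k (C r) = C r')
    (lt : DVar n M → DVar n M → Prop)
    (hrank : IsRanking lt op.σset op.ν)
    {J : Ideal (MvPolynomial (DVar n M) R)} (hD : IsDIdeal op J) (hR : IsReflexive op J)
    (H : MvPolynomial (DVar n M) R) (w : DVar n M) (k : Fin M)
    (h : Tred lt J H 1 w) : Tred lt J H 1 (shiftVar w (Pi.single k 1)) := by
  by_cases hk : k ∈ op.σset
  · exact Tred_sigma op hvar hconst lt hrank hD hR H 1 w k hk h
  · obtain ⟨a, b, ha, hb, hg, hJ⟩ := h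
    have hsub := supported_mono (R := R) (LtS_sub_LeS lt w)
    refine Tred_delta_aux op hvar hconst lt hrank hD hR H w k hk _ ?_ hJ ?_
    · simp only [Finset.range_one, Finset.sum_singleton, pow_one, pow_zero, mul_one]
      exact add_mem (mul_mem (hsub ha) (X_mem_supp (Or.inl rfl))) (hsub (hb 0))
    · simp only [Finset.range_one, Finset.sum_singleton, pow_one, pow_zero, mul_one]
      rw [map_add, pderiv_mul, pderiv_X_self,
        pderiv_zero_of (supp_degreeOf hrank ha w (Or.inl rfl)),
        pderiv_zero_of (supp_degreeOf hrank (hb 0) w (Or.inl rfl))]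
      simpa using hg

theorem reduce_step {R : Type} [CommRing R] {n M : ℕ} {lt : DVar n M → DVar n M → Prop}
    {σset : Finset (Fin M)} {ν : Fin M → ℕ} (hr : IsRanking lt σset ν)
    {J P : Ideal (MvPolynomial (DVar n M) R)} (hJP : J ≤ P) (H : MvPolynomial (DVar n M) R)
    (e : ℕ) (he : 1 ≤ e) (w : DVar n M) (hT : Tred lt J H e w)
    (g : MvPolynomial (DVar n M) R) (hg : g ∈ P) (hdeg : e ≤ degreeOf w g)
    (ih : ∀ g', Smaller lt g' g → g' ∈ P → InSat J H g') : InSat J H g := by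
  obtain ⟨a, b, ha, hb, hgood, hJ⟩ := hT
  set k := degreeOf w g with hk
  set q := coefU w k g with hq
  set Q := a * X w ^ e + ∑ i ∈ Finset.range e, b i * X w ^ i with hQ
  have hexp : g = q * X w ^ k + restU w g := expand_rest w g
  have hkey : a * g = (q * X w ^ (k - e)) * Q +
      (a * restU w g - q * X w ^ (k - e) * ∑ i ∈ Finset.range e, b i * X w ^ i) := by
    have hX : (X w : MvPolynomial (DVar n M) R) ^ k = X w ^ (k - e) * X w ^ e := by
      rw [← pow_add, Nat.sub_add_cancel hdeg]
    rw [hQ]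
    conv_lhs => rw [hexp, hX]
    ring
  set g' := a * restU w g - q * X w ^ (k - e) * ∑ i ∈ Finset.range e, b i * X w ^ i with hg'
  have hQJ : q * X w ^ (k - e) * Q ∈ J := J.mul_mem_left _ hJ
  have hg'P : g' ∈ P := by
    have : g' = a * g - q * X w ^ (k - e) * Q := by rw [hkey]; ring
    rw [this]
    exact P.sub_mem (P.mul_mem_left _ hg) (hJP hQJ)
  have hq0 : degreeOf w q = 0 := coefU_degreeOf_self w k g
  have hsm : Smaller lt g' g := by
    refine ⟨w, ?_, ?_⟩
    · suffices degreeOf w g' ≤ k - 1 by omega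
      refine (degreeOf_sub_le _ _ _).trans (max_le ?_ ?_)
      · refine (degreeOf_mul_le _ _ _).trans ?_
        rw [supp_degreeOf hr ha w (Or.inl rfl)]
        have := restU_degreeOf_lt w g (by omega)
        omega
      · rw [Finset.mul_sum]
        refine degreeOf_sum_le' _ _ _ _ fun i hi => ?_
        have hi' := Finset.mem_range.1 hi
        have h1 := degreeOf_mul_le w (q * X w ^ (k - e)) (b i * X w ^ i)
        have h2 := degreeOf_mul_le w q (X w ^ (k - e))
        have h3 := degreeOf_mul_le w (b i) (X w ^ i)
        have h4 := supp_degreeOf hr (hb i) w (Or.inl rfl)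
        have h5 := degreeOf_X_pow_le (R := R) w i
        have h6 := degreeOf_X_pow_le (R := R) w (k - e)
        omega
    · intro v hv
      have hne : v ≠ w := by rintro rfl; exact hr.irrefl _ hv
      refine (degreeOf_sub_le _ _ _).trans (max_le ?_ ?_)
      · refine (degreeOf_mul_le _ _ _).trans ?_
        rw [supp_degreeOf hr ha v (Or.inr hv), zero_add]
        exact restU_degreeOf_le w v g
      · rw [Finset.mul_sum]
        refine degreeOf_sum_le' _ _ _ _ fun i hi => ?_
        have h1 := degreeOf_mul_le v (q * X w ^ (k - e)) (b i * X w ^ i)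
        have h2 := degreeOf_mul_le v q (X w ^ (k - e))
        have h3 := degreeOf_mul_le v (b i) (X w ^ i)
        have h4 := supp_degreeOf hr (hb i) v (Or.inr hv)
        have h5 := degreeOf_X_pow_of_ne (R := R) i hne
        have h6 := degreeOf_X_pow_of_ne (R := R) (k - e) hne
        have h7 : degreeOf v q ≤ degreeOf v g := coefU_degreeOf_le w v k g
        omega
  apply hgood
  rw [hkey]
  exact (InSat.of_mem hQJ).add (ih g' hsm hg'P)

end DStarAux

/-- Let `R` be a `ℚ`-algebra, `P` a prime perfect `D`-ideal of the
`D*`-polynomial ring with characteristic set `𝒞`, `H = ∏_{c ∈ 𝒞} I_c·s_c` and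
`B = P ∩ R`. Then `H ∉ P` and `P = ⟨𝒞 ∪ B⟩_D : H^∞`. -/
theorem prime_perfect_ideal_representation
    {K R : Type} [Field K] [CommRing R] [Algebra K R] [Algebra ℚ R]
    {n M : ℕ} (op : DStarOps K (MvPolynomial (DVar n M) R) M)
    (hvar : ∀ (k : Fin M) (u : DVar n M),
      op.δ k (X u) = X (shiftVar u (Pi.single k 1)))
    (hconst : ∀ (k : Fin M) (r : R), ∃ r' : R, op.δ k (C r) = C r')
    (lt : DVar n M → DVar n M → Prop)
    (hrank : IsRanking lt op.σset op.ν)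
    (P : Ideal (MvPolynomial (DVar n M) R)) (hprime : P.IsPrime)
    (hperf : IsPerfectDIdeal op P)
    (𝒞 : Finset (MvPolynomial (DVar n M) R))
    (h𝒞 : IsCharSet lt op.σset P 𝒞)
    (uc : MvPolynomial (DVar n M) R → DVar n M)
    (huc : ∀ c ∈ 𝒞, IsLeader lt c (uc c)) :
    (∏ c ∈ 𝒞, initialOf (uc c) c * pderiv (uc c) c) ∉ P ∧
    ∀ f : MvPolynomial (DVar n M) R,
      f ∈ P ↔ ∃ m : ℕ,
        InReflexiveDIdealGen op
          ((𝒞 : Set (MvPolynomial (DVar n M) R)) ∪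
            ((P : Set (MvPolynomial (DVar n M) R)) ∩
              Set.range (C : R →+* MvPolynomial (DVar n M) R)))
          ((∏ c ∈ 𝒞, initialOf (uc c) c * pderiv (uc c) c) ^ m * f) := by
  classical
  set H := ∏ c ∈ 𝒞, initialOf (uc c) c * pderiv (uc c) c with hH
  set S := (𝒞 : Set (MvPolynomial (DVar n M) R)) ∪
            ((P : Set (MvPolynomial (DVar n M) R)) ∩
              Set.range (C : R →+* MvPolynomial (DVar n M) R)) with hS
  have hHP : H ∉ P := by
    rw [hH, hprime.prod_mem_iff]
    rintro ⟨c, hc, h⟩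
    rcases hprime.mem_or_mem h with h | h
    · exact DStarAux.initial_not_mem hrank h𝒞 uc huc c hc h
    · exact h𝒞.1.2.2 c hc _ (huc c hc) h
  refine ⟨hHP, ?_⟩
  set J := DStarAux.genJ op S with hJ
  have hSP : S ⊆ P := by
    rintro x (hx | hx)
    · exact h𝒞.1.2.1 hx
    · exact hx.1
  have hSJ : S ⊆ J := by
    intro x hx
    rw [SetLike.mem_coe, hJ, DStarAux.mem_genJ]
    exact fun I h _ _ => h hx
  have hJP : J ≤ P := by
    intro x hx
    rw [hJ, DStarAux.mem_genJ] at hx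
    exact hx P hSP hperf.1 hperf.2.1
  have hD : IsDIdeal op J := DStarAux.genJ_D op S
  have hR : IsReflexive op J := DStarAux.genJ_R op S
  have hpos : ∀ c ∈ 𝒞, 1 ≤ degreeOf (uc c) c := fun c hc =>
    Nat.one_le_iff_ne_zero.2 ((DStarAux.mem_vars_iff _ _).1 (huc c hc).1)
  have hsupp : ∀ c ∈ 𝒞, c ∈ supported R (DStarAux.LeS lt (uc c)) := by
    intro c hc
    rw [mem_supported]
    intro v hv
    by_cases h : v = uc c
    · exact Or.inl h
    · exact Or.inr ((huc c hc).2 v hv h)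
  have hbase : ∀ c ∈ 𝒞, DStarAux.Tred lt J H (degreeOf (uc c) c) (uc c) := by
    intro c hc
    have hco : ∀ i, DStarAux.coefU (uc c) i c ∈ supported R (DStarAux.LtS lt (uc c)) := by
      intro i
      rw [mem_supported]
      intro v hv
      rw [Finset.mem_coe, DStarAux.mem_vars_iff] at hv
      refine (huc c hc).2 v ?_ ?_
      · rw [DStarAux.mem_vars_iff]
        have := DStarAux.coefU_degreeOf_le (uc c) v i c
        omega
      · rintro rfl
        exact hv (DStarAux.coefU_degreeOf_self _ _ _)
    refine ⟨DStarAux.coefU (uc c) (degreeOf (uc c) c) c, fun i => DStarAux.coefU (uc c) i c,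
      hco _, hco, DStarAux.good_of_dvd ?_, ?_⟩
    · exact (Dvd.intro _ rfl : initialOf (uc c) c ∣ initialOf (uc c) c * pderiv (uc c) c).trans
        (Finset.dvd_prod_of_mem _ hc)
    · have h := DStarAux.expand_rest (uc c) c
      rw [DStarAux.restU] at h
      rw [← h]
      exact hSJ (Or.inl hc)
  have hsig : ∀ c ∈ 𝒞, ∀ φ, IsSigmaExp op.σset φ →
      DStarAux.Tred lt J H (degreeOf (uc c) c) (shiftVar (uc c) φ) := by
    intro c hc φ hφ
    exact DStarAux.shift_induct (fun w => DStarAux.Tred lt J H (degreeOf (uc c) c) w)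
      (fun k => k ∈ op.σset)
      (fun w k hk hw => DStarAux.Tred_sigma op hvar hconst lt hrank hD hR H _ w k hk hw)
      _ φ (uc c) rfl hφ (hbase c hc)
  have hdel : ∀ c ∈ 𝒞, ∀ φ, IsDeltaExp op.σset φ →
      DStarAux.Tred lt J H 1 (shiftVar (uc c) φ) := by
    rintro c hc φ ⟨k, hk, hk0⟩
    rw [DStarAux.exp_split φ k hk0, ← DStarAux.shift_add]
    refine DStarAux.shift_induct (fun w => DStarAux.Tred lt J H 1 w) (fun _ => True)
      (fun w k _ hw => DStarAux.Tred_one op hvar hconst lt hrank hD hR H w k hw)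
      _ _ _ rfl (fun _ _ => trivial) ?_
    refine DStarAux.Tred_delta_aux op hvar hconst lt hrank hD hR H _ k hk c (hsupp c hc)
      (hSJ (Or.inl hc)) (DStarAux.good_of_dvd ?_)
    exact (Dvd.intro_left _ rfl : pderiv (uc c) c ∣ initialOf (uc c) c * pderiv (uc c) c).trans
      (Finset.dvd_prod_of_mem _ hc)
  have main : ∀ g, g ∈ P → DStarAux.InSat J H g := by
    intro g
    induction g using (DStarAux.smaller_wf (R := R) hrank.trichot hrank.irrefl hrank.trans
      hrank.wf).induction with
    | _ g ih =>
    intro hg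
    by_cases hred : ∀ c ∈ 𝒞, ReducedWrt lt op.σset g c
    · apply DStarAux.InSat.of_mem
      have h1 := DStarAux.reduced_coeffs hrank h𝒞 uc huc g hg hred
      rw [as_sum g]
      refine J.sum_mem fun d _ => ?_
      rw [monomial_eq]
      exact J.mul_mem_right _ (hSJ (Or.inr ⟨h1 d, ⟨_, rfl⟩⟩))
    · push Not at hred
      obtain ⟨c, hc, hnr⟩ := hred
      by_contra hcon
      apply hnr
      intro u hu
      have huu := DStarAux.leader_unique hrank hu (huc c hc)
      subst huu
      refine ⟨fun φ hφ hm => hcon ?_, fun φ hφ => ?_⟩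
      · exact DStarAux.reduce_step hrank hJP H 1 le_rfl _ (hdel c hc φ hφ) g hg
          (Nat.one_le_iff_ne_zero.2 ((DStarAux.mem_vars_iff _ _).1 hm)) ih
      · by_contra hle
        exact hcon (DStarAux.reduce_step hrank hJP H _ (hpos c hc) _ (hsig c hc φ hφ) g hg
          (not_lt.1 hle) ih)
  intro f
  constructor
  · intro hf
    obtain ⟨m, hm⟩ := main f hf
    exact ⟨m, (DStarAux.mem_genJ op S _).1 hm⟩
  · rintro ⟨m, hm⟩
    have h1 : H ^ m * f ∈ P := hm P hSP hperf.1 hperf.2.1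
    rcases hprime.mem_or_mem h1 with h | h
    · exact absurd (hprime.mem_of_pow_mem m h) hHP
    · exact h
end

section
/- (D*-basis theorem) Let (R,e) be a D*-ring with R a ℚ-algebra, satisfying the ascending chain condition on perfect D-ideals. Then the D*-polynomial ring R{x₁,…,xₙ}_{D*} also satisfies the ascending chain condition on perfect D-ideals; equivalently, every perfect D-ideal of R{x₁,…,xₙ}_{D*} is finitely generated as a perfect D-ideal. -/
open MvPolynomial
open scoped BigOperators

variable {K : Type} [Field K] {A : Type} [CommRing A] [Algebra K A] {M : ℕ}

section Perfect

theorem op_zero (op : DStarOps K A M) (k : Fin M) : op.δ k 0 = 0 := by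
  have := op.map_add k 0 0
  simpa using this

theorem op_sum (op : DStarOps K A M) (k : Fin M) {ι : Type*} (s : Finset ι) (f : ι → A) :
    op.δ k (∑ i ∈ s, f i) = ∑ i ∈ s, op.δ k (f i) := by
  classical
  induction s using Finset.induction_on with
  | empty => simp [op_zero]
  | insert a s ha ih => rw [Finset.sum_insert ha, op.map_add, ih, Finset.sum_insert ha]

theorem sigma_pow (op : DStarOps K A M) (k : Fin M) (hk : k ∈ op.σset) (a : A) (e : ℕ) :
    op.δ k (a ^ e) = op.δ k a ^ e := by
  induction e with
  | zero => simp [op.sigma_one k hk]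
  | succ e ih => rw [pow_succ, op.sigma_mul k hk, ih, pow_succ]

/-- The colon ideal `(I : s)`. -/
def colonEl (I : Ideal A) (s : A) : Ideal A :=
  Submodule.comap (LinearMap.mulRight A s) I

theorem mem_colonEl {I : Ideal A} {s a : A} : a ∈ colonEl I s ↔ a * s ∈ I := Iff.rfl

theorem colon_perfect (op : DStarOps K A M) {I : Ideal A} (hI : IsPerfectDIdeal op I) (s : A) :
    IsPerfectDIdeal op (colonEl I s) := by
  obtain ⟨hD, hr, hrad⟩ := hI
  have hsig : ∀ k ∈ op.σset, ∀ a, a * s ∈ I → op.δ k a * s ∈ I := by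
    intro k hk a ha
    apply hr k hk
    have h1 := hD k _ ha
    rw [op.sigma_mul k hk] at h1
    rw [op.sigma_mul k hk]
    have := I.mul_mem_left (s * op.δ k (op.δ k a)) h1
    convert this using 1
    ring
  refine ⟨?_, ?_, ?_⟩
  · have key : ∀ N k, op.ν k = N → ∀ a, a * s ∈ I → op.δ k a * s ∈ I := by
      intro N
      induction N using Nat.strong_induction_on with
      | _ N ih =>
        intro k hN a ha
        by_cases hk : k ∈ op.σset
        · exact hsig k hk a ha
        have hfk := op.fac_mem k
        have h1 := I.mul_mem_right s (hD k _ ha)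
        rw [op.prod_rule k hk, add_mul, add_mul, Finset.sum_mul] at h1
        have h3 : (∑ pq ∈ Finset.univ.filter
          (fun pq : Fin M × Fin M =>
            pq.1 ∉ op.σset ∧ pq.2 ∉ op.σset ∧ op.fac pq.1 = op.fac k ∧ op.fac pq.2 = op.fac k ∧
              op.ν pq.1 + op.ν pq.2 ≤ op.ν k),
            (op.α k pq.1 pq.2 • (op.δ pq.1 a * op.δ pq.2 s)) * s) ∈ I := by
          apply Ideal.sum_mem
          rintro ⟨p, q⟩ hpq
          simp only [Finset.mem_filter, Finset.mem_univ, true_and] at hpq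
          obtain ⟨hp, hq, -, -, hle⟩ := hpq
          have := op.nu_delta q hq
          have h4 := ih (op.ν p) (by omega) p rfl a ha
          rw [smul_mul_assoc]
          apply Submodule.smul_of_tower_mem
          have := I.mul_mem_left (op.δ q s) h4
          convert this using 1
          ring
        have h2 : op.δ (op.fac k) a * op.δ k s * s ∈ I := by
          have := I.mul_mem_left (op.δ k s) (hsig _ hfk a ha)
          convert this using 1
          ring
        have h5 : op.δ k a * op.δ (op.fac k) s * s ∈ I := by
          have := I.sub_mem (I.sub_mem h1 h3) h2
          convert this using 1
          ring
        apply hr _ hfk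
        rw [op.sigma_mul _ hfk]
        have := I.mul_mem_left (op.δ (op.fac k) (op.δ k a)) h5
        convert this using 1
        ring
    intro k a ha
    exact key _ k rfl a ha
  · intro k hk a ha
    rw [mem_colonEl] at ha ⊢
    apply hr k hk
    rw [op.sigma_mul k hk]
    have := I.mul_mem_left (op.δ k s) ha
    convert this using 1
    ring
  · rintro a ⟨m, hm⟩
    rw [mem_colonEl] at hm ⊢
    apply hrad
    refine ⟨m + 1, ?_⟩
    have := I.mul_mem_left (a * s ^ m) hm
    convert this using 1
    ring

theorem sigma_cancel (op : DStarOps K A M) {Q : Ideal A} (hQ : IsPerfectDIdeal op Q)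
    (k : Fin M) (hk : k ∈ op.σset) (s g : A) (h : op.δ k s * g ∈ Q) : s * g ∈ Q := by
  have := (colon_perfect op hQ g).2.1 k hk s
  apply this
  rw [mem_colonEl, mul_assoc]
  exact Q.mul_mem_left _ h

/-- Perfect closure. -/
def pcl (op : DStarOps K A M) (S : Set A) : Ideal A :=
  sInf {I : Ideal A | S ⊆ I ∧ IsPerfectDIdeal op I}

theorem mem_pcl {op : DStarOps K A M} {S : Set A} {x : A} :
    x ∈ pcl op S ↔ ∀ I : Ideal A, S ⊆ I → IsPerfectDIdeal op I → x ∈ I := by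
  simp only [pcl, Submodule.mem_sInf, Set.mem_ofPred_eq, and_imp]

theorem subset_pcl (op : DStarOps K A M) (S : Set A) : S ⊆ pcl op S := by
  intro x hx
  exact mem_pcl.2 fun I h _ => h hx

theorem pcl_le {op : DStarOps K A M} {S : Set A} {I : Ideal A} (h : S ⊆ I)
    (hI : IsPerfectDIdeal op I) : pcl op S ≤ I := fun _ hx => mem_pcl.1 hx I h hI

theorem pcl_perfect (op : DStarOps K A M) (S : Set A) : IsPerfectDIdeal op (pcl op S) := by
  refine ⟨?_, ?_, ?_⟩
  · intro k a ha
    exact mem_pcl.2 fun I h hI => hI.1 k a (mem_pcl.1 ha I h hI)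
  · intro k hk a ha
    exact mem_pcl.2 fun I h hI => hI.2.1 k hk a (mem_pcl.1 ha I h hI)
  · rintro a ⟨m, hm⟩
    exact mem_pcl.2 fun I h hI => hI.2.2 ⟨m, mem_pcl.1 hm I h hI⟩

theorem pcl_mono (op : DStarOps K A M) {S T : Set A} (h : S ⊆ T) : pcl op S ≤ pcl op T :=
  pcl_le (h.trans (subset_pcl op T)) (pcl_perfect op T)

/-- A directed family of perfect ideals has perfect supremum. -/
theorem directed_perfect (op : DStarOps K A M) {ι : Type*} [Nonempty ι] (c : ι → Ideal A)
    (hc : Directed (· ≤ ·) c) (hp : ∀ i, IsPerfectDIdeal op (c i)) :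
    IsPerfectDIdeal op (⨆ i, c i) := by
  refine ⟨?_, ?_, ?_⟩
  · intro k a ha
    rw [Submodule.mem_iSup_of_directed _ hc] at ha ⊢
    obtain ⟨i, hi⟩ := ha
    exact ⟨i, (hp i).1 k a hi⟩
  · intro k hk a ha
    rw [Submodule.mem_iSup_of_directed _ hc] at ha ⊢
    obtain ⟨i, hi⟩ := ha
    exact ⟨i, (hp i).2.1 k hk a hi⟩
  · rintro a ⟨m, ha⟩
    rw [Submodule.mem_iSup_of_directed _ hc] at ha ⊢
    obtain ⟨i, hi⟩ := ha
    exact ⟨i, (hp i).2.2 ⟨m, hi⟩⟩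

theorem pcl_compact (op : DStarOps K A M) {S : Set A} {x : A} (hx : x ∈ pcl op S) :
    ∃ F : Finset A, (F : Set A) ⊆ S ∧ x ∈ pcl op (F : Set A) := by
  classical
  let ι := {F : Finset A // (F : Set A) ⊆ S}
  haveI : Nonempty ι := ⟨⟨∅, by simp⟩⟩
  let c : ι → Ideal A := fun F => pcl op (F.1 : Set A)
  have hc : Directed (· ≤ ·) c := by
    intro F G
    refine ⟨⟨F.1 ∪ G.1, by simpa using ⟨F.2, G.2⟩⟩, pcl_mono op (by simp), pcl_mono op (by simp)⟩
  have hx' : x ∈ ⨆ i, c i := by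
    refine mem_pcl.1 hx _ ?_ (directed_perfect op c hc fun i => pcl_perfect op _)
    intro y hy
    refine (Submodule.mem_iSup_of_directed _ hc).2 ⟨⟨{y}, by simpa using hy⟩, ?_⟩
    exact subset_pcl op _ (by simp)
  obtain ⟨i, hi⟩ := (Submodule.mem_iSup_of_directed _ hc).1 hx'
  exact ⟨i.1, i.2, hi⟩

theorem pcl_compact' (op : DStarOps K A M) {S : Set A} (G : Finset A)
    (hG : (G : Set A) ⊆ pcl op S) :
    ∃ F : Finset A, (F : Set A) ⊆ S ∧ (G : Set A) ⊆ pcl op (F : Set A) := by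
  classical
  induction G using Finset.induction_on with
  | empty => exact ⟨∅, by simp, by simp⟩
  | insert a s ha ih =>
    rw [Finset.coe_insert, Set.insert_subset_iff] at hG
    obtain ⟨F, hF, h1⟩ := ih hG.2
    obtain ⟨F', hF', h2⟩ := pcl_compact op hG.1
    refine ⟨F ∪ F', by simpa using ⟨hF, hF'⟩, ?_⟩
    rw [Finset.coe_insert, Set.insert_subset_iff]
    exact ⟨pcl_mono op (by simp) h2, h1.trans (pcl_mono op (by simp))⟩

/-- finitely generated as a perfect ideal -/
def PFG (op : DStarOps K A M) (I : Ideal A) : Prop :=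
  ∃ F : Finset A, (F : Set A) ⊆ I ∧ I ≤ pcl op (F : Set A)

theorem acc_of_pfg (op : DStarOps K A M) (h : ∀ I, IsPerfectDIdeal op I → PFG op I)
    (c : ℕ → Ideal A) (hc : Monotone c) (hp : ∀ i, IsPerfectDIdeal op (c i)) :
    ∃ N : ℕ, ∀ m : ℕ, N ≤ m → c m = c N := by
  have hd : Directed (· ≤ ·) c := hc.directed_le
  obtain ⟨F, hF, hle⟩ := h _ (directed_perfect op c hd hp)
  have : ∃ N, (F : Set A) ⊆ c N := by
    clear hle
    classical
    induction F using Finset.induction_on with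
    | empty => exact ⟨0, by simp⟩
    | insert a s ha ih =>
      rw [Finset.coe_insert, Set.insert_subset_iff] at hF
      obtain ⟨N, hN⟩ := ih hF.2
      obtain ⟨N', hN'⟩ := (Submodule.mem_iSup_of_directed _ hd).1 hF.1
      refine ⟨max N N', ?_⟩
      rw [Finset.coe_insert, Set.insert_subset_iff]
      exact ⟨hc (le_max_right _ _) hN', hN.trans (hc (le_max_left _ _))⟩
  obtain ⟨N, hN⟩ := this
  refine ⟨N, fun m hm => le_antisymm ?_ (hc hm)⟩
  exact (le_iSup c m).trans (hle.trans (pcl_le hN (hp N)))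

theorem pfg_of_acc (op : DStarOps K A M)
    (hACC : ∀ c : ℕ → Ideal A, Monotone c →
      (∀ i : ℕ, IsPerfectDIdeal op (c i)) → ∃ N : ℕ, ∀ m : ℕ, N ≤ m → c m = c N)
    (I : Ideal A) (hI : IsPerfectDIdeal op I) : PFG op I := by
  classical
  by_contra hn
  have step : ∀ F : {F : Finset A // (F : Set A) ⊆ I}, ∃ x ∈ I, x ∉ pcl op (F.1 : Set A) := by
    intro F
    by_contra hcon
    push Not at hcon
    exact hn ⟨F.1, F.2, hcon⟩
  choose x hxI hx using step
  let nxt : {F : Finset A // (F : Set A) ⊆ I} → {F : Finset A // (F : Set A) ⊆ I} := fun F =>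
    ⟨insert (x F) F.1, by
      rw [Finset.coe_insert, Set.insert_subset_iff]; exact ⟨hxI F, F.2⟩⟩
  let s : ℕ → {F : Finset A // (F : Set A) ⊆ I} := fun m => nxt^[m] ⟨∅, by simp⟩
  have hs : ∀ m, s (m + 1) = nxt (s m) := fun m => Function.iterate_succ_apply' _ _ _
  obtain ⟨N, hN⟩ := hACC (fun m => pcl op ((s m).1 : Set A)) (by
    apply monotone_nat_of_le_succ
    intro m
    apply pcl_mono
    rw [hs]
    simp [nxt]) (fun i => pcl_perfect op _)
  have h1 := hN (N + 1) (by omega)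
  apply hx (s N)
  rw [← h1, hs]
  exact subset_pcl op _ (by simp [nxt])

/-- If some perfect ideal is not finitely generated there is a prime one which is
maximal such. -/
theorem exists_max_prime (op : DStarOps K A M)
    (h : ¬ ∀ I, IsPerfectDIdeal op I → PFG op I) :
    ∃ I : Ideal A, IsPerfectDIdeal op I ∧ ¬ PFG op I ∧ I.IsPrime ∧
      ∀ a ∉ I, ∃ F : Finset A, (F : Set A) ⊆ I ∧ I ≤ pcl op (insert a (F : Set A)) := by
  classical
  push Not at h
  obtain ⟨I0, hI0, hI0'⟩ := h
  obtain ⟨I, -, hmax⟩ := zorn_le_nonempty₀ {I : Ideal A | IsPerfectDIdeal op I ∧ ¬ PFG op I} (by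
    intro c hcs hc y hy
    haveI : Nonempty c := ⟨⟨y, hy⟩⟩
    have hd : Directed (· ≤ ·) (fun i : c => (i : Ideal A)) := hc.directed
    refine ⟨⨆ i : c, (i : Ideal A), ⟨directed_perfect op _ hd fun i => (hcs i.2).1, ?_⟩, ?_⟩
    · rintro ⟨F, hF, hle⟩
      have : ∃ i : c, (F : Set A) ⊆ (i : Ideal A) := by
        clear hle
        induction F using Finset.induction_on with
        | empty => exact ⟨⟨y, hy⟩, by simp⟩
        | insert a s ha ih =>
          rw [Finset.coe_insert, Set.insert_subset_iff] at hF
          obtain ⟨N, hN⟩ := ih hF.2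
          obtain ⟨N', hN'⟩ := (Submodule.mem_iSup_of_directed _ hd).1 hF.1
          obtain ⟨L, hL1, hL2⟩ := hd N N'
          refine ⟨L, ?_⟩
          rw [Finset.coe_insert, Set.insert_subset_iff]
          exact ⟨hL2 hN', hN.trans hL1⟩
      obtain ⟨i, hi⟩ := this
      exact (hcs i.2).2 ⟨F, hi, (le_iSup (fun i : c => (i : Ideal A)) i).trans hle⟩
    · intro z hz
      exact le_iSup (fun i : c => (i : Ideal A)) ⟨z, hz⟩) I0 ⟨hI0, hI0'⟩
  obtain ⟨⟨hI, hnf⟩, hmx⟩ := hmax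
  have key : ∀ a ∉ I, ∃ F : Finset A, (F : Set A) ⊆ I ∧ I ≤ pcl op (insert a (F : Set A)) := by
    intro a ha
    have hle : I ≤ pcl op (insert a (I : Set A)) :=
      (Set.subset_insert a (I : Set A)).trans (subset_pcl op _)
    have haP : a ∈ pcl op (insert a (I : Set A)) := subset_pcl op _ (Set.mem_insert _ _)
    have hfg : PFG op (pcl op (insert a (I : Set A))) := by
      by_contra hcon
      exact ha (hmx ⟨pcl_perfect op _, hcon⟩ hle haP)
    obtain ⟨G, hG, hle2⟩ := hfg
    obtain ⟨F, hF, hGF⟩ := pcl_compact' op G hG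
    refine ⟨F.erase a, ?_, ?_⟩
    · intro x hx
      rw [Finset.coe_erase] at hx
      rcases hF hx.1 with h | h
      · exact absurd h hx.2
      · exact h
    · refine hle.trans (hle2.trans ((pcl_le hGF (pcl_perfect op _)).trans (pcl_mono op ?_)))
      intro x hx
      by_cases hxa : x = a
      · exact Or.inl hxa
      · right
        simpa using ⟨hx, hxa⟩
  refine ⟨I, hI, hnf, ?_, key⟩
  rw [Ideal.isPrime_iff]
  constructor
  · rintro rfl
    apply hnf
    refine ⟨{1}, by simp, ?_⟩
    rw [top_le_iff, Ideal.eq_top_iff_one]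
    exact subset_pcl op _ (by simp)
  · intro a b hab
    by_contra hcon
    push Not at hcon
    obtain ⟨Fa, hFa, ha⟩ := key a hcon.1
    obtain ⟨Fb, hFb, hb⟩ := key b hcon.2
    apply hnf
    refine ⟨insert (a * b) (Fa ∪ Fb), ?_, ?_⟩
    · rw [Finset.coe_insert, Set.insert_subset_iff]
      exact ⟨hab, by simpa using ⟨hFa, hFb⟩⟩
    · set J := pcl op ((insert (a * b) (Fa ∪ Fb) : Finset A) : Set A) with hJ
      have hJp : IsPerfectDIdeal op J := pcl_perfect op _
      have hsub := subset_pcl op ((insert (a * b) (Fa ∪ Fb) : Finset A) : Set A)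
      have hIb : I ≤ colonEl J b := by
        refine ha.trans (pcl_le ?_ (colon_perfect op hJp b))
        rw [Set.insert_subset_iff]
        refine ⟨mem_colonEl.2 (hsub (by simp)), fun y hy => mem_colonEl.2 (J.mul_mem_right _ (hsub ?_))⟩
        have : y ∈ Fa := hy
        simp [this]
      intro x hx
      have hIx : I ≤ colonEl J x := by
        refine hb.trans (pcl_le ?_ (colon_perfect op hJp x))
        rw [Set.insert_subset_iff]
        refine ⟨mem_colonEl.2 ?_, fun y hy => mem_colonEl.2 (J.mul_mem_right _ (hsub ?_))⟩
        · rw [mul_comm]; exact hIb hx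
        have : y ∈ Fb := hy
        simp [this]
      exact hJp.2.2 ⟨2, by rw [sq]; exact hIx hx⟩

end Perfect
section Poly

theorem exists_ranking {n M : ℕ} (σset : Finset (Fin M)) (ν : Fin M → ℕ)
    (h0 : ∀ k ∈ σset, ν k = 0) :
    ∃ lt : DVar n M → DVar n M → Prop, IsRanking lt σset ν := by
  let wt : DVar n M → ℕ := fun u => ∑ l, u.2 l * (ν l + 1)
  let key : DVar n M → ℕ ×ₗ (Lex (Fin M → ℕ) ×ₗ Fin n) :=
    fun u => toLex (wt u, toLex (toLex u.2, u.1))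
  have hwt : ∀ (u : DVar n M) k, wt (shiftVar u (Pi.single k 1)) = wt u + (ν k + 1) := by
    intro u k
    simp only [wt, shiftVar, add_mul, Finset.sum_add_distrib]
    congr 1
    simp [Pi.single_apply]
  have hsh : ∀ (u : DVar n M) k, toLex (shiftVar u (Pi.single k 1)).2 =
      toLex u.2 + toLex (Pi.single k 1) := by
    intro u k
    rfl
  refine ⟨fun u v => key u < key v, ?_, ?_, ?_, ?_, ?_, ?_, ?_, h0⟩
  · intro u v
    rcases lt_trichotomy (key u) (key v) with h | h | h
    · exact Or.inl h
    · right; left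
      simp only [key, toLex_inj, Prod.mk.injEq] at h
      exact Prod.ext h.2.2 h.2.1
    · exact Or.inr (Or.inr h)
  · intro u; exact lt_irrefl _
  · intro u v w; exact lt_trans
  · exact InvImage.wf key wellFounded_lt
  · intro u k
    rw [Prod.Lex.toLex_lt_toLex]
    left
    simp only
    rw [hwt]; omega
  · intro u v k h
    simp only [key] at h ⊢
    rw [Prod.Lex.toLex_lt_toLex, Prod.Lex.toLex_lt_toLex] at h ⊢
    simp only [hwt, hsh] at h ⊢
    rcases h with h | ⟨h, h' | ⟨h', h''⟩⟩
    · left; omega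
    · right; refine ⟨by omega, Or.inl ?_⟩
      exact add_lt_add_left h' _
    · right; refine ⟨by omega, Or.inr ⟨?_, h''⟩⟩
      simpa using h'
  · intro u k k' h
    rw [Prod.Lex.toLex_lt_toLex]
    left
    simp only
    rw [hwt, hwt]; omega

theorem exists_max_var {n M : ℕ} {lt : DVar n M → DVar n M → Prop} {σset : Finset (Fin M)}
    {ν : Fin M → ℕ} (H : IsRanking lt σset ν) (s : Finset (DVar n M)) (hs : s.Nonempty) :
    ∃ u ∈ s, ∀ v ∈ s, v = u ∨ lt v u := by
  classical
  induction hs using Finset.Nonempty.cons_induction with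
  | singleton a => exact ⟨a, by simp, by simp⟩
  | cons a s h hs ih =>
    obtain ⟨u, hu, hmax⟩ := ih
    rcases H.trichot a u with h1 | h1 | h1
    · refine ⟨u, by simp [hu], fun v hv => ?_⟩
      rcases Finset.mem_cons.1 hv with rfl | hv
      · exact Or.inr h1
      · exact hmax v hv
    · refine ⟨u, by simp [hu], fun v hv => ?_⟩
      rcases Finset.mem_cons.1 hv with rfl | hv
      · exact Or.inl h1
      · exact hmax v hv
    · refine ⟨a, by simp, fun v hv => ?_⟩
      rcases Finset.mem_cons.1 hv with rfl | hv
      · exact Or.inl rfl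
      · right
        rcases hmax v hv with rfl | h2
        · exact h1
        · exact H.trans _ _ _ h2 h1

/-- The standing hypotheses on a `D*`-polynomial ring. -/
structure PolyOps {K R : Type} [Field K] [CommRing R] [Algebra K R] {n M : ℕ}
    (op : DStarOps K (MvPolynomial (DVar n M) R) M)
    (lt : DVar n M → DVar n M → Prop) : Prop where
  hC : ∀ (k : Fin M) (r : R), ∃ r' : R, op.δ k (C r) = C r'
  hX : ∀ (k : Fin M) (u : DVar n M), op.δ k (X u) = X (shiftVar u (Pi.single k 1))
  rk : IsRanking lt op.σset op.ν

variable {R : Type} [CommRing R] [Algebra K R] {n : ℕ}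
  {op : DStarOps K (MvPolynomial (DVar n M) R) M} {lt : DVar n M → DVar n M → Prop}

theorem X_mem_supp {S : Set (DVar n M)} {v : DVar n M} (h : v ∈ S) :
    (X v : MvPolynomial (DVar n M) R) ∈ supported R S :=
  Algebra.subset_adjoin ⟨v, h, rfl⟩

theorem Ksmul_mem (B : Subalgebra R (MvPolynomial (DVar n M) R)) (a : K)
    {x : MvPolynomial (DVar n M) R} (hx : x ∈ B) : a • x ∈ B := by
  rw [← algebraMap_smul R a x]
  exact B.smul_mem hx _

theorem op_supported (H : PolyOps op lt) (S T : Set (DVar n M)) : ∀ N k, op.ν k = N →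
    (∀ v ∈ S, ∀ p, (p = k ∨ op.ν p < op.ν k) → shiftVar v (Pi.single p 1) ∈ T) →
    ∀ f ∈ supported R S, op.δ k f ∈ supported R T := by
  intro N
  induction N using Nat.strong_induction_on with
  | _ N ih =>
    intro k hN hST f hf
    have ih' : ∀ p, op.ν p < op.ν k → ∀ f ∈ supported R S, op.δ p f ∈ supported R T := by
      intro p hp
      refine ih (op.ν p) (by omega) p rfl ?_
      intro v hv q hq
      refine hST v hv q (Or.inr ?_)
      rcases hq with rfl | hq <;> omega
    rw [supported_eq_adjoin_X] at hf
    induction hf using Algebra.adjoin_induction with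
    | mem x hx =>
      obtain ⟨v, hv, rfl⟩ := hx
      rw [H.hX]
      exact X_mem_supp (hST v hv k (Or.inl rfl))
    | algebraMap r =>
      obtain ⟨r', hr'⟩ := H.hC k r
      rw [algebraMap_eq, hr']
      exact (supported R T).algebraMap_mem r'
    | add x y hx hy hx' hy' =>
      rw [op.map_add]
      exact add_mem hx' hy'
    | mul x y hx hy hx' hy' =>
      by_cases hk : k ∈ op.σset
      · rw [op.sigma_mul k hk]
        exact mul_mem hx' hy'
      · have hf : op.ν (op.fac k) < op.ν k := by
          have := op.nu_sigma _ (op.fac_mem k)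
          have := op.nu_delta k hk
          omega
        rw [op.prod_rule k hk]
        refine add_mem (add_mem (mul_mem hx' (ih' _ hf _ hy)) (mul_mem (ih' _ hf _ hx) hy')) ?_
        refine sum_mem ?_
        rintro ⟨p, q⟩ hpq
        simp only [Finset.mem_filter, Finset.mem_univ, true_and] at hpq
        obtain ⟨hp, hq, -, -, hle⟩ := hpq
        have := op.nu_delta q hq
        have := op.nu_delta p hp
        exact Ksmul_mem _ _ (mul_mem (ih' p (by omega) _ hx) (ih' q (by omega) _ hy))

/-- Polynomials in variables below `u`. -/
noncomputable def Low (R : Type) [CommRing R] {n M : ℕ} (lt : DVar n M → DVar n M → Prop) (u : DVar n M) :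
    Subalgebra R (MvPolynomial (DVar n M) R) := supported R {v | lt v u}

/-- Polynomials in variables at most `u`. -/
noncomputable def LowE (R : Type) [CommRing R] {n M : ℕ} (lt : DVar n M → DVar n M → Prop) (u : DVar n M) :
    Subalgebra R (MvPolynomial (DVar n M) R) := supported R {v | v = u ∨ lt v u}

theorem low_le_lowE (u : DVar n M) : Low R lt u ≤ LowE R lt u :=
  supported_mono fun _ h => Or.inr h

theorem X_mem_lowE (u : DVar n M) : (X u : MvPolynomial (DVar n M) R) ∈ LowE R lt u :=
  X_mem_supp (Or.inl rfl)

theorem op_low (H : PolyOps op lt) (k : Fin M) (u : DVar n M) {f} (hf : f ∈ Low R lt u) :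
    op.δ k f ∈ Low R lt (shiftVar u (Pi.single k 1)) := by
  refine op_supported H _ _ _ k rfl ?_ f hf
  rintro v hv p (rfl | hp)
  · exact H.rk.mono _ _ _ hv
  · exact H.rk.trans _ _ _ (H.rk.op_ord v p k hp) (H.rk.mono _ _ _ hv)

theorem op_lowE_lt (H : PolyOps op lt) (p k : Fin M) (hpk : op.ν p < op.ν k) (u : DVar n M) {f}
    (hf : f ∈ LowE R lt u) :
    op.δ p f ∈ Low R lt (shiftVar u (Pi.single k 1)) := by
  refine op_supported H _ _ _ p rfl ?_ f hf
  intro v hv q hq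
  have hqk : op.ν q < op.ν k := by
    rcases hq with rfl | hq <;> omega
  rcases hv with rfl | hv
  · exact H.rk.op_ord _ _ _ hqk
  · exact H.rk.trans _ _ _ (H.rk.op_ord v q k hqk) (H.rk.mono _ _ _ hv)

theorem fac_lt (op : DStarOps K A M) {k : Fin M} (hk : k ∉ op.σset) :
    op.ν (op.fac k) < op.ν k := by
  have := op.nu_sigma _ (op.fac_mem k)
  have := op.nu_delta k hk
  omega

/-- Leibniz rule modulo lower terms. -/
theorem op_mul_mod (H : PolyOps op lt) (k : Fin M) (hk : k ∉ op.σset) (u : DVar n M) {a b}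
    (ha : a ∈ LowE R lt u) (hb : b ∈ LowE R lt u) :
    ∃ T ∈ Low R lt (shiftVar u (Pi.single k 1)),
      op.δ k (a * b) = op.δ k a * op.δ (op.fac k) b + op.δ (op.fac k) a * op.δ k b + T := by
  refine ⟨_, ?_, op.prod_rule k hk a b⟩
  refine sum_mem ?_
  rintro ⟨p, q⟩ hpq
  simp only [Finset.mem_filter, Finset.mem_univ, true_and] at hpq
  obtain ⟨hp, hq, -, -, hle⟩ := hpq
  have := op.nu_delta q hq
  have := op.nu_delta p hp
  exact Ksmul_mem _ _ (mul_mem (op_lowE_lt H p k (by omega) u ha)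
    (op_lowE_lt H q k (by omega) u hb))

theorem op_pow_mod (H : PolyOps op lt) (k : Fin M) (hk : k ∉ op.σset) (u : DVar n M) (j : ℕ) :
    ∃ T ∈ Low R lt (shiftVar u (Pi.single k 1)),
      op.δ k (X u ^ (j + 1)) = op.δ (op.fac k) (((j : MvPolynomial (DVar n M) R) + 1) * X u ^ j)
        * X (shiftVar u (Pi.single k 1)) + T := by
  have hs := op.fac_mem k
  have hone := op.sigma_one _ hs
  have hnat : ∀ m : ℕ, op.δ (op.fac k) (m : MvPolynomial (DVar n M) R) = m := by
    intro m
    induction m with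
    | zero => simp [op_zero]
    | succ m ih => rw [Nat.cast_succ, op.map_add, ih, hone]
  induction j with
  | zero => exact ⟨0, zero_mem _, by simp [H.hX, hone]⟩
  | succ j ih =>
    obtain ⟨T, hT, h1⟩ := ih
    obtain ⟨T', hT', h2⟩ := op_mul_mod H k hk u (pow_mem (X_mem_lowE (R := R) (lt := lt) u) (j + 1))
      (X_mem_lowE u)
    refine ⟨T * op.δ (op.fac k) (X u) + T', add_mem (mul_mem hT
      (op_lowE_lt H _ k (fac_lt op hk) u (X_mem_lowE u))) hT', ?_⟩
    rw [pow_succ, h2, h1, H.hX k u]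
    simp only [op.sigma_mul _ hs, op.map_add, sigma_pow _ _ hs, hnat, hone, Nat.cast_succ]
    ring

/-- `∑_{j ≤ d} c j u^j`. -/
noncomputable def lsum (u : DVar n M) (c : ℕ → MvPolynomial (DVar n M) R) (d : ℕ) :
    MvPolynomial (DVar n M) R := ∑ j ∈ Finset.range d, c j * X u ^ j

theorem lsum_succ (u : DVar n M) (c : ℕ → MvPolynomial (DVar n M) R) (d : ℕ) :
    lsum u c (d + 1) = lsum u c d + c d * X u ^ d := Finset.sum_range_succ _ _

/-- coefficients of the formal derivative -/
noncomputable def dcoef (c : ℕ → MvPolynomial (DVar n M) R) : ℕ → MvPolynomial (DVar n M) R :=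
  fun j => ((j : MvPolynomial (DVar n M) R) + 1) * c (j + 1)

theorem dcoef_mem {B : Subalgebra R (MvPolynomial (DVar n M) R)}
    {c : ℕ → MvPolynomial (DVar n M) R} (hc : ∀ j, c j ∈ B) (j : ℕ) : dcoef c j ∈ B :=
  mul_mem (add_mem (natCast_mem B j) (one_mem _)) (hc _)

theorem lsum_mem_lowE {u : DVar n M} {c : ℕ → MvPolynomial (DVar n M) R}
    (hc : ∀ j, c j ∈ Low R lt u) (d : ℕ) : lsum u c d ∈ LowE R lt u :=
  sum_mem fun j _ => mul_mem (low_le_lowE u (hc j)) (pow_mem (X_mem_lowE u) j)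

theorem op_psum (H : PolyOps op lt) (k : Fin M) (hk : k ∉ op.σset) (u : DVar n M)
    (c : ℕ → MvPolynomial (DVar n M) R) (hc : ∀ j, c j ∈ Low R lt u) (d : ℕ) :
    ∃ T ∈ Low R lt (shiftVar u (Pi.single k 1)),
      op.δ k (lsum u c (d + 1)) = op.δ (op.fac k) (lsum u (dcoef c) d)
        * X (shiftVar u (Pi.single k 1)) + T := by
  induction d with
  | zero =>
    refine ⟨op.δ k (c 0), op_low H k u (hc 0), ?_⟩
    simp [lsum, op_zero]
  | succ d ih =>
    have hs := op.fac_mem k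
    obtain ⟨T, hT, h1⟩ := ih
    obtain ⟨T', hT', h2⟩ := op_mul_mod H k hk u (low_le_lowE u (hc (d + 1)))
      (pow_mem (X_mem_lowE (R := R) (lt := lt) u) (d + 1))
    obtain ⟨T'', hT'', h3⟩ := op_pow_mod H k hk u d
    have hfu := op_lowE_lt H _ k (fac_lt op hk) u (pow_mem (X_mem_lowE (R := R) (lt := lt) u) (d+1))
    have hfc := op_lowE_lt H _ k (fac_lt op hk) u (low_le_lowE u (hc (d + 1)))
    refine ⟨T + op.δ k (c (d + 1)) * op.δ (op.fac k) (X u ^ (d + 1)) +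
      op.δ (op.fac k) (c (d + 1)) * T'' + T', ?_, ?_⟩
    · exact add_mem (add_mem (add_mem hT (mul_mem (op_low H k u (hc _)) hfu))
        (mul_mem hfc hT'')) hT'
    · rw [lsum_succ, op.map_add, h1, h2, h3, lsum_succ, op.map_add, dcoef]
      simp only [op.sigma_mul _ hs]
      ring

/-- `f = s w^e + (lower degree in w)`, coefficients below `w`. -/
def Lead (lt : DVar n M → DVar n M → Prop) (f : MvPolynomial (DVar n M) R) (w : DVar n M)
    (e : ℕ) (s : MvPolynomial (DVar n M) R) : Prop :=
  ∃ c : ℕ → MvPolynomial (DVar n M) R, (∀ j, c j ∈ Low R lt w) ∧ c e = s ∧ f = lsum w c (e + 1)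

theorem lead_sigma (H : PolyOps op lt) (k : Fin M) (hk : k ∈ op.σset) {f w e s}
    (h : Lead (R := R) lt f w e s) :
    Lead lt (op.δ k f) (shiftVar w (Pi.single k 1)) e (op.δ k s) := by
  obtain ⟨c, hc, rfl, rfl⟩ := h
  refine ⟨fun j => op.δ k (c j), fun j => op_low H k w (hc j), rfl, ?_⟩
  simp only [lsum, op_sum, op.sigma_mul k hk, sigma_pow op k hk, H.hX]

theorem lead_one_of {w : DVar n M} {s T : MvPolynomial (DVar n M) R} (hs : s ∈ Low R lt w)
    (hT : T ∈ Low R lt w) : Lead lt (s * X w + T) w 1 s := by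
  refine ⟨fun j => if j = 0 then T else s, ?_, by simp, ?_⟩
  · intro j
    dsimp only
    split_ifs <;> assumption
  · simp [lsum, Finset.sum_range_succ]
    ring

theorem lead_delta (H : PolyOps op lt) (k : Fin M) (hk : k ∉ op.σset) (u : DVar n M)
    (c : ℕ → MvPolynomial (DVar n M) R) (hc : ∀ j, c j ∈ Low R lt u) (d : ℕ) :
    Lead lt (op.δ k (lsum u c (d + 1))) (shiftVar u (Pi.single k 1)) 1
      (op.δ (op.fac k) (lsum u (dcoef c) d)) := by
  obtain ⟨T, hT, h⟩ := op_psum H k hk u c hc d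
  rw [h]
  exact lead_one_of (op_lowE_lt H _ k (fac_lt op hk) u (lsum_mem_lowE (dcoef_mem hc) d)) hT

theorem lead_one_step (H : PolyOps op lt) (k : Fin M) {f w s}
    (h : Lead (R := R) lt f w 1 s) :
    Lead lt (op.δ k f) (shiftVar w (Pi.single k 1)) 1 (op.δ (op.fac k) s) := by
  by_cases hk : k ∈ op.σset
  · rw [op.fac_sigma k hk]
    exact lead_sigma H k hk h
  · obtain ⟨c, hc, rfl, rfl⟩ := h
    have := lead_delta H k hk w c hc 1
    have h2 : lsum w (dcoef c) 1 = c 1 := by simp [lsum, dcoef]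
    rwa [h2] at this

theorem shift_split (φ : Fin M → ℕ) (k : Fin M) (hk : φ k ≠ 0) :
    ∃ φ' : Fin M → ℕ, φ = φ' + Pi.single k 1 := by
  refine ⟨φ - Pi.single k 1, ?_⟩
  ext l
  by_cases h : l = k
  · subst h
    simp
    omega
  · simp [h]

theorem shift_add (u : DVar n M) (φ ψ : Fin M → ℕ) :
    shiftVar u (φ + ψ) = shiftVar (shiftVar u φ) ψ := by
  simp [shiftVar, add_assoc]

theorem shift_zero (u : DVar n M) : shiftVar u 0 = u := by simp [shiftVar]

/-- Transform result: there is a transform `G` of `f` with leader `w` degree `e` and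
leading coefficient `s` which is, up to perfect ideals, `s₀`. -/
def TransRes (op : DStarOps K (MvPolynomial (DVar n M) R) M) (lt : DVar n M → DVar n M → Prop)
    (f s₀ : MvPolynomial (DVar n M) R) (w : DVar n M) (e : ℕ) : Prop :=
  ∃ G s, Lead lt G w e s ∧ (∀ I, IsDIdeal op I → f ∈ I → G ∈ I) ∧
    ∀ Q, IsPerfectDIdeal op Q → ∀ g, s * g ∈ Q → s₀ * g ∈ Q

theorem trans_sigma (H : PolyOps op lt) {f s₀ : MvPolynomial (DVar n M) R} {u : DVar n M} {e : ℕ}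
    (h : TransRes op lt f s₀ u e) : ∀ N (φ : Fin M → ℕ), ∑ l, φ l = N → IsSigmaExp op.σset φ →
      TransRes op lt f s₀ (shiftVar u φ) e := by
  intro N
  induction N with
  | zero =>
    intro φ hφ _
    have : φ = 0 := by
      ext l
      simpa using (Finset.sum_eq_zero_iff.1 hφ) l (Finset.mem_univ l)
    rw [this, shift_zero]
    exact h
  | succ N ih =>
    intro φ hφ hs
    obtain ⟨k, -, hk⟩ : ∃ k ∈ Finset.univ, φ k ≠ 0 := Finset.exists_ne_zero_of_sum_ne_zero
      (by rw [hφ]; omega)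
    have hkσ := hs k hk
    obtain ⟨φ', rfl⟩ := shift_split φ k hk
    obtain ⟨G, s, h1, h2, h3⟩ := ih φ' (by simpa [Finset.sum_add_distrib] using hφ)
      (fun l hl => hs l (by simp only [Pi.add_apply]; omega))
    rw [shift_add]
    exact ⟨_, _, lead_sigma H k hkσ h1, fun I hI hf => hI k _ (h2 I hI hf),
      fun Q hQ g hg => h3 Q hQ g (sigma_cancel op hQ k hkσ _ _ hg)⟩

theorem trans_one (H : PolyOps op lt) {f s₀ : MvPolynomial (DVar n M) R} {u : DVar n M}
    (h : TransRes op lt f s₀ u 1) : ∀ N (φ : Fin M → ℕ), ∑ l, φ l = N →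
      TransRes op lt f s₀ (shiftVar u φ) 1 := by
  intro N
  induction N with
  | zero =>
    intro φ hφ
    have : φ = 0 := by
      ext l
      simpa using (Finset.sum_eq_zero_iff.1 hφ) l (Finset.mem_univ l)
    rw [this, shift_zero]
    exact h
  | succ N ih =>
    intro φ hφ
    obtain ⟨k, -, hk⟩ : ∃ k ∈ Finset.univ, φ k ≠ 0 := Finset.exists_ne_zero_of_sum_ne_zero
      (by rw [hφ]; omega)
    obtain ⟨φ', rfl⟩ := shift_split φ k hk
    obtain ⟨G, s, h1, h2, h3⟩ := ih φ' (by simpa [Finset.sum_add_distrib] using hφ)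
    rw [shift_add]
    exact ⟨_, _, lead_one_step H k h1, fun I hI hf => hI k _ (h2 I hI hf),
      fun Q hQ g hg => h3 Q hQ g (sigma_cancel op hQ _ (op.fac_mem k) _ _ hg)⟩

/-- Every transform of `f` has leading coefficient coming from initial or separant. -/
theorem trans_all (H : PolyOps op lt) (u : DVar n M)
    (c : ℕ → MvPolynomial (DVar n M) R) (hc : ∀ j, c j ∈ Low R lt u) (d : ℕ) (hd : 1 ≤ d)
    (φ : Fin M → ℕ) :
    ∃ e, 1 ≤ e ∧ e ≤ d ∧
      TransRes op lt (lsum u c (d + 1)) (c d * lsum u (dcoef c) d) (shiftVar u φ) e := by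
  by_cases hφ : IsSigmaExp op.σset φ
  · refine ⟨d, hd, le_rfl, trans_sigma H ?_ _ φ rfl hφ⟩
    refine ⟨_, _, ⟨c, hc, rfl, rfl⟩, fun _ _ h => h, fun Q hQ g hg => ?_⟩
    have := Q.mul_mem_left (lsum u (dcoef c) d) hg
    convert this using 1
    ring
  · simp only [IsSigmaExp, not_forall] at hφ
    obtain ⟨k, hk, hkσ⟩ := hφ
    obtain ⟨φ', rfl⟩ := shift_split φ k hk
    refine ⟨1, le_rfl, hd, ?_⟩
    rw [add_comm φ', shift_add]
    have h0 : TransRes op lt (lsum u c (d + 1)) (c d * lsum u (dcoef c) d)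
        (shiftVar u (Pi.single k 1)) 1 := by
      refine ⟨op.δ k (lsum u c (d + 1)), op.δ (op.fac k) (lsum u (dcoef c) d),
        lead_delta H k hkσ u c hc d, fun I hI h => hI k _ h, fun Q hQ g hg => ?_⟩
      have h1 := sigma_cancel op hQ (op.fac k) (op.fac_mem k) (lsum u (dcoef c) d) g hg
      rw [mul_assoc]
      exact Q.mul_mem_left _ h1
    exact trans_one H h0 _ φ' rfl

/-- Every polynomial is constant or has a leader. -/
theorem const_or_psum (H : PolyOps op lt) (g : MvPolynomial (DVar n M) R) :
    (∃ r, g = C r) ∨ ∃ u ∈ g.vars, ∃ c : ℕ → MvPolynomial (DVar n M) R, ∃ d,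
      (∀ j, c j ∈ Low R lt u) ∧ g = lsum u c d := by
  rcases g.vars.eq_empty_or_nonempty with h | h
  · left
    have := mem_supported_vars (R := R) g
    rw [h, Finset.coe_empty, supported_empty] at this
    obtain ⟨r, hr⟩ := Algebra.mem_bot.1 this
    exact ⟨r, hr.symm⟩
  · right
    obtain ⟨u, hu, hmax⟩ := exists_max_var H.rk g.vars h
    refine ⟨u, hu, ?_⟩
    have hg : g ∈ supported R (g.vars : Set (DVar n M)) := mem_supported_vars g
    let B : Subalgebra R (MvPolynomial (DVar n M) R) :=
      ((Polynomial.aeval (R := Low R lt u) (X u : MvPolynomial (DVar n M) R)).range).restrictScalars R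
    have hB : supported R (g.vars : Set (DVar n M)) ≤ B := by
      rw [supported_eq_adjoin_X]
      apply Algebra.adjoin_le
      rintro _ ⟨v, hv, rfl⟩
      rcases hmax v hv with rfl | hlt
      · exact ⟨Polynomial.X, by simp⟩
      · exact ⟨Polynomial.C ⟨X v, X_mem_supp hlt⟩, by simp⟩
    obtain ⟨p, hp⟩ := hB hg
    refine ⟨fun j => (p.coeff j : MvPolynomial (DVar n M) R), p.natDegree + 1,
      fun j => (p.coeff j).2, ?_⟩
    rw [← hp]
    change Polynomial.aeval _ p = _
    rw [Polynomial.aeval_eq_sum_range]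
    rfl

/-- `(u,d)` is attained in `I`. -/
def Att (lt : DVar n M → DVar n M → Prop) (I : Ideal (MvPolynomial (DVar n M) R))
    (u : DVar n M) (d : ℕ) : Prop :=
  1 ≤ d ∧ ∃ c : ℕ → MvPolynomial (DVar n M) R, (∀ j, c j ∈ Low R lt u) ∧
    lsum u c (d + 1) ∈ I ∧ c d ∉ I

theorem lsum_mul_sub (u : DVar n M) {B : Subalgebra R (MvPolynomial (DVar n M) R)}
    (c c' : ℕ → MvPolynomial (DVar n M) R)
    (hc : ∀ j, c j ∈ B) (hc' : ∀ j, c' j ∈ B) (e d : ℕ) (hed : e ≤ d) :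
    ∃ c'' : ℕ → MvPolynomial (DVar n M) R, (∀ j, c'' j ∈ B) ∧
      c' e * lsum u c (d + 1) - c d * X u ^ (d - e) * lsum u c' (e + 1) = lsum u c'' d := by
  obtain ⟨m, rfl⟩ := Nat.exists_eq_add_of_le' hed
  refine ⟨fun j => c' e * c j - if m ≤ j then c (m + e) * c' (j - m) else 0, ?_, ?_⟩
  · intro j
    refine sub_mem (mul_mem (hc' _) (hc _)) ?_
    split_ifs
    · exact mul_mem (hc _) (hc' _)
    · exact zero_mem _
  · have h1 : lsum u (fun j => c' e * c j - if m ≤ j then c (m + e) * c' (j - m) else 0) (m + e) =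
        c' e * lsum u c (m + e) - c (m + e) * X u ^ m * lsum u c' e := by
      simp only [lsum, sub_mul, Finset.sum_sub_distrib, Finset.mul_sum]
      congr 1
      · exact Finset.sum_congr rfl fun j _ => by ring
      · rw [Finset.sum_range_add]
        have h0 : ∑ x ∈ Finset.range m, (if m ≤ x then c (m + e) * c' (x - m) else 0) * X u ^ x
            = 0 := by
          refine Finset.sum_eq_zero fun x hx => ?_
          have := Finset.mem_range.1 hx
          rw [if_neg (by omega), zero_mul]
        rw [h0, zero_add]
        refine Finset.sum_congr rfl fun j _ => ?_
        rw [if_pos (by omega), Nat.add_sub_cancel_left, pow_add]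
        ring
    rw [h1, lsum_succ, lsum_succ, Nat.add_sub_cancel, pow_add]
    ring

theorem reduce (H : PolyOps op lt) {I Q : Ideal (MvPolynomial (DVar n M) R)}
    (hconst : ∀ r, C r ∈ I → C r ∈ Q)
    (hatt : ∀ u d, Att lt I u d → ∃ G s e, e ≤ d ∧ Lead lt G u e s ∧ G ∈ I ∧ G ∈ Q ∧
      ∀ g, s * g ∈ Q → g ∈ Q) : I ≤ Q := by
  have key : ∀ u, ∀ d, ∀ c : ℕ → MvPolynomial (DVar n M) R, (∀ j, c j ∈ Low R lt u) →
      lsum u c d ∈ I → lsum u c d ∈ Q := by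
    intro u
    induction u using H.rk.wf.induction with
    | _ u ih =>
      have ihlow : ∀ f ∈ Low R lt u, f ∈ I → f ∈ Q := by
        intro f hf hfI
        rcases const_or_psum H f with ⟨r, rfl⟩ | ⟨v, hv, c, d, hc, hfc⟩
        · exact hconst r hfI
        · have hvu : lt v u := (mem_supported.1 hf) hv
          rw [hfc] at hfI ⊢
          exact ih v hvu d c hc hfI
      intro d
      induction d with
      | zero => intro c _ _; simp [lsum]
      | succ d ihd =>
        intro c hc hI
        by_cases hcd : c d ∈ I
        · have h1 := ihlow _ (hc d) hcd
          rw [lsum_succ] at hI ⊢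
          refine Q.add_mem (ihd c hc ?_) (Q.mul_mem_right _ h1)
          exact (I.add_mem_iff_left (I.mul_mem_right _ hcd)).1 hI
        · by_cases hd : d = 0
          · subst hd
            simp only [lsum, zero_add, Finset.sum_range_one, pow_zero, mul_one] at hI
            exact absurd hI hcd
          obtain ⟨G, s, e, hed, ⟨c', hc', rfl, rfl⟩, hGI, hGQ, hcan⟩ :=
            hatt u d ⟨by omega, c, hc, hI, hcd⟩
          apply hcan
          obtain ⟨c'', hc'', heq⟩ := lsum_mul_sub u c c' hc hc' e d hed
          have h1 : lsum u c'' d ∈ I := by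
            rw [← heq]
            exact I.sub_mem (I.mul_mem_left _ hI) (I.mul_mem_left _ hGI)
          have h2 := ihd c'' hc'' h1
          rw [← heq] at h2
          exact (Q.sub_mem_iff_left (Q.mul_mem_left _ hGQ)).1 h2
  intro g hg
  rcases const_or_psum H g with ⟨r, rfl⟩ | ⟨v, hv, c, d, hc, hfc⟩
  · exact hconst r hg
  · rw [hfc] at hg ⊢
    exact key v d c hc hg

/-- Finite basis of attained pairs (Dickson). -/
theorem att_basis (I : Ideal (MvPolynomial (DVar n M) R)) :
    ∃ B : Finset (DVar n M × ℕ),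
      (∀ b ∈ B, Att lt I b.1 b.2 ∧ ∀ d < b.2, ¬ Att lt I b.1 d) ∧
      ∀ u d, Att lt I u d → ∃ b ∈ B, b.2 ≤ d ∧ ∃ φ, u = shiftVar b.1 φ := by
  classical
  let E : Fin n → (Fin M → ℕ) × ℕ → Prop := fun j x => Att lt I (j, x.1) x.2
  have hfin : ∀ j, {x | Minimal (E j) x}.Finite := fun j =>
    WellQuasiOrderedLE.finite_of_isAntichain (setOfPred_minimal_antichain _)
  refine ⟨Finset.univ.biUnion fun j => (hfin j).toFinset.image fun x => ((j, x.1), x.2), ?_, ?_⟩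
  · intro b hb
    simp only [Finset.mem_biUnion, Finset.mem_univ, true_and, Finset.mem_image,
      Set.Finite.mem_toFinset] at hb
    obtain ⟨j, x, hx, rfl⟩ := hb
    have hx : Minimal (E j) x := hx
    refine ⟨hx.1, fun d hd hatt => ?_⟩
    have := hx.2 (y := (x.1, d)) hatt ⟨le_rfl, hd.le⟩
    have := this.2
    simp only at this hd
    omega
  · rintro ⟨j, θ⟩ d h
    obtain ⟨x, hxle, hx⟩ := exists_minimal_le_of_wellFoundedLT (E j) (θ, d) h
    refine ⟨((j, x.1), x.2), ?_, hxle.2, θ - x.1, ?_⟩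
    · simp only [Finset.mem_biUnion, Finset.mem_univ, true_and, Finset.mem_image,
        Set.Finite.mem_toFinset]
      exact ⟨j, x, hx, rfl⟩
    · refine Prod.ext rfl ?_
      ext l
      have := hxle.1 l
      simp only [shiftVar, Pi.sub_apply] at this ⊢
      omega

theorem natCast_unit_mul_mem [Algebra ℚ R] {I : Ideal (MvPolynomial (DVar n M) R)} (m : ℕ)
    (x : MvPolynomial (DVar n M) R) (h : ((m : MvPolynomial (DVar n M) R) + 1) * x ∈ I) :
    x ∈ I := by
  have := I.mul_mem_left (algebraMap ℚ (MvPolynomial (DVar n M) R) ((m : ℚ) + 1)⁻¹) h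
  rw [← mul_assoc] at this
  have h2 : ((m : MvPolynomial (DVar n M) R) + 1) =
      algebraMap ℚ (MvPolynomial (DVar n M) R) ((m : ℚ) + 1) := by simp
  rw [h2, ← map_mul, inv_mul_cancel₀ (by positivity), map_one, one_mul] at this
  exact this

theorem sep_not_mem [Algebra ℚ R] {I : Ideal (MvPolynomial (DVar n M) R)} {u : DVar n M} {d : ℕ}
    (hd : 1 ≤ d) (hmin : ∀ d' < d, ¬ Att lt I u d') (c : ℕ → MvPolynomial (DVar n M) R)
    (hc : ∀ j, c j ∈ Low R lt u) (hcd : c d ∉ I) : lsum u (dcoef c) d ∉ I := by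
  intro h
  obtain ⟨m, rfl⟩ := Nat.exists_eq_add_of_le' hd
  have hm : dcoef c m ∉ I := fun h' => hcd (natCast_unit_mul_mem m _ h')
  by_cases hm0 : m = 0
  · subst hm0
    apply hm
    simpa [lsum] using h
  · exact hmin m (by omega) ⟨by omega, dcoef c, dcoef_mem hc, h, hm⟩

end Poly
/-- **`D*`-basis theorem.** Let `(R, e)` be a `D*`-ring with `R` a
`ℚ`-algebra. If `R` has the ascending chain condition on perfect `D`-ideals, then so does
the `D*`-polynomial ring `R{x₁,…,xₙ}_{D*}`. -/
theorem dStar_basis_theorem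
    {K R : Type} [Field K] [CommRing R] [Algebra K R] [Algebra ℚ R]
    {n M : ℕ}
    (opR : DStarOps K R M)
    (opP : DStarOps K (MvPolynomial (DVar n M) R) M)
    -- the D-structure on the polynomial ring extends that of R
    (hσ : opP.σset = opR.σset) (hfac : opP.fac = opR.fac)
    (hν : opP.ν = opR.ν) (hα : opP.α = opR.α)
    (hext : ∀ (k : Fin M) (r : R), opP.δ k (C r) = C (opR.δ k r))
    (hvar : ∀ (k : Fin M) (u : DVar n M),
      opP.δ k (X u) = X (shiftVar u (Pi.single k 1)))
    -- R has the ascending chain condition on perfect D-ideals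
    (hACC : ∀ c : ℕ → Ideal R, Monotone c →
      (∀ i : ℕ, IsPerfectDIdeal opR (c i)) → ∃ N : ℕ, ∀ m : ℕ, N ≤ m → c m = c N) :
    ∀ c : ℕ → Ideal (MvPolynomial (DVar n M) R), Monotone c →
      (∀ i : ℕ, IsPerfectDIdeal opP (c i)) → ∃ N : ℕ, ∀ m : ℕ, N ≤ m → c m = c N := by
  classical
  obtain ⟨lt, hlt⟩ := exists_ranking (n := n) opP.σset opP.ν opP.nu_sigma
  have H : PolyOps opP lt := ⟨fun k r => ⟨_, hext k r⟩, hvar, hlt⟩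
  apply acc_of_pfg
  by_contra hcon
  obtain ⟨I, hI, hnf, hprime, hext1⟩ := exists_max_prime opP hcon
  apply hnf
  have hcomap : ∀ J, IsPerfectDIdeal opP J → IsPerfectDIdeal opR (J.comap C) := by
    intro J hJ
    refine ⟨?_, ?_, ?_⟩
    · intro k a ha
      rw [Ideal.mem_comap] at ha ⊢
      rw [← hext]
      exact hJ.1 k _ ha
    · intro k hk a ha
      rw [Ideal.mem_comap] at ha ⊢
      refine hJ.2.1 k (hσ ▸ hk) _ ?_
      rwa [hext, ← map_mul]
    · rintro a ⟨m, ha⟩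
      rw [Ideal.mem_comap] at ha ⊢
      exact hJ.2.2 ⟨m, by rwa [← map_pow]⟩
  obtain ⟨Fp, hFp, hple⟩ := pfg_of_acc opR hACC _ (hcomap I hI)
  obtain ⟨B, hB, hBall⟩ := att_basis (lt := lt) I
  have hch : ∀ b : B, ∃ c : ℕ → MvPolynomial (DVar n M) R, (∀ j, c j ∈ Low R lt b.1.1) ∧
      lsum b.1.1 c (b.1.2 + 1) ∈ I ∧ c b.1.2 ∉ I := fun b => (hB b.1 b.2).1.2
  choose c hc hcI hcd using hch
  set h : MvPolynomial (DVar n M) R :=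
    ∏ b : B, (c b b.1.2 * lsum b.1.1 (dcoef (c b)) b.1.2) with hh
  have hhI : h ∉ I := by
    rw [hh, hprime.prod_mem_iff]
    rintro ⟨b, -, hb⟩
    rcases hprime.mem_or_mem hb with hb | hb
    · exact hcd b hb
    · exact sep_not_mem (hB b.1 b.2).1.1 (hB b.1 b.2).2 (c b) (hc b) (hcd b) hb
  obtain ⟨F0, hF0, hI0⟩ := hext1 h hhI
  set Λ : Finset (MvPolynomial (DVar n M) R) :=
    Finset.univ.image fun b : B => lsum b.1.1 (c b) (b.1.2 + 1) with hΛ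
  refine ⟨F0 ∪ (Λ ∪ Fp.image C), ?_, ?_⟩
  · intro x hx
    simp only [Finset.coe_union, Set.mem_union, Finset.mem_coe] at hx
    rcases hx with hx | hx | hx
    · exact hF0 hx
    · obtain ⟨b, -, rfl⟩ := Finset.mem_image.1 hx
      exact hcI b
    · obtain ⟨r, hr, rfl⟩ := Finset.mem_image.1 hx
      exact hFp hr
  have hsub := subset_pcl opP ((F0 ∪ (Λ ∪ Fp.image C) : Finset _) : Set (MvPolynomial (DVar n M) R))
  have hJ := pcl_perfect opP ((F0 ∪ (Λ ∪ Fp.image C) : Finset _) : Set (MvPolynomial (DVar n M) R))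
  set J := pcl opP ((F0 ∪ (Λ ∪ Fp.image C) : Finset _) : Set (MvPolynomial (DVar n M) R)) with hJdef
  have hQ := colon_perfect opP hJ h
  have hJQ : J ≤ colonEl J h := fun x hx => mem_colonEl.2 (J.mul_mem_right _ hx)
  have hIQ : I ≤ colonEl J h := by
    refine reduce H ?_ ?_
    · intro r hr
      apply hJQ
      have : I.comap C ≤ J.comap C := by
        refine hple.trans (pcl_le ?_ (hcomap J hJ))
        intro x hx
        have hx : x ∈ Fp := hx
        refine hsub ?_
        rw [Finset.mem_coe, Finset.mem_union, Finset.mem_union]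
        exact Or.inr (Or.inr (Finset.mem_image_of_mem _ hx))
      exact this hr
    · intro u d hud
      obtain ⟨b, hb, hbd, φ, rfl⟩ := hBall u d hud
      obtain ⟨e, -, he, G, s, hlead, hG, hs⟩ :=
        trans_all H b.1 (c ⟨b, hb⟩) (hc ⟨b, hb⟩) b.2 (hB b hb).1.1 φ
      refine ⟨G, s, e, he.trans hbd, hlead, hG I hI.1 (hcI ⟨b, hb⟩), hG _ hQ.1 (hJQ (hsub ?_)), ?_⟩
      · rw [Finset.mem_coe, Finset.mem_union, Finset.mem_union]
        exact Or.inr (Or.inl (Finset.mem_image_of_mem _ (Finset.mem_univ (⟨b, hb⟩ : B))))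
      · intro g hg
        have h1 := hs _ hQ g hg
        have h2 : h * g ∈ colonEl J h := by
          obtain ⟨t, ht⟩ : c ⟨b, hb⟩ b.2 * lsum b.1 (dcoef (c ⟨b, hb⟩)) b.2 ∣ h :=
            Finset.dvd_prod_of_mem
              (fun b : B => c b b.1.2 * lsum b.1.1 (dcoef (c b)) b.1.2) (Finset.mem_univ (⟨b, hb⟩ : B))
          have := (colonEl J h).mul_mem_left t h1
          rw [ht]
          rw [← ht]
          convert this using 1
          rw [ht]
          ring
        rw [mem_colonEl] at h2 ⊢
        apply hJ.2.2
        refine ⟨2, ?_⟩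
        have := J.mul_mem_left g h2
        convert this using 1
        ring
  intro x hx
  have hIx : I ≤ colonEl J x := by
    refine hI0.trans (pcl_le ?_ (colon_perfect opP hJ x))
    rw [Set.insert_subset_iff]
    refine ⟨mem_colonEl.2 ?_, fun y hy => mem_colonEl.2 (J.mul_mem_right _ (hsub ?_))⟩
    · rw [mul_comm]
      exact hIQ hx
    · rw [Finset.mem_coe, Finset.mem_union]
      exact Or.inl hy
  exact hJ.2.2 ⟨2, by rw [sq]; exact hIx hx⟩
end

section
/- Let (R,e) be a D*-ring with R a ℚ-algebra having the ascending chain condition on perfect D-ideals, and let S be a D*-algebra over (R,e) that is finitely D-generated. Then S has the ascending chain condition on perfect D-ideals. -/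
open scoped BigOperators

variable {K : Type} [Field K] {A : Type} [CommRing A] [Algebra K A] {M : ℕ}

namespace DAux

/-- The ideal quotient `(I : a)`. -/
def colon (I : Ideal A) (a : A) : Ideal A where
  carrier := {b | a * b ∈ I}
  add_mem' := by
    intro x y hx hy
    simp only [Set.mem_ofPred_eq, mul_add] at *
    exact I.add_mem hx hy
  zero_mem' := by simp
  smul_mem' := by
    intro c x hx
    simp only [Set.mem_ofPred_eq, smul_eq_mul] at *
    have := I.mul_mem_left c hx
    rwa [mul_left_comm] at this

theorem mem_colon {I : Ideal A} {a b : A} : b ∈ colon I a ↔ a * b ∈ I := Iff.rfl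

theorem sigma_back {op : DStarOps K A M} {I : Ideal A} (h : IsPerfectDIdeal op I)
    {k : Fin M} (hk : k ∈ op.σset) {a : A} (ha : op.δ k a ∈ I) : a ∈ I :=
  h.2.1 k hk a (I.mul_mem_left _ ha)

theorem ksmul_mem (I : Ideal A) (c : K) {a : A} (ha : a ∈ I) : c • a ∈ I := by
  rw [Algebra.smul_def]; exact I.mul_mem_left _ ha

theorem colon_sigma {op : DStarOps K A M} {I : Ideal A} (h : IsPerfectDIdeal op I)
    {k : Fin M} (hk : k ∈ op.σset) {a b : A} (hab : a * b ∈ I) : a * op.δ k b ∈ I := by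
  apply h.2.1 k hk
  have h1 := h.1 k _ hab
  rw [op.sigma_mul k hk] at h1 ⊢
  have := I.mul_mem_left (a * op.δ k (op.δ k b)) h1
  convert this using 1; ring

theorem colon_delta {op : DStarOps K A M} {I : Ideal A} (h : IsPerfectDIdeal op I) :
    ∀ (n : ℕ) (k : Fin M), op.ν k = n → ∀ a b : A, a * b ∈ I → a * op.δ k b ∈ I := by
  intro n
  induction n using Nat.strong_induction_on with
  | _ n ih =>
  intro k hkn a b hab
  by_cases hk : k ∈ op.σset
  · exact colon_sigma h hk hab
  have hf := op.fac_mem k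
  have h1 := h.1 k _ hab
  rw [op.prod_rule k hk] at h1
  have h2 : ∑ pq ∈ Finset.univ.filter
          (fun pq : Fin M × Fin M =>
            pq.1 ∉ op.σset ∧ pq.2 ∉ op.σset ∧ op.fac pq.1 = op.fac k ∧ op.fac pq.2 = op.fac k ∧
              op.ν pq.1 + op.ν pq.2 ≤ op.ν k),
        op.α k pq.1 pq.2 • (op.δ pq.1 a * op.δ pq.2 b) ∈ I := by
    apply I.sum_mem
    rintro ⟨p, q⟩ hpq
    simp only [Finset.mem_filter, Finset.mem_univ, true_and] at hpq
    obtain ⟨hp, hq, -, -, hle⟩ := hpq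
    have := op.nu_delta p hp
    have := op.nu_delta q hq
    apply ksmul_mem
    have h3 := ih (op.ν q) (by omega) q rfl a b hab
    rw [mul_comm] at h3
    have h4 := ih (op.ν p) (by omega) p rfl _ _ h3
    rwa [mul_comm] at h4
  have h5 := (I.add_mem_iff_left h2).1 h1
  have h6 : a * op.δ (op.fac k) b ∈ I := colon_sigma h hf hab
  apply h.2.1 _ hf
  rw [op.sigma_mul _ hf]
  have h7 := I.mul_mem_left a h5
  have h8 : a * (op.δ (op.fac k) a * op.δ k b) ∈ I := by
    have h9 : a * (op.δ k a * op.δ (op.fac k) b) ∈ I := by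
      have := I.mul_mem_left (op.δ k a) h6
      convert this using 1; ring
    rw [mul_add] at h7
    exact (I.add_mem_iff_right h9).1 h7
  have := I.mul_mem_left (op.δ (op.fac k) (op.δ k b)) h8
  convert this using 1; ring

theorem colon_perfect {op : DStarOps K A M} {I : Ideal A} (h : IsPerfectDIdeal op I) (a : A) :
    IsPerfectDIdeal op (colon I a) := by
  refine ⟨fun k b hb => colon_delta h _ k rfl a b hb, ?_, ?_⟩
  · intro k hk b hb
    rw [mem_colon] at *
    apply h.2.1 k hk
    rw [op.sigma_mul k hk]
    have := I.mul_mem_left (op.δ k a) hb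
    convert this using 1; ring
  · rintro b ⟨n, hn⟩
    rw [mem_colon] at *
    apply h.2.2
    refine ⟨n + 1, ?_⟩
    have := I.mul_mem_left (a ^ n * b) hn
    convert this using 1; ring

/-- Perfect closure of a set. -/
def pc (op : DStarOps K A M) (F : Set A) : Ideal A :=
  sInf {I | IsPerfectDIdeal op I ∧ F ⊆ I}

theorem mem_pc {op : DStarOps K A M} {F : Set A} {a : A} :
    a ∈ pc op F ↔ ∀ I : Ideal A, IsPerfectDIdeal op I → F ⊆ I → a ∈ I := by
  simp [pc, Submodule.mem_sInf]

theorem pc_perfect (op : DStarOps K A M) (F : Set A) : IsPerfectDIdeal op (pc op F) := by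
  refine ⟨?_, ?_, ?_⟩
  · intro k a ha
    rw [mem_pc] at *
    exact fun I hI hF => hI.1 k a (ha I hI hF)
  · intro k hk a ha
    rw [mem_pc] at *
    exact fun I hI hF => hI.2.1 k hk a (ha I hI hF)
  · rintro a ⟨n, ha⟩
    rw [mem_pc] at *
    exact fun I hI hF => hI.2.2 ⟨n, ha I hI hF⟩

theorem subset_pc (op : DStarOps K A M) (F : Set A) : F ⊆ pc op F :=
  fun _ ha => mem_pc.2 fun _ _ hF => hF ha

theorem pc_le {op : DStarOps K A M} {F : Set A} {I : Ideal A} (hI : IsPerfectDIdeal op I)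
    (hF : F ⊆ I) : pc op F ≤ I := fun _ ha => mem_pc.1 ha I hI hF

theorem pc_mono (op : DStarOps K A M) {F G : Set A} (h : F ⊆ G) : pc op F ≤ pc op G :=
  pc_le (pc_perfect op G) (h.trans (subset_pc op G))

theorem sSup_perfect {op : DStarOps K A M} {s : Set (Ideal A)} (hne : s.Nonempty)
    (hd : DirectedOn (· ≤ ·) s) (hs : ∀ I ∈ s, IsPerfectDIdeal op I) :
    IsPerfectDIdeal op (sSup s) := by
  refine ⟨?_, ?_, ?_⟩
  · intro k a ha
    rw [Submodule.mem_sSup_of_directed hne hd] at *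
    obtain ⟨I, hI, h⟩ := ha
    exact ⟨I, hI, (hs I hI).1 k a h⟩
  · intro k hk a ha
    rw [Submodule.mem_sSup_of_directed hne hd] at *
    obtain ⟨I, hI, h⟩ := ha
    exact ⟨I, hI, (hs I hI).2.1 k hk a h⟩
  · rintro a ⟨n, ha⟩
    rw [Submodule.mem_sSup_of_directed hne hd] at *
    obtain ⟨I, hI, h⟩ := ha
    exact ⟨I, hI, (hs I hI).2.2 ⟨n, h⟩⟩

theorem finite_sub_of_directed {s : Set (Ideal A)} (hne : s.Nonempty)
    (hd : DirectedOn (· ≤ ·) s) {F : Set A} (hF : F.Finite) (h : F ⊆ (sSup s : Ideal A)) :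
    ∃ I ∈ s, F ⊆ (I : Set A) := by
  induction F, hF using Set.Finite.induction_on with
  | empty => obtain ⟨I, hI⟩ := hne; exact ⟨I, hI, by simp⟩
  | @insert a F _ _ ih =>
    obtain ⟨I, hI, h1⟩ := ih ((Set.subset_insert _ _).trans h)
    have h2 : a ∈ (sSup s : Ideal A) := h (Set.mem_insert _ _)
    rw [Submodule.mem_sSup_of_directed hne hd] at h2
    obtain ⟨I', hI', h2⟩ := h2
    obtain ⟨L, hL, h3, h4⟩ := hd I hI I' hI'
    exact ⟨L, hL, Set.insert_subset (h4 h2) (h1.trans h3)⟩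

/-- Finitely generated as a perfect ideal. -/
def PFG (op : DStarOps K A M) (I : Ideal A) : Prop := ∃ F : Set A, F.Finite ∧ I = pc op F

theorem pc_compact {op : DStarOps K A M} {X F : Set A} (hF : F.Finite)
    (h : F ⊆ pc op X) : ∃ Y ⊆ X, Y.Finite ∧ F ⊆ (pc op Y : Set A) := by
  let s : Set (Ideal A) := (pc op) '' {Y | Y ⊆ X ∧ Y.Finite}
  have hne : s.Nonempty := ⟨_, ∅, ⟨by simp, Set.finite_empty⟩, rfl⟩
  have hd : DirectedOn (· ≤ ·) s := by
    rintro _ ⟨Y, ⟨hY, hYf⟩, rfl⟩ _ ⟨Z, ⟨hZ, hZf⟩, rfl⟩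
    exact ⟨_, ⟨Y ∪ Z, ⟨Set.union_subset hY hZ, hYf.union hZf⟩, rfl⟩,
      pc_mono op Set.subset_union_left, pc_mono op Set.subset_union_right⟩
  have hp : IsPerfectDIdeal op (sSup s) := sSup_perfect hne hd (by
    rintro _ ⟨Y, _, rfl⟩; exact pc_perfect _ _)
  have hX : X ⊆ (sSup s : Ideal A) := by
    intro a ha
    have h1 : pc op {a} ≤ sSup s :=
      le_sSup ⟨{a}, ⟨by simpa using ha, Set.finite_singleton _⟩, rfl⟩
    exact h1 (subset_pc op {a} rfl)
  obtain ⟨_, ⟨Y, ⟨hY, hYf⟩, rfl⟩, h2⟩ := finite_sub_of_directed hne hd hF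
    (h.trans (pc_le hp hX))
  exact ⟨Y, hY, hYf, h2⟩

/-- ACC on perfect ideals implies every perfect ideal is finitely generated. -/
theorem pfg_of_acc {op : DStarOps K A M}
    (hACC : ∀ c : ℕ → Ideal A, Monotone c →
      (∀ i : ℕ, IsPerfectDIdeal op (c i)) → ∃ N : ℕ, ∀ m : ℕ, N ≤ m → c m = c N)
    {I : Ideal A} (hI : IsPerfectDIdeal op I) : PFG op I := by
  let Q := {J : Ideal A // IsPerfectDIdeal op J}
  have wf : WellFoundedGT Q := by
    rw [wellFoundedGT_iff_monotone_chain_condition]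
    intro c
    obtain ⟨N, hN⟩ := hACC (fun i => (c i).1) (fun i j hij => c.monotone hij) (fun i => (c i).2)
    exact ⟨N, fun m hm => Subtype.ext (hN m hm).symm⟩
  let s : Set Q := {J | ∃ F : Set A, F.Finite ∧ F ⊆ I ∧ J.1 = pc op F}
  obtain ⟨m, ⟨F, hF, hFI, hm⟩, hmax⟩ := wf.wf.has_min s
    ⟨⟨pc op ∅, pc_perfect _ _⟩, ∅, Set.finite_empty, by simp, rfl⟩
  refine ⟨F, hF, le_antisymm ?_ (pc_le hI hFI)⟩
  intro a ha
  by_contra hna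
  refine hmax ⟨pc op (insert a F), pc_perfect _ _⟩
    ⟨_, hF.insert a, Set.insert_subset ha hFI, rfl⟩ ?_
  show m < _
  rw [← Subtype.coe_lt_coe, hm]
  refine lt_of_le_of_ne (pc_mono op (Set.subset_insert _ _)) ?_
  intro h
  apply hna
  rw [h]
  exact subset_pc _ _ (Set.mem_insert _ _)

theorem acc_of_pfg {op : DStarOps K A M}
    (h : ∀ I : Ideal A, IsPerfectDIdeal op I → PFG op I) :
    ∀ c : ℕ → Ideal A, Monotone c →
      (∀ i : ℕ, IsPerfectDIdeal op (c i)) → ∃ N : ℕ, ∀ m : ℕ, N ≤ m → c m = c N := by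
  intro c hc hp
  have hne : (Set.range c).Nonempty := ⟨_, 0, rfl⟩
  have hd : DirectedOn (· ≤ ·) (Set.range c) := directedOn_range.2 hc.directed_le
  obtain ⟨F, hF, hFe⟩ := h _ (sSup_perfect hne hd (by rintro _ ⟨i, rfl⟩; exact hp i))
  obtain ⟨_, ⟨N, rfl⟩, hN⟩ := finite_sub_of_directed hne hd hF (hFe ▸ subset_pc op F)
  refine ⟨N, fun m hm => le_antisymm ?_ (hc hm)⟩
  calc c m ≤ sSup (Set.range c) := le_sSup ⟨m, rfl⟩
    _ = pc op F := hFe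
    _ ≤ c N := pc_le (hp N) hN

theorem finite_gens_insert {op : DStarOps K A M} {P : Ideal A}
    (hmax : ∀ I : Ideal A, IsPerfectDIdeal op I → P < I → PFG op I) {a : A} (ha : a ∉ P) :
    ∃ G : Set A, G.Finite ∧ G ⊆ P ∧ ∀ J : Ideal A, IsPerfectDIdeal op J → a ∈ J → G ⊆ J → P ≤ J := by
  have hlt : P < pc op (insert a (P : Set A)) := by
    refine lt_of_le_of_ne (fun z hz => subset_pc op _ (Set.mem_insert_of_mem _ hz)) ?_
    intro h
    apply ha
    rw [h]
    exact subset_pc _ _ (Set.mem_insert _ _)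
  obtain ⟨F, hF, hFe⟩ := hmax _ (pc_perfect _ _) hlt
  obtain ⟨Y, hY, hYf, hFY⟩ := pc_compact (op := op) (X := insert a (P : Set A)) hF
    (hFe ▸ subset_pc op F)
  refine ⟨Y ∩ P, hYf.inter_of_left _, Set.inter_subset_right, fun J hJ haJ hGJ => ?_⟩
  refine hlt.le.trans ?_
  rw [hFe]
  refine (pc_le (pc_perfect op Y) hFY).trans (pc_le hJ ?_)
  intro y hy
  rcases hY hy with rfl | h
  · exact haJ
  · exact hGJ ⟨hy, h⟩

/-- If some perfect ideal is not finitely generated, there is a maximal one, and it is prime. -/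
theorem exists_max {op : DStarOps K A M} {I : Ideal A} (hI : IsPerfectDIdeal op I)
    (hn : ¬ PFG op I) : ∃ P : Ideal A, IsPerfectDIdeal op P ∧ ¬ PFG op P ∧ P.IsPrime ∧
      ∀ J : Ideal A, IsPerfectDIdeal op J → P < J → PFG op J := by
  obtain ⟨P, -, hP⟩ := zorn_le_nonempty₀ {J : Ideal A | IsPerfectDIdeal op J ∧ ¬ PFG op J} (by
    intro c hc hchain y hy
    have hd := hchain.directedOn
    have hp : IsPerfectDIdeal op (sSup c) := sSup_perfect ⟨y, hy⟩ hd (fun J hJ => (hc hJ).1)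
    refine ⟨sSup c, ⟨hp, ?_⟩, fun z hz => le_sSup hz⟩
    rintro ⟨F, hF, hFe⟩
    obtain ⟨J, hJ, hFJ⟩ := finite_sub_of_directed ⟨y, hy⟩ hd hF (hFe ▸ subset_pc op F)
    refine (hc hJ).2 ⟨F, hF, le_antisymm ?_ (pc_le (hc hJ).1 hFJ)⟩
    rw [← hFe]; exact le_sSup hJ) I ⟨hI, hn⟩
  have hPp : IsPerfectDIdeal op P := hP.prop.1
  have hmax : ∀ J : Ideal A, IsPerfectDIdeal op J → P < J → PFG op J := by
    intro J hJ hlt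
    by_contra hnp
    exact hP.not_prop_of_gt hlt ⟨hJ, hnp⟩
  refine ⟨P, hPp, hP.prop.2, ⟨?_, ?_⟩, hmax⟩
  · rintro rfl
    refine hP.prop.2 ⟨{1}, Set.finite_singleton _, ?_⟩
    symm
    rw [Ideal.eq_top_iff_one]
    exact subset_pc _ _ rfl
  · intro a b hab
    by_contra hcon
    push Not at hcon
    obtain ⟨ha, hb⟩ := hcon
    obtain ⟨G, hG, hGP, hGm⟩ := finite_gens_insert hmax ha
    obtain ⟨G', hG', hGP', hGm'⟩ := finite_gens_insert hmax hb
    let F := insert (a * b) (G ∪ G')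
    have hJ := pc_perfect op F
    have hsub := subset_pc op F
    refine hP.prop.2 ⟨F, (hG.union hG').insert _, le_antisymm ?_ (pc_le hPp
      (Set.insert_subset hab (Set.union_subset hGP hGP')))⟩
    intro z hz
    have h1 : z ∈ colon (pc op F) b := by
      refine hGm _ (colon_perfect hJ b) ?_ ?_ hz
      · rw [mem_colon, mul_comm]; exact hsub (Set.mem_insert _ _)
      · intro g hg
        exact Ideal.mul_mem_left _ _ (hsub (Or.inr (Or.inl hg)))
    have h2 : z ∈ colon (pc op F) z := by
      refine hGm' _ (colon_perfect hJ z) ?_ ?_ hz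
      · rw [mem_colon, mul_comm]; exact h1
      · intro g hg
        exact Ideal.mul_mem_left _ _ (hsub (Or.inr (Or.inr hg)))
    exact hJ.2.2 ⟨2, by rw [pow_two]; exact h2⟩

/-- `σ`-transforms as a reflexive transitive closure. -/
def SigT (op : DStarOps K A M) : A → A → Prop :=
  Relation.ReflTransGen (fun c c' => ∃ k ∈ op.σset, c' = op.δ k c)

theorem sigT_back {op : DStarOps K A M} {I : Ideal A} (h : IsPerfectDIdeal op I)
    {c c' : A} (hc : SigT op c c') (hm : c' ∈ I) : c ∈ I := by
  induction hc with
  | refl => exact hm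
  | tail _ h2 ih =>
    obtain ⟨k, hk, rfl⟩ := h2
    exact ih (sigma_back h hk hm)

theorem colon_cancel {op : DStarOps K A M} {J : Ideal A} (h : IsPerfectDIdeal op J)
    {c c' H z : A} (hcH : c ∣ H) (hc : SigT op c c') (hz : c' * z ∈ colon J H) :
    z ∈ colon J H := by
  obtain ⟨b, rfl⟩ := hcH
  have h1 : c' ∈ colon J (c * b * z) := by
    rw [mem_colon] at *
    convert hz using 1; ring
  have h2 := sigT_back (colon_perfect h _) hc h1
  rw [mem_colon] at *
  refine h.2.2 ⟨2, ?_⟩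
  have := J.mul_mem_left (b * z) h2
  convert this using 1; ring

/-- Polynomial expressions in `x` of degree `< n` with coefficients in `T`. -/
def Low (T : Subalgebra K A) (x : A) : ℕ → A → Prop
  | 0, g => g = 0
  | n + 1, g => ∃ c ∈ T, ∃ r, Low T x n r ∧ g = c * x ^ n + r

section Low
variable {T : Subalgebra K A} {x : A}

theorem Low.zero (n : ℕ) : Low T x n 0 := by
  induction n with
  | zero => rfl
  | succ n ih => exact ⟨0, T.zero_mem, 0, ih, by ring⟩

theorem Low.add {n : ℕ} : ∀ {g h : A}, Low T x n g → Low T x n h → Low T x n (g + h) := by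
  induction n with
  | zero => rintro g h rfl rfl; simp [Low]
  | succ n ih =>
    rintro _ _ ⟨c, hc, r, hr, rfl⟩ ⟨c', hc', r', hr', rfl⟩
    exact ⟨c + c', T.add_mem hc hc', r + r', ih hr hr', by ring⟩

theorem Low.smul {n : ℕ} {t : A} (ht : t ∈ T) : ∀ {g : A}, Low T x n g → Low T x n (t * g) := by
  induction n with
  | zero => rintro g rfl; simp [Low]
  | succ n ih =>
    rintro _ ⟨c, hc, r, hr, rfl⟩
    exact ⟨t * c, T.mul_mem ht hc, t * r, ih hr, by ring⟩

theorem Low.neg {n : ℕ} {g : A} (h : Low T x n g) : Low T x n (-g) := by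
  have := h.smul (T.neg_mem T.one_mem)
  simpa using this

theorem Low.sub {n : ℕ} {g h : A} (hg : Low T x n g) (hh : Low T x n h) : Low T x n (g - h) := by
  rw [sub_eq_add_neg]; exact hg.add hh.neg

theorem Low.succ {n : ℕ} {g : A} (h : Low T x n g) : Low T x (n + 1) g :=
  ⟨0, T.zero_mem, g, h, by ring⟩

theorem Low.mono {n m : ℕ} (hnm : n ≤ m) {g : A} (h : Low T x n g) : Low T x m g := by
  induction m, hnm using Nat.le_induction with
  | base => exact h
  | succ m _ ih => exact ih.succ

theorem Low.mulX {n : ℕ} : ∀ {g : A}, Low T x n g → Low T x (n + 1) (x * g) := by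
  induction n with
  | zero => rintro g rfl; rw [mul_zero]; exact Low.zero _
  | succ n ih =>
    rintro _ ⟨c, hc, r, hr, rfl⟩
    exact ⟨c, hc, x * r, ih hr, by ring⟩

theorem Low.mulXpow {n : ℕ} {g : A} (h : Low T x n g) (k : ℕ) : Low T x (n + k) (x ^ k * g) := by
  induction k with
  | zero => simpa using h
  | succ k ih => have := ih.mulX; rwa [← mul_assoc, ← pow_succ'] at this

theorem Low.mul {m : ℕ} {h : A} (hh : Low T x m h) {n : ℕ} :
    ∀ {g : A}, Low T x n g → Low T x (m + n) (g * h) := by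
  induction n with
  | zero => rintro g rfl; rw [zero_mul]; exact Low.zero _
  | succ n ih =>
    rintro _ ⟨c, hc, r, hr, rfl⟩
    have h1 := ((hh.mulXpow n).smul hc).succ
    have h2 := (ih hr).succ
    have := h1.add h2
    rw [show (c * x ^ n + r) * h = c * (x ^ n * h) + r * h by ring]
    exact this

theorem Low.mem {T' : Subalgebra K A} (hT : T ≤ T') (hx : x ∈ T') {n : ℕ} :
    ∀ {g : A}, Low T x n g → g ∈ T' := by
  induction n with
  | zero => rintro g rfl; exact T'.zero_mem
  | succ n ih =>
    rintro _ ⟨c, hc, r, hr, rfl⟩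
    exact T'.add_mem (T'.mul_mem (hT hc) (T'.pow_mem hx n)) (ih hr)

theorem Low.sigma {op : DStarOps K A M} {k : Fin M} (hk : k ∈ op.σset) {T' : Subalgebra K A}
    (hT : ∀ t ∈ T, op.δ k t ∈ T') {n : ℕ} :
    ∀ {g : A}, Low T x n g → Low T' (op.δ k x) n (op.δ k g) := by
  have hpow : ∀ n, op.δ k (x ^ n) = op.δ k x ^ n := by
    intro n
    induction n with
    | zero => simpa using op.sigma_one k hk
    | succ n ih => rw [pow_succ, op.sigma_mul k hk, ih, pow_succ]
  induction n with
  | zero =>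
    rintro g rfl
    have := op.map_add k 0 0
    simp only [add_zero] at this
    show op.δ k 0 = 0
    simpa using this
  | succ n ih =>
    rintro _ ⟨c, hc, r, hr, rfl⟩
    exact ⟨_, hT c hc, _, ih hr, by rw [op.map_add, op.sigma_mul k hk, hpow]⟩

end Low

theorem delta_zero (op : DStarOps K A M) (k : Fin M) : op.δ k 0 = 0 := by
  have := op.map_add k 0 0
  simp only [add_zero] at this
  simpa using this

/-- The correction term of the Leibniz rule lies in `T'`. -/
theorem leibniz {op : DStarOps K A M} {T' : Subalgebra K A} {k : Fin M} (hk : k ∉ op.σset)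
    {a b : A} (ha : ∀ j, op.ν j < op.ν k → op.δ j a ∈ T')
    (hb : ∀ j, op.ν j < op.ν k → op.δ j b ∈ T') :
    ∃ t ∈ T', op.δ k (a * b) = op.δ k a * op.δ (op.fac k) b + op.δ (op.fac k) a * op.δ k b + t := by
  refine ⟨_, ?_, op.prod_rule k hk a b⟩
  apply T'.sum_mem
  rintro ⟨p, q⟩ hpq
  simp only [Finset.mem_filter, Finset.mem_univ, true_and] at hpq
  obtain ⟨hp, hq, -, -, hle⟩ := hpq
  have := op.nu_delta p hp
  have := op.nu_delta q hq
  exact T'.smul_mem (T'.mul_mem (ha p (by omega)) (hb q (by omega))) _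

theorem nu_fac_lt {op : DStarOps K A M} {k : Fin M} (hk : k ∉ op.σset) :
    op.ν (op.fac k) < op.ν k := by
  have := op.nu_delta k hk
  rw [op.nu_sigma _ (op.fac_mem k)]; omega

theorem adjoin_delta {op : DStarOps K A M} {X : Set A} {T' : Subalgebra K A} {C : Set (Fin M)}
    (hC : ∀ j ∈ C, ∀ p, op.ν p < op.ν j → p ∈ C)
    (h1 : ∀ j ∈ C, op.δ j 1 ∈ T') (hX : ∀ j ∈ C, ∀ y ∈ X, op.δ j y ∈ T') {y : A}
    (hy : y ∈ Algebra.adjoin K X) : ∀ j ∈ C, op.δ j y ∈ T' := by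
  induction hy using Algebra.adjoin_induction with
  | mem y hy => exact fun j hj => hX j hj y hy
  | algebraMap r =>
    intro j hj
    rw [Algebra.algebraMap_eq_smul_one, op.map_smul]
    exact T'.smul_mem (h1 j hj) r
  | add a b _ _ ha hb =>
    intro j hj
    rw [op.map_add]; exact T'.add_mem (ha j hj) (hb j hj)
  | mul a b _ _ ha hb =>
    intro j hj
    by_cases hs : j ∈ op.σset
    · rw [op.sigma_mul j hs]; exact T'.mul_mem (ha j hj) (hb j hj)
    · obtain ⟨t, ht, he⟩ := leibniz (T' := T') hs (fun p hp => ha p (hC j hj p hp))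
        (fun p hp => hb p (hC j hj p hp))
      have hf := hC j hj _ (nu_fac_lt hs)
      rw [he]
      exact T'.add_mem (T'.add_mem (T'.mul_mem (ha j hj) (hb _ hf)) (T'.mul_mem (ha _ hf) (hb j hj))) ht

/-- Derivative of a monomial expression. -/
theorem delta_monomial {op : DStarOps K A M} {T U T' : Subalgebra K A} {x : A} {k : Fin M}
    (hk : k ∉ op.σset) (hTU : T ≤ U) (hx : x ∈ U)
    (hU : ∀ y ∈ U, ∀ j, op.ν j < op.ν k → op.δ j y ∈ T') (hT : ∀ y ∈ T, op.δ k y ∈ T')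
    (n : ℕ) : ∀ c ∈ T, op.δ k (c * x ^ n) -
      op.δ (op.fac k) ((n : A) * c * x ^ (n - 1)) * op.δ k x ∈ T' := by
  have hs := op.fac_mem k
  have hl := nu_fac_lt hk
  have e1 : ∀ n : ℕ, op.δ (op.fac k) (n : A) = n := by
    intro n
    induction n with
    | zero => simpa using delta_zero op _
    | succ n ih => push_cast; rw [op.map_add, ih, op.sigma_one _ hs]
  induction n with
  | zero =>
    intro c hc
    simp only [pow_zero, mul_one, Nat.cast_zero, zero_mul, delta_zero, sub_zero]
    exact hT c hc
  | succ n ih =>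
    intro c hc
    have hcn : c * x ^ n ∈ U := U.mul_mem (hTU hc) (U.pow_mem hx n)
    obtain ⟨t, ht, he⟩ := leibniz (T' := T') (a := c * x ^ n) (b := x) hk (hU _ hcn) (hU _ hx)
    have h1 := T'.add_mem (T'.mul_mem (ih c hc) (hU x hx _ hl)) ht
    convert h1 using 1
    rw [show c * x ^ (n + 1) = c * x ^ n * x by ring, he]
    rcases n with _ | n
    · simp [delta_zero]
      ring
    · simp only [op.sigma_mul _ hs, e1, Nat.add_sub_cancel, pow_succ]
      push_cast
      ring

/-- Derivative of a polynomial expression, with separant `s`. -/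
theorem delta_low {op : DStarOps K A M} {T U T' : Subalgebra K A} {x : A} {k : Fin M}
    (hk : k ∉ op.σset) (hTU : T ≤ U) (hx : x ∈ U)
    (hU : ∀ y ∈ U, ∀ j, op.ν j < op.ν k → op.δ j y ∈ T') (hT : ∀ y ∈ T, op.δ k y ∈ T')
    (n : ℕ) : ∀ g, Low T x n g → ∃ s, Low T x (n - 1) s ∧
      op.δ k g - op.δ (op.fac k) s * op.δ k x ∈ T' := by
  induction n with
  | zero =>
    rintro g rfl
    exact ⟨0, Low.zero _, by simp [delta_zero]⟩
  | succ n ih =>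
    rintro _ ⟨c, hc, r, hr, rfl⟩
    obtain ⟨s, hs, h1⟩ := ih r hr
    refine ⟨(n : A) * c * x ^ (n - 1) + s, ?_, ?_⟩
    · rcases n with _ | n
      · simpa using hs
      · exact ⟨_, T.mul_mem (natCast_mem T _) hc, s, hs, rfl⟩
    · have h2 := T'.add_mem (delta_monomial hk hTU hx hU hT n c hc) h1
      convert h2 using 1
      rw [op.map_add, op.map_add]; ring

section Main

variable {V : Type} [LinearOrder V]

/-- Subalgebra generated by `ρ(R)` and the `x w` with `w < v`. -/
def Alt (Z : Set A) (x : V → A) (v : V) : Subalgebra K A :=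
  Algebra.adjoin K (Z ∪ x '' Set.Iio v)

/-- Subalgebra generated by `ρ(R)` and the `x w` with `w ≤ v`. -/
def Ale (Z : Set A) (x : V → A) (v : V) : Subalgebra K A :=
  Algebra.adjoin K (Z ∪ x '' Set.Iic v)

theorem Alt_le_Ale (Z : Set A) (x : V → A) (v : V) : Alt (K := K) Z x v ≤ Ale Z x v :=
  Algebra.adjoin_mono (Set.union_subset_union_right _ (Set.image_mono Set.Iio_subset_Iic_self))

theorem Ale_mono (Z : Set A) (x : V → A) {v w : V} (h : v ≤ w) :
    Ale (K := K) Z x v ≤ Ale Z x w :=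
  Algebra.adjoin_mono (Set.union_subset_union_right _ (Set.image_mono (Set.Iic_subset_Iic.2 h)))

theorem x_mem_Ale (Z : Set A) (x : V → A) (v : V) : x v ∈ Ale (K := K) Z x v :=
  Algebra.subset_adjoin (Or.inr ⟨v, le_refl v, rfl⟩)

theorem x_mem_Alt (Z : Set A) (x : V → A) {v w : V} (h : w < v) : x w ∈ Alt (K := K) Z x v :=
  Algebra.subset_adjoin (Or.inr ⟨w, h, rfl⟩)

theorem Z_mem_Alt {Z : Set A} (x : V → A) (v : V) {z : A} (h : z ∈ Z) :
    z ∈ Alt (K := K) Z x v :=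
  Algebra.subset_adjoin (Or.inl h)

/-- Elements of a generated subalgebra use finitely many generators. -/
theorem adjoin_cases (Z : Subalgebra K A) (x : V → A) (U : Set V) {g : A}
    (hg : g ∈ Algebra.adjoin K ((Z : Set A) ∪ x '' U)) :
    g ∈ Z ∨ ∃ v ∈ U, g ∈ Ale (K := K) (Z : Set A) x v := by
  have key : ∀ a b : A, (a ∈ Z ∨ ∃ v ∈ U, a ∈ Ale (K := K) (Z : Set A) x v) →
      (b ∈ Z ∨ ∃ v ∈ U, b ∈ Ale (K := K) (Z : Set A) x v) →
      (a ∈ Z ∧ b ∈ Z) ∨ ∃ v ∈ U, a ∈ Ale (K := K) (Z : Set A) x v ∧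
        b ∈ Ale (K := K) (Z : Set A) x v := by
    rintro a b (ha | ⟨v, hv, ha⟩) (hb | ⟨w, hw, hb⟩)
    · exact Or.inl ⟨ha, hb⟩
    · exact Or.inr ⟨w, hw, Algebra.subset_adjoin (Or.inl ha), hb⟩
    · exact Or.inr ⟨v, hv, ha, Algebra.subset_adjoin (Or.inl hb)⟩
    · rcases le_total v w with h | h
      · exact Or.inr ⟨w, hw, Ale_mono _ _ h ha, hb⟩
      · exact Or.inr ⟨v, hv, ha, Ale_mono _ _ h hb⟩
  induction hg using Algebra.adjoin_induction with
  | mem y hy =>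
    rcases hy with hy | ⟨v, hv, rfl⟩
    · exact Or.inl hy
    · exact Or.inr ⟨v, hv, x_mem_Ale _ _ _⟩
  | algebraMap r => exact Or.inl (Z.algebraMap_mem r)
  | add a b _ _ ha hb =>
    rcases key a b ha hb with ⟨h1, h2⟩ | ⟨v, hv, h1, h2⟩
    · exact Or.inl (Z.add_mem h1 h2)
    · exact Or.inr ⟨v, hv, Subalgebra.add_mem _ h1 h2⟩
  | mul a b _ _ ha hb =>
    rcases key a b ha hb with ⟨h1, h2⟩ | ⟨v, hv, h1, h2⟩
    · exact Or.inl (Z.mul_mem h1 h2)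
    · exact Or.inr ⟨v, hv, Subalgebra.mul_mem _ h1 h2⟩

theorem low_of_Ale (Z : Set A) (x : V → A) (v : V) {g : A} (hg : g ∈ Ale (K := K) Z x v) :
    ∃ n, Low (Alt (K := K) Z x v) (x v) n g := by
  have hone : ∀ t ∈ Alt (K := K) Z x v, Low (Alt (K := K) Z x v) (x v) 1 t :=
    fun t ht => ⟨t, ht, 0, rfl, by ring⟩
  induction hg using Algebra.adjoin_induction with
  | mem y hy =>
    rcases hy with hy | ⟨w, hw, rfl⟩
    · exact ⟨1, hone _ (Z_mem_Alt x v hy)⟩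
    · rcases lt_or_eq_of_le (show w ≤ v from hw) with h | rfl
      · exact ⟨1, hone _ (x_mem_Alt _ _ h)⟩
      · exact ⟨2, 1, Subalgebra.one_mem _, 0, Low.zero _, by ring⟩
  | algebraMap r => exact ⟨1, hone _ (Subalgebra.algebraMap_mem _ r)⟩
  | add a b _ _ ha hb =>
    obtain ⟨n, hn⟩ := ha
    obtain ⟨m, hm⟩ := hb
    exact ⟨max n m, (hn.mono (le_max_left _ _)).add (hm.mono (le_max_right _ _))⟩
  | mul a b _ _ ha hb =>
    obtain ⟨n, hn⟩ := ha
    obtain ⟨m, hm⟩ := hb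
    exact ⟨_, hm.mul hn⟩

/-- `P` contains an expression of degree `d` in `x v` with leading coefficient outside `P`. -/
def HasDeg (K : Type) [Field K] [Algebra K A] (Z : Set A) (x : V → A) (P : Ideal A)
    (v : V) (d : ℕ) : Prop :=
  ∃ c ∈ Alt (K := K) Z x v, c ∉ P ∧ ∃ r, Low (Alt (K := K) Z x v) (x v) d r ∧ c * x v ^ d + r ∈ P

/-- Compatibility of the variables with the operators. -/
structure Setup (op : DStarOps K A M) (Z : Subalgebra K A) (x : V → A) (s : Fin M → V → V) :
    Prop where
  x_s : ∀ k v, x (s k v) = op.δ k (x v)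
  mono : ∀ k v w, v < w → s k v < s k w
  nu : ∀ j k v w, op.ν j < op.ν k → v ≤ w → s j v < s k w
  Z_delta : ∀ k, ∀ z ∈ Z, op.δ k z ∈ Z

section
variable {op : DStarOps K A M} {Z : Subalgebra K A} {x : V → A} {s : Fin M → V → V}

theorem Setup.delta_Alt (h : Setup op Z x s) (k : Fin M) (v : V) {y : A}
    (hy : y ∈ Alt (K := K) (Z : Set A) x v) : op.δ k y ∈ Alt (K := K) (Z : Set A) x (s k v) := by
  refine adjoin_delta (op := op) (C := {j | op.ν j < op.ν k ∨ j = k}) ?_ ?_ ?_ hy k (Or.inr rfl)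
  · rintro j (hj | rfl) p hp
    · exact Or.inl (hp.trans hj)
    · exact Or.inl hp
  · exact fun j _ => Z_mem_Alt _ _ (h.Z_delta j 1 Z.one_mem)
  · rintro j hj y (hy | ⟨w, hw, rfl⟩)
    · exact Z_mem_Alt _ _ (h.Z_delta j y hy)
    · rw [← h.x_s]
      apply x_mem_Alt
      rcases hj with hj | rfl
      · exact h.nu _ _ _ _ hj (le_of_lt hw)
      · exact h.mono _ _ _ hw

theorem Setup.delta_Ale (h : Setup op Z x s) (k : Fin M) (v : V) {y : A}
    (hy : y ∈ Ale (K := K) (Z : Set A) x v) (j : Fin M) (hj : op.ν j < op.ν k) :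
    op.δ j y ∈ Alt (K := K) (Z : Set A) x (s k v) := by
  refine adjoin_delta (op := op) (C := {j | op.ν j < op.ν k}) ?_ ?_ ?_ hy j hj
  · exact fun j hj p hp => lt_trans hp hj
  · exact fun j _ => Z_mem_Alt _ _ (h.Z_delta j 1 Z.one_mem)
  · rintro j hj y (hy | ⟨w, hw, rfl⟩)
    · exact Z_mem_Alt _ _ (h.Z_delta j y hy)
    · rw [← h.x_s]
      exact x_mem_Alt _ _ (h.nu _ _ _ _ hj hw)

theorem Setup.delta_low (h : Setup op Z x s) {k : Fin M} (hk : k ∉ op.σset) (v : V) (n : ℕ) {g : A}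
    (hg : Low (Alt (K := K) (Z : Set A) x v) (x v) n g) :
    ∃ t, Low (Alt (K := K) (Z : Set A) x v) (x v) (n - 1) t ∧
      op.δ k g - op.δ (op.fac k) t * x (s k v) ∈ Alt (K := K) (Z : Set A) x (s k v) := by
  rw [h.x_s]
  exact DAux.delta_low hk (Alt_le_Ale _ _ _) (x_mem_Ale _ _ _)
    (fun y hy j hj => h.delta_Ale k v hy j hj) (fun y hy => h.delta_Alt k v hy) n g hg

theorem Setup.delta_mon (h : Setup op Z x s) {k : Fin M} (hk : k ∉ op.σset) (v : V) (n : ℕ) {c : A}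
    (hc : c ∈ Alt (K := K) (Z : Set A) x v) :
      op.δ k (c * x v ^ n) - op.δ (op.fac k) ((n : A) * c * x v ^ (n - 1)) * x (s k v)
        ∈ Alt (K := K) (Z : Set A) x (s k v) := by
  rw [h.x_s]
  exact delta_monomial hk (Alt_le_Ale _ _ _) (x_mem_Ale _ _ _)
    (fun y hy j hj => h.delta_Ale k v hy j hj) (fun y hy => h.delta_Alt k v hy) n c hc

theorem sigma_pow {k : Fin M} (hk : k ∈ op.σset) (y : A) (n : ℕ) :
    op.δ k (y ^ n) = op.δ k y ^ n := by
  induction n with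
  | zero => simpa using op.sigma_one k hk
  | succ n ih => rw [pow_succ, op.sigma_mul k hk, ih, pow_succ]

theorem not_hasDeg_zero {P : Ideal A} {v : V} : ¬ HasDeg K (Z : Set A) x P v 0 := by
  rintro ⟨c, hc, hcP, r, hr, h⟩
  have hr : r = 0 := hr
  subst hr
  apply hcP
  simpa using h

theorem Setup.hasDeg_delta (h : Setup op Z x s) {P : Ideal A} (hP : IsPerfectDIdeal op P)
    (hQ : ∀ n : ℕ, 0 < n → IsUnit (n : A)) {k : Fin M} (hk : k ∉ op.σset) {v : V} (m : ℕ) :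
    HasDeg K (Z : Set A) x P v m → HasDeg K (Z : Set A) x P (s k v) 1 := by
  induction m using Nat.strong_induction_on with
  | _ m ih =>
  intro hm
  rcases m with _ | m
  · exact absurd hm not_hasDeg_zero
  by_cases hlow : HasDeg K (Z : Set A) x P v m
  · exact ih m (by omega) hlow
  obtain ⟨c, hc, hcP, r, hr, hf⟩ := hm
  obtain ⟨t, ht, h1⟩ := h.delta_low hk v _ hr
  have h2 := h.delta_mon hk v (m + 1) hc
  have h3 := hP.1 k _ hf
  simp only [Nat.add_sub_cancel] at ht h2
  set S := ((m + 1 : ℕ) : A) * c * x v ^ m + t with hS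
  have hcm : ((m + 1 : ℕ) : A) * c ∈ Alt (K := K) (Z : Set A) x v :=
    Subalgebra.mul_mem _ (natCast_mem _ _) hc
  have hSP : S ∉ P := by
    intro hSP
    refine hlow ⟨_, hcm, ?_, t, ht, hSP⟩
    intro hh
    exact hcP ((Ideal.unit_mul_mem_iff_mem P (hQ (m + 1) (by omega))).1 hh)
  have hSA : S ∈ Ale (K := K) (Z : Set A) x v :=
    Low.mem (T := Alt (K := K) (Z : Set A) x v) (n := m + 1) (Alt_le_Ale _ _ _)
      (x_mem_Ale _ _ _) ⟨_, hcm, t, ht, hS⟩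
  refine ⟨op.δ (op.fac k) S, h.delta_Ale k v hSA _ (nu_fac_lt hk),
    fun hh => hSP (sigma_back hP (op.fac_mem k) hh), _, ⟨_, Subalgebra.add_mem _ h2 h1, 0, rfl, rfl⟩, ?_⟩
  convert h3 using 1
  rw [hS, op.map_add, op.map_add]
  ring

theorem Setup.hasDeg_step (h : Setup op Z x s) {P : Ideal A} (hP : IsPerfectDIdeal op P)
    (hQ : ∀ n : ℕ, 0 < n → IsUnit (n : A)) (k : Fin M) {v : V} {m : ℕ}
    (hm : HasDeg K (Z : Set A) x P v m) : ∃ m' ≤ m, HasDeg K (Z : Set A) x P (s k v) m' := by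
  by_cases hk : k ∈ op.σset
  · obtain ⟨c, hc, hcP, r, hr, hf⟩ := hm
    refine ⟨m, le_rfl, op.δ k c, h.delta_Alt k v hc, fun hh => hcP (sigma_back hP hk hh), op.δ k r,
      ?_, ?_⟩
    · rw [h.x_s]
      exact Low.sigma hk (fun t ht => h.delta_Alt k v ht) hr
    · have := hP.1 k _ hf
      rwa [op.map_add, op.sigma_mul k hk, sigma_pow hk, ← h.x_s] at this
  · refine ⟨1, ?_, h.hasDeg_delta hP hQ hk m hm⟩
    rcases m with _ | m
    · exact absurd hm not_hasDeg_zero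
    · omega

/-- Existence of an element of `B ∩ P` of degree `d` in `x v` whose leading coefficient is a
`σ`-transform of `c`. -/
def Good (op : DStarOps K A M) (Z : Subalgebra K A) (x : V → A) (P B : Ideal A) (c : A) (d : ℕ)
    (v : V) : Prop :=
  ∃ c', SigT op c c' ∧ c' ∈ Alt (K := K) (Z : Set A) x v ∧ c' ∉ P ∧
    ∃ r, Low (Alt (K := K) (Z : Set A) x v) (x v) d r ∧ c' * x v ^ d + r ∈ B ∧ c' * x v ^ d + r ∈ P

theorem Setup.good_path (h : Setup op Z x s) {P B : Ideal A} (hP : IsPerfectDIdeal op P)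
    (hB : IsPerfectDIdeal op B)
    (hQ : ∀ n : ℕ, 0 < n → IsUnit (n : A)) {c : A} {d : ℕ} {u v : V}
    (hu : Good op Z x P B c d u)
    (hpath : Relation.ReflTransGen (fun u v => ∃ k, v = s k u) u v) :
    (∀ m < d, ¬ HasDeg K (Z : Set A) x P v m) → Good op Z x P B c d v := by
  induction hpath with
  | refl => exact fun _ => hu
  | @tail w v' _ hstep ih =>
    obtain ⟨k, rfl⟩ := hstep
    intro hmin
    obtain ⟨c', hcc, hc, hcP, r, hr, hfB, hfP⟩ := ih (by
      intro m hm hd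
      obtain ⟨m', hm', hd'⟩ := h.hasDeg_step hP hQ k hd
      exact hmin m' (by omega) hd')
    by_cases hk : k ∈ op.σset
    · refine ⟨op.δ k c', hcc.tail ⟨k, hk, rfl⟩, h.delta_Alt k w hc,
        fun hh => hcP (sigma_back hP hk hh), op.δ k r, ?_, ?_, ?_⟩
      · rw [h.x_s]
        exact Low.sigma hk (fun t ht => h.delta_Alt k w ht) hr
      · have := hB.1 k _ hfB
        rwa [op.map_add, op.sigma_mul k hk, sigma_pow hk, ← h.x_s] at this
      · have := hP.1 k _ hfP
        rwa [op.map_add, op.sigma_mul k hk, sigma_pow hk, ← h.x_s] at this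
    · have hd : HasDeg K (Z : Set A) x P w d := ⟨c', hc, hcP, r, hr, hfP⟩
      have h1 := h.hasDeg_delta hP hQ hk d hd
      have hd1 : d = 1 := by
        rcases d with _ | _ | d
        · exact absurd hd not_hasDeg_zero
        · rfl
        · exact absurd h1 (hmin 1 (by omega))
      subst hd1
      obtain ⟨t, ht, h2⟩ := h.delta_low hk w _ hr
      have ht : t = 0 := ht
      subst ht
      have h3 := h.delta_mon hk w 1 hc
      have h4 := Subalgebra.add_mem _ h3 h2
      have e : op.δ (op.fac k) c' * x (s k w) ^ 1 +
          (op.δ k (c' * x w ^ 1) -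
            op.δ (op.fac k) (((1 : ℕ) : A) * c' * x w ^ (1 - 1)) * x (s k w) +
          (op.δ k r - op.δ (op.fac k) 0 * x (s k w))) = op.δ k (c' * x w ^ 1 + r) := by
        rw [op.map_add, delta_zero]
        simp
        ring
      refine ⟨op.δ (op.fac k) c', hcc.tail ⟨_, op.fac_mem k, rfl⟩,
        h.delta_Ale k w (Alt_le_Ale _ _ _ hc) _ (nu_fac_lt hk),
        fun hh => hcP (sigma_back hP (op.fac_mem k) hh), _, ⟨_, h4, 0, rfl, rfl⟩, ?_, ?_⟩
      · have := hB.1 k _ hfB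
        rw [← e] at this
        simpa using this
      · have := hP.1 k _ hfP
        rw [← e] at this
        simpa using this

/-- The reduction step. -/
theorem Setup.reduce [WellFoundedLT V] (h : Setup op Z x s) {P B : Ideal A}
    (hP : IsPerfectDIdeal op P) (hB : IsPerfectDIdeal op B)
    (hQ : ∀ n : ℕ, 0 < n → IsUnit (n : A))
    (hZ : ∀ z ∈ Z, z ∈ P → z ∈ B)
    (W : Set (V × ℕ)) (cf : V × ℕ → A)
    (hW : ∀ u ∈ W, Good op Z x P B (cf u) u.2 u.1)
    (hcancel : ∀ u ∈ W, ∀ c', SigT op (cf u) c' → ∀ z, c' * z ∈ B → z ∈ B)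
    (hbasis : ∀ v e, HasDeg K (Z : Set A) x P v e → (∀ m < e, ¬ HasDeg K (Z : Set A) x P v m) →
      ∃ u ∈ W, Relation.ReflTransGen (fun u v => ∃ k, v = s k u) u.1 v ∧ u.2 ≤ e) (v : V) :
    ∀ g ∈ Ale (K := K) (Z : Set A) x v, g ∈ P → g ∈ B := by
  induction v using WellFoundedLT.induction with
  | _ v ih =>
  have hlt : ∀ g ∈ Alt (K := K) (Z : Set A) x v, g ∈ P → g ∈ B := by
    intro g hg hgP
    rcases adjoin_cases Z x _ hg with h1 | ⟨w, hw, h1⟩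
    · exact hZ g h1 hgP
    · exact ih w hw g h1 hgP
  have hlow : ∀ n g, Low (Alt (K := K) (Z : Set A) x v) (x v) n g → g ∈ P → g ∈ B := by
    intro n
    induction n with
    | zero => rintro g rfl _; exact B.zero_mem
    | succ n ihn =>
      rintro _ ⟨c, hc, r, hr, rfl⟩ hgP
      by_cases hcP : c ∈ P
      · have h1 := hlt c hc hcP
        have h2 : r ∈ P := (P.add_mem_iff_right (P.mul_mem_right _ hcP)).1 hgP
        exact B.add_mem (B.mul_mem_right _ h1) (ihn r hr h2)
      · have hd : ∃ e, HasDeg K (Z : Set A) x P v e := ⟨n, c, hc, hcP, r, hr, hgP⟩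
        classical
        have hdn : Nat.find hd ≤ n := Nat.find_min' hd ⟨c, hc, hcP, r, hr, hgP⟩
        obtain ⟨u, hu, hpath, hle⟩ := hbasis v _ (Nat.find_spec hd) (fun m hm => Nat.find_min hd hm)
        obtain ⟨c', hcc, hc', hcP', r', hr', hfB, hfP⟩ := h.good_path hP hB hQ (hW u hu) hpath
          (fun m hm => Nat.find_min hd (by omega))
        obtain ⟨j, rfl⟩ : ∃ j, n = u.2 + j := ⟨n - u.2, by omega⟩
        apply hcancel u hu c' hcc
        have e : c' * (c * x v ^ (u.2 + j) + r) =
            (c' * r - c * (x v ^ j * r')) + c * x v ^ j * (c' * x v ^ u.2 + r') := by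
          rw [pow_add]; ring
        have hgP' := P.mul_mem_left c' hgP
        rw [e] at hgP' ⊢
        refine B.add_mem (ihn _ ((hr.smul hc').sub ((hr'.mulXpow j).smul hc)) ?_)
          (B.mul_mem_left _ hfB)
        exact (P.add_mem_iff_left (P.mul_mem_left _ hfP)).1 hgP'
  intro g hg hgP
  obtain ⟨n, hn⟩ := low_of_Ale _ _ _ hg
  exact hlow n g hn hgP

/-- The basis theorem, in abstract form. -/
theorem Setup.pfg [WellFoundedLT V] (h : Setup op Z x s)
    (hQ : ∀ n : ℕ, 0 < n → IsUnit (n : A))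
    (htop : ∀ g : A, g ∈ Algebra.adjoin K ((Z : Set A) ∪ x '' Set.univ))
    (hZfin : ∀ P : Ideal A, IsPerfectDIdeal op P → ∃ F : Set A, F.Finite ∧ F ⊆ P ∧
      ∀ J : Ideal A, IsPerfectDIdeal op J → F ⊆ J → ∀ z ∈ Z, z ∈ P → z ∈ J)
    (hdickson : ∀ T : Set (V × ℕ), ∃ W ⊆ T, W.Finite ∧ ∀ v ∈ T, ∃ u ∈ W,
      Relation.ReflTransGen (fun u v => ∃ k, v = s k u) u.1 v.1 ∧ u.2 ≤ v.2)
    (I : Ideal A) (hI : IsPerfectDIdeal op I) : PFG op I := by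
  by_contra hn
  obtain ⟨P, hP, hnP, hprime, hmax⟩ := exists_max hI hn
  apply hnP
  obtain ⟨F, hF, hFP, hFZ⟩ := hZfin P hP
  obtain ⟨W, hWT, hWfin, hWb⟩ := hdickson {u | HasDeg K (Z : Set A) x P u.1 u.2}
  have hch : ∀ u : V × ℕ, ∃ c f : A, u ∈ W → c ∈ Alt (K := K) (Z : Set A) x u.1 ∧ c ∉ P ∧ f ∈ P ∧
      ∃ r, Low (Alt (K := K) (Z : Set A) x u.1) (x u.1) u.2 r ∧ f = c * x u.1 ^ u.2 + r := by
    intro u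
    by_cases hu : u ∈ W
    · obtain ⟨c, hc, hcP, r, hr, hf⟩ := hWT hu
      exact ⟨c, _, fun _ => ⟨hc, hcP, hf, r, hr, rfl⟩⟩
    · exact ⟨0, 0, fun hh => absurd hh hu⟩
  choose cf ff hcf using hch
  let H : A := ∏ u ∈ hWfin.toFinset, cf u
  have hH : H ∉ P := by
    intro hh
    obtain ⟨u, hu, hu'⟩ := (hprime.prod_mem_iff).1 hh
    exact (hcf u (hWfin.mem_toFinset.1 hu)).2.1 hu'
  obtain ⟨G, hG, hGP, hGm⟩ := finite_gens_insert hmax hH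
  let E := F ∪ G ∪ ff '' W
  have hJ := pc_perfect op E
  have hsub := subset_pc op E
  have hEP : E ⊆ P := by
    rintro y ((hy | hy) | ⟨u, hu, rfl⟩)
    · exact hFP hy
    · exact hGP hy
    · exact (hcf u hu).2.2.1
  refine ⟨E, (hF.union hG).union (hWfin.image _), le_antisymm ?_ (pc_le hP hEP)⟩
  have hJB : pc op E ≤ colon (pc op E) H := fun y hy => Ideal.mul_mem_left _ _ hy
  have hB := colon_perfect hJ H
  have hZB : ∀ z ∈ Z, z ∈ P → z ∈ colon (pc op E) H := fun z hz hzP =>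
    hJB (hFZ _ hJ (fun y hy => hsub (Or.inl (Or.inl hy))) z hz hzP)
  have hred := h.reduce hP hB hQ hZB W cf (by
      intro u hu
      obtain ⟨h1, h2, h3, r, hr, h4⟩ := hcf u hu
      refine ⟨cf u, Relation.ReflTransGen.refl, h1, h2, r, hr, ?_, ?_⟩
      · rw [← h4]; exact hJB (hsub (Or.inr ⟨u, hu, rfl⟩))
      · rw [← h4]; exact h3)
    (by
      intro u hu c' hc' z hz
      exact colon_cancel hJ (Finset.dvd_prod_of_mem cf (hWfin.mem_toFinset.2 hu)) hc' hz)
    (by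
      intro v e hve _
      exact hWb (v, e) hve)
  intro z hz
  have hzB : z ∈ colon (pc op E) H := by
    rcases adjoin_cases Z x _ (htop z) with h1 | ⟨v, _, h1⟩
    · exact hZB z h1 hz
    · exact hred v z h1 hz
  have h2 : z ∈ colon (pc op E) z := by
    refine hGm _ (colon_perfect hJ z) ?_ ?_ hz
    · rw [mem_colon, mul_comm]; exact hzB
    · intro g hg
      exact Ideal.mul_mem_left _ _ (hsub (Or.inl (Or.inr hg)))
  exact hJ.2.2 ⟨2, by rw [pow_two]; exact h2⟩

end

end Main

/-- Index type of the variables: commutative words in the operators, and a generator index. -/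
def Var (M p : ℕ) : Type := Multiset (Fin M) × Fin p

/-- The key used to order the variables. -/
def vkey (ν : Fin M → ℕ) {p : ℕ} (v : Var M p) : ℕ ×ₗ (Lex (Fin M → ℕ) ×ₗ Fin p) :=
  toLex ((v.1.map (fun k => ν k + 1)).sum, toLex (toLex (fun k => v.1.count k), v.2))

theorem vkey_inj (ν : Fin M → ℕ) (p : ℕ) : Function.Injective (vkey ν (p := p)) := by
  rintro ⟨m, i⟩ ⟨m', i'⟩ h
  simp only [vkey, EmbeddingLike.apply_eq_iff_eq, Prod.mk.injEq] at h
  obtain ⟨-, h1, h2⟩ := h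
  have : m = m' := Multiset.ext.2 (fun k => congrFun h1 k)
  rw [this, h2]

/-- Applying an operator to a variable. -/
def vs (p : ℕ) (k : Fin M) (v : Var M p) : Var M p := (k ::ₘ v.1, v.2)

theorem vkey_mono (ν : Fin M → ℕ) {p : ℕ} (k : Fin M) (v w : Var M p)
    (h : vkey ν v < vkey ν w) : vkey ν (vs p k v) < vkey ν (vs p k w) := by
  have hc : ∀ m : Multiset (Fin M), toLex (fun j => (k ::ₘ m).count j) =
      toLex (Pi.single k 1) + toLex (fun j => m.count j) := by
    intro m
    apply toLex.symm.injective
    funext j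
    show (k ::ₘ m).count j = (Pi.single k 1 : Fin M → ℕ) j + m.count j
    rw [Multiset.count_cons, Pi.single_apply, add_comm]
  simp only [vkey, vs, Prod.Lex.toLex_lt_toLex, Multiset.map_cons, Multiset.sum_cons, hc,
    add_lt_add_iff_left, add_right_inj] at h ⊢
  exact h

theorem vkey_nu (ν : Fin M → ℕ) {p : ℕ} (j k : Fin M) (v w : Var M p) (hjk : ν j < ν k)
    (h : vkey ν v ≤ vkey ν w) : vkey ν (vs p j v) < vkey ν (vs p k w) := by
  simp only [vkey, vs, Prod.Lex.toLex_lt_toLex, Prod.Lex.toLex_le_toLex, Multiset.map_cons,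
    Multiset.sum_cons] at h ⊢
  left
  rcases h with h | h
  · omega
  · have := h.1; omega

theorem reach_add {p : ℕ} (m t : Multiset (Fin M)) (i : Fin p) :
    Relation.ReflTransGen (fun u v => ∃ k, v = vs p k u) ((m, i) : Var M p) (t + m, i) := by
  induction t using Multiset.induction_on with
  | empty => rw [zero_add]; exact Relation.ReflTransGen.refl
  | cons k t ih =>
    refine ih.tail ⟨k, ?_⟩
    show _ = (k ::ₘ (t + m), i)
    rw [Multiset.cons_add]

theorem dickson (M p : ℕ) (T : Set (Var M p × ℕ)) : ∃ W ⊆ T, W.Finite ∧ ∀ v ∈ T, ∃ u ∈ W,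
      Relation.ReflTransGen (fun u v => ∃ k, v = vs p k u) u.1 v.1 ∧ u.2 ≤ v.2 := by
  let φ : Var M p × ℕ → (Fin M → ℕ) × ℕ := fun v => (fun k => v.1.1.count k, v.2)
  let mn : Fin p → Set ((Fin M → ℕ) × ℕ) := fun i =>
    {y | Minimal (fun y => ∃ v ∈ T, v.1.2 = i ∧ φ v = y) y}
  have hfin : ∀ i, (mn i).Finite := fun i =>
    WellQuasiOrderedLE.finite_of_isAntichain (setOfPred_minimal_antichain _)
  have hch : ∀ i, ∀ y : (Fin M → ℕ) × ℕ, y ∈ mn i → ∃ v ∈ T, v.1.2 = i ∧ φ v = y :=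
    by
    intro i y hy
    have hy' : Minimal (fun y => ∃ v ∈ T, v.1.2 = i ∧ φ v = y) y := hy
    exact hy'.prop
  choose f hf using hch
  refine ⟨⋃ i, Set.range (fun y : mn i => f i y.1 y.2), ?_, ?_, ?_⟩
  · rintro _ h
    simp only [Set.mem_iUnion, Set.mem_range] at h
    obtain ⟨i, y, rfl⟩ := h
    exact (hf i y.1 y.2).1
  · refine Set.finite_iUnion (fun i => ?_)
    have := (hfin i).to_subtype
    exact Set.finite_range _
  · intro v hv
    obtain ⟨y, hle, hy⟩ := exists_minimal_le_of_wellFoundedLT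
      (fun y => ∃ w ∈ T, w.1.2 = v.1.2 ∧ φ w = y) (φ v) ⟨v, hv, rfl, rfl⟩
    have hy' : y ∈ mn v.1.2 := hy
    refine ⟨f _ y hy', Set.mem_iUnion.2 ⟨v.1.2, ⟨⟨y, hy'⟩, rfl⟩⟩, ?_⟩
    obtain ⟨-, h2, h3⟩ := hf _ y hy'
    generalize f _ y hy' = u at h2 h3
    obtain ⟨⟨m, i⟩, d⟩ := u
    obtain ⟨⟨m', i'⟩, d'⟩ := v
    simp only at h2
    subst h2
    rw [← h3] at hle
    have hle1 : m ≤ m' := Multiset.le_iff_count.2 (fun k => hle.1 k)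
    refine ⟨?_, hle.2⟩
    obtain ⟨t, rfl⟩ := Multiset.le_iff_exists_add.1 hle1
    rw [add_comm]
    exact reach_add m t i

end DAux

/-- Let `(R, e)` be a `D*`-ring with `R` a `ℚ`-algebra having the
ascending chain condition on perfect `D`-ideals, and let `S` be a `D*`-algebra over
`(R, e)` that is finitely `D`-generated. Then `S` has the ascending chain condition on
perfect `D`-ideals. -/
theorem acc_perfectDIdeals_of_finitely_dGenerated
    {K R S : Type} [Field K] [CommRing R] [Algebra K R] [Algebra ℚ R]
    [CommRing S] [Algebra K S]
    {M : ℕ}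
    (opR : DStarOps K R M) (opS : DStarOps K S M)
    (hσ : opS.σset = opR.σset) (hfac : opS.fac = opR.fac)
    (hν : opS.ν = opR.ν) (hα : opS.α = opR.α)
    -- S is a D*-algebra over (R, e): the structure map is a D-homomorphism
    (ρ : R →ₐ[K] S)
    (hρ : ∀ (k : Fin M) (r : R), opS.δ k (ρ r) = ρ (opR.δ k r))
    -- S is finitely D-generated over (R, e)
    (p : ℕ) (a : Fin p → S)
    (hgen : ∀ T : Subring S, (∀ r : R, ρ r ∈ T) →
      (∀ (k : Fin M) (x : S), x ∈ T → opS.δ k x ∈ T) →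
      (∀ i : Fin p, a i ∈ T) → ∀ s : S, s ∈ T)
    -- R has the ascending chain condition on perfect D-ideals
    (hACC : ∀ c : ℕ → Ideal R, Monotone c →
      (∀ i : ℕ, IsPerfectDIdeal opR (c i)) → ∃ N : ℕ, ∀ m : ℕ, N ≤ m → c m = c N) :
    ∀ c : ℕ → Ideal S, Monotone c →
      (∀ i : ℕ, IsPerfectDIdeal opS (c i)) → ∃ N : ℕ, ∀ m : ℕ, N ≤ m → c m = c N := by
  classical
  let Z : Subalgebra K S := ρ.range
  have hcomm : LeftCommutative opS.δ := ⟨fun k l b => opS.comm k l b⟩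
  let x : DAux.Var M p → S := fun v => v.1.foldr opS.δ (a v.2)
  letI : LinearOrder (DAux.Var M p) := LinearOrder.lift' (DAux.vkey opS.ν) (DAux.vkey_inj _ _)
  haveI : WellFoundedLT (DAux.Var M p) :=
    ⟨InvImage.wf (DAux.vkey opS.ν) (wellFounded_lt (α := ℕ ×ₗ (Lex (Fin M → ℕ) ×ₗ Fin p)))⟩
  have hset : DAux.Setup opS Z x (DAux.vs p) :=
    { x_s := fun k v => Multiset.foldr_cons _ _ _ _
      mono := fun k v w hvw => DAux.vkey_mono opS.ν k v w hvw
      nu := fun j k v w hjk hvw => DAux.vkey_nu opS.ν j k v w hjk hvw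
      Z_delta := by
        rintro k _ ⟨r, rfl⟩
        exact ⟨opR.δ k r, (hρ k r).symm⟩ }
  refine DAux.acc_of_pfg (fun I hI => hset.pfg ?_ ?_ ?_ (DAux.dickson M p) I hI)
  · intro n hn
    have h1 : IsUnit ((n : ℚ)) := isUnit_iff_ne_zero.2 (by positivity)
    have h2 := (h1.map (algebraMap ℚ R)).map ρ
    simpa using h2
  · intro g
    refine hgen (Algebra.adjoin K ((Z : Set S) ∪ x '' Set.univ)).toSubring ?_ ?_ ?_ g
    · intro r
      exact Algebra.subset_adjoin (Or.inl ⟨r, rfl⟩)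
    · intro k y hy
      refine DAux.adjoin_delta (op := opS) (C := Set.univ) (fun _ _ _ _ => Set.mem_univ _)
        ?_ ?_ hy k (Set.mem_univ k)
      · exact fun j _ => Algebra.subset_adjoin (Or.inl (hset.Z_delta j 1 Z.one_mem))
      · rintro j _ y (hy | ⟨w, _, rfl⟩)
        · exact Algebra.subset_adjoin (Or.inl (hset.Z_delta j y hy))
        · rw [← hset.x_s]
          exact Algebra.subset_adjoin (Or.inr ⟨_, Set.mem_univ _, rfl⟩)
    · intro i
      exact Algebra.subset_adjoin (Or.inr ⟨((0, i) : Multiset (Fin M) × Fin p), Set.mem_univ _,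
        Multiset.foldr_zero _ _⟩)
  · intro P hP
    have hcontr : ∀ J : Ideal S, IsPerfectDIdeal opS J → IsPerfectDIdeal opR (J.comap ρ) := by
      intro J hJ
      refine ⟨?_, ?_, ?_⟩
      · intro k r hr
        rw [Ideal.mem_comap] at *
        rw [← hρ]; exact hJ.1 k _ hr
      · intro k hk r hr
        rw [Ideal.mem_comap] at *
        rw [map_mul, ← hρ] at hr
        exact hJ.2.1 k (hσ ▸ hk) _ hr
      · rintro r ⟨n, hr⟩
        rw [Ideal.mem_comap] at *
        rw [map_pow] at hr
        exact hJ.2.2 ⟨n, hr⟩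
    obtain ⟨F, hF, hFe⟩ := DAux.pfg_of_acc hACC (hcontr P hP)
    refine ⟨ρ '' F, hF.image _, ?_, ?_⟩
    · rintro _ ⟨r, hr, rfl⟩
      have : r ∈ P.comap ρ := by rw [hFe]; exact DAux.subset_pc _ _ hr
      exact this
    · rintro J hJ hFJ _ ⟨r, rfl⟩ hr
      have h1 : r ∈ P.comap ρ := hr
      rw [hFe] at h1
      exact DAux.pc_le (hcontr J hJ) (fun y hy => hFJ ⟨y, hy, rfl⟩) h1
end
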